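/- Assume conditions (C1) and (C2) on b and σ. Then the HJB equation −∂_t v + H(t,x,D_x v,D²_x v) = 0 on O = [0,T)×Q with boundary/terminal condition v = −Pξ on ∂*O has at most one viscosity solution v satisfying a polynomial growth condition |v(t,x)| ≤ L₀(‖x‖^m + 1) for some L₀ > 0 and m > 3 and attaining the boundary values, i.e. if v₁ and v₂ are two viscosity solutions both satisfying such growth bounds and both equal to −Pξ on ∂*O, then v₁ = v₂ on [0,T]×Q̄. -/

import Mathlib

open Set Filter Topology Matrix

noncomputable section

/-- ℝ³, realized as `Fin 3 → ℝ`; the state variable is `x = (P, ξ, Θ)`. -/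
abbrev Vec3 := Fin 3 → ℝ
/-- Real 3×3 matrices (`S³` is the subset of symmetric ones). -/
abbrev Mat3 := Matrix (Fin 3) (Fin 3) ℝ

/-- Euclidean norm on ℝ³. -/
def enorm3 (x : Vec3) : ℝ := Real.sqrt (∑ j, x j ^ 2)

/-- `Q = (R,∞) × (0,∞) × (−H,H)`. -/
def Qset (R H : ℝ) : Set Vec3 := {x | R < x 0 ∧ 0 < x 1 ∧ x 2 ∈ Ioo (-H) H}

/-- `Q̄ = [R,∞) × [0,∞) × [−H,H]`. -/
def Qbar (R H : ℝ) : Set Vec3 := {x | R ≤ x 0 ∧ 0 ≤ x 1 ∧ x 2 ∈ Icc (-H) H}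

/-- The data of the stochastic control problem: the constants
`T, R, H, N, C, A, α, β, ϱ, k, γ`, the drift and volatility coefficients `b, σ` of the
pay-off process, the coefficients `θf, sf` of the quality process, the operating cost
`ℓf`, and the cut-off function `ζ`. -/
structure HJBData where
  T : ℝ
  R : ℝ
  H : ℝ
  N : ℝ
  C : ℝ
  A : ℝ
  α : ℝ
  β : ℝ
  ϱ : ℝ
  k : ℝ
  γ : ℝ
  b : ℝ → ℝ → ℝ × ℝ → ℝ
  σ : ℝ → ℝ → ℝ × ℝ → ℝ
  θf : ℝ → ℝ
  sf : ℝ → ℝ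
  ℓf : ℝ → ℝ
  ζ : ℝ → ℝ

namespace HJBData

variable (D : HJBData)

/-- The control set `U = [0,N] × [0,C]`, `u = (η,c)`. -/
def ctrl : Set (ℝ × ℝ) := Icc 0 D.N ×ˢ Icc 0 D.C

/-- The domain `[0,T] × Q̄`. -/
def dom : Set (ℝ × Vec3) := Icc 0 D.T ×ˢ Qbar D.R D.H

/-- `O = [0,T) × Q`. -/
def intO : Set (ℝ × Vec3) := Ico 0 D.T ×ˢ Qset D.R D.H

/-- The parabolic boundary `∂*O = ([0,T] × ∂Q) ∪ ({T} × Q)`. -/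
def parBdry : Set (ℝ × Vec3) :=
  {p | (p.1 ∈ Icc 0 D.T ∧ p.2 ∈ Qbar D.R D.H \ Qset D.R D.H) ∨
    (p.1 = D.T ∧ p.2 ∈ Qset D.R D.H)}

/-- The drift vector `f(t,x,u) = (b(t,P,u), 0, θ(t)ζ_H(Θ))`. -/
def drift (t : ℝ) (x : Vec3) (u : ℝ × ℝ) : Vec3 :=
  ![D.b t (x 0) u, 0, D.θf t * D.ζ (x 2)]

/-- The volatility vector
`σ⃗(t,x,u) = (σ(t,P,u), −ϱ⁻¹ ξ (Θ + A c^α η^β − ℓ(t)), s̄(t)ζ_H(Θ))`. -/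
def vol (t : ℝ) (x : Vec3) (u : ℝ × ℝ) : Vec3 :=
  ![D.σ t (x 0) u, -(D.ϱ⁻¹) * x 1 * (x 2 + D.A * u.2 ^ D.α * u.1 ^ D.β - D.ℓf t),
    D.sf t * D.ζ (x 2)]

/-- `a(t,x,u) = σ⃗ σ⃗ᵀ`. -/
def aMat (t : ℝ) (x : Vec3) (u : ℝ × ℝ) : Mat3 :=
  Matrix.vecMulVec (D.vol t x u) (D.vol t x u)

/-- The running cost `L(x,u) = k η^γ ξ`. -/
def runCost (x : Vec3) (u : ℝ × ℝ) : ℝ := D.k * u.1 ^ D.γ * x 1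

/-- The Hamiltonian
`H(t,x,z,M) = sup_{u∈U} [−f(t,x,u)·z − ½ tr(a(t,x,u)M) − L(x,u)]`. -/
def Ham (t : ℝ) (x : Vec3) (z : Vec3) (M : Mat3) : ℝ :=
  sSup ((fun u => -(∑ j, D.drift t x u j * z j) - (1 / 2) * (D.aMat t x u * M).trace
    - D.runCost x u) '' D.ctrl)

end HJBData

/-- The continuous linear map `h ↦ v·h` on ℝ³. -/
def dotCLM (v : Vec3) : Vec3 →L[ℝ] ℝ :=
  ∑ j, v j • (ContinuousLinearMap.proj j : Vec3 →L[ℝ] ℝ)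

/-- The continuous linear map `h ↦ M h` on ℝ³ associated to a 3×3 matrix `M`. -/
def matCLM (M : Mat3) : Vec3 →L[ℝ] Vec3 :=
  ContinuousLinearMap.pi fun i => dotCLM (M i)

/-- `φ ∈ C^{1,2}([0,T]×Q̄)`, with the data of its partial derivatives: `φt` is the
first partial derivative in `t`, `φx` the spatial gradient, `φxx` the spatial Hessian;
all exist and are continuous on `[0,T]×Q̄`. -/
structure IsC12 (T R H : ℝ) (φ φt : ℝ × Vec3 → ℝ) (φx : ℝ × Vec3 → Vec3)
    (φxx : ℝ × Vec3 → Mat3) : Prop where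
  contPhi : ContinuousOn φ (Icc 0 T ×ˢ Qbar R H)
  hasDerivT : ∀ p ∈ Icc 0 T ×ˢ Qbar R H,
    HasDerivWithinAt (fun s => φ (s, p.2)) (φt p) (Icc 0 T) p.1
  hasFDerivX : ∀ p ∈ Icc 0 T ×ˢ Qbar R H,
    HasFDerivWithinAt (fun y => φ (p.1, y)) (dotCLM (φx p)) (Qbar R H) p.2
  hasFDerivXX : ∀ p ∈ Icc 0 T ×ˢ Qbar R H,
    HasFDerivWithinAt (fun y => φx (p.1, y)) (matCLM (φxx p)) (Qbar R H) p.2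
  contT : ContinuousOn φt (Icc 0 T ×ˢ Qbar R H)
  contX : ContinuousOn φx (Icc 0 T ×ˢ Qbar R H)
  contXX : ContinuousOn φxx (Icc 0 T ×ˢ Qbar R H)

/-- `v` is a viscosity subsolution of the HJB equation
`−∂_t v + H(t,x,D_x v,D²_x v) = 0` on `O = [0,T)×Q` with boundary/terminal condition
`v = −Pξ` on `∂*O`. -/
def IsViscositySubsolution (D : HJBData) (v : ℝ × Vec3 → ℝ) : Prop :=
  ContinuousOn v D.dom ∧
  (∀ p ∈ D.parBdry, v p ≤ -(p.2 0 * p.2 1)) ∧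
  ∀ (φ φt : ℝ × Vec3 → ℝ) (φx : ℝ × Vec3 → Vec3) (φxx : ℝ × Vec3 → Mat3),
    IsC12 D.T D.R D.H φ φt φx φxx →
    ∀ p ∈ D.intO, IsLocalMaxOn (fun w => v w - φ w) D.dom p →
      -(φt p) + D.Ham p.1 p.2 (φx p) (φxx p) ≤ 0

/-- `v` is a viscosity supersolution of the HJB equation
`−∂_t v + H(t,x,D_x v,D²_x v) = 0` on `O = [0,T)×Q` with boundary/terminal condition
`v = −Pξ` on `∂*O`. -/
def IsViscositySupersolution (D : HJBData) (v : ℝ × Vec3 → ℝ) : Prop :=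
  ContinuousOn v D.dom ∧
  (∀ p ∈ D.parBdry, v p ≥ -(p.2 0 * p.2 1)) ∧
  ∀ (φ φt : ℝ × Vec3 → ℝ) (φx : ℝ × Vec3 → Vec3) (φxx : ℝ × Vec3 → Mat3),
    IsC12 D.T D.R D.H φ φt φx φxx →
    ∀ p ∈ D.intO, IsLocalMinOn (fun w => v w - φ w) D.dom p →
      -(φt p) + D.Ham p.1 p.2 (φx p) (φxx p) ≥ 0

/-- `v` is a viscosity solution: both a viscosity subsolution and supersolution. -/
def IsViscositySolution (D : HJBData) (v : ℝ × Vec3 → ℝ) : Prop :=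
  IsViscositySubsolution D v ∧ IsViscositySupersolution D v

/-!
STATEMENT 2 (uniqueness): under (C1), (C2), the HJB equation with boundary/terminal
condition `v = −Pξ` on `∂*O` has at most one viscosity solution with polynomial growth
(of some order `m > 3`) attaining the boundary values: if `v₁`, `v₂` are two such
viscosity solutions, then `v₁ = v₂` on `[0,T]×Q̄`.
-/

/-- A function differentiable at `t` is touched from above at `t` by a `C¹` function. -/
theorem exists_contDiff_touching_above {N : ℝ → ℝ} (hN : Continuous N) {t d : ℝ}
    (hd : HasDerivAt N d t) :
    ∃ θ : ℝ → ℝ, ContDiff ℝ 1 θ ∧ deriv θ t = d ∧ IsLocalMax (fun s => N s - θ s) t := by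
  set k : ℝ → ℝ := Function.update (fun s => s⁻¹ * (N (t + s) - N t - d * s)) 0 0 with hk
  have hkc : Continuous k := by
    rw [continuous_iff_continuousAt]
    intro s
    by_cases hs : s = 0
    · subst hs
      rw [hk, continuousAt_update_same]
      have h1 := hasDerivAt_iff_tendsto_slope_zero.1 hd
      have h2 : Tendsto (fun s : ℝ => s⁻¹ • (N (t + s) - N t) - d) (𝓝[≠] 0) (𝓝 (d - d)) :=
        h1.sub_const d
      rw [sub_self] at h2
      refine h2.congr' ?_
      filter_upwards [self_mem_nhdsWithin] with s hs
      have : s ≠ 0 := hs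
      simp only [smul_eq_mul]
      field_simp
    · rw [hk, continuousAt_update_of_ne hs]
      fun_prop (disch := assumption)
  have hk0 : k 0 = 0 := by simp [hk]
  have hke : ∀ s, N (t + s) - N t - d * s = s * k s := by
    intro s
    by_cases hs : s = 0
    · simp [hs]
    · simp [hk, hs]
  set g : ℝ → ℝ := fun r => sSup ((fun τ => |k (r * τ)|) '' Icc (-1) 1) with hg
  have hgc : Continuous g := by
    have : Continuous (↿(fun r τ : ℝ => |k (r * τ)|)) := by
      simp only [Function.HasUncurry.uncurry, id]
      fun_prop
    exact isCompact_Icc.continuous_sSup this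
  have hgb : ∀ r τ : ℝ, τ ∈ Icc (-1) 1 → |k (r * τ)| ≤ g r := by
    intro r τ hτ
    refine le_csSup ?_ ⟨τ, hτ, rfl⟩
    exact (isCompact_Icc.image_of_continuousOn (by fun_prop)).bddAbove
  have hgb' : ∀ r s : ℝ, |s| ≤ r → |k s| ≤ g r := by
    intro r s hs
    rcases eq_or_ne r 0 with rfl | hr
    · have : s = 0 := by simpa using hs
      subst this
      simpa using hgb 0 0 (by simp)
    · have hr' : 0 < r := lt_of_le_of_ne ((abs_nonneg s).trans hs) hr.symm
      have := hgb r (s / r) (by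
        rw [mem_Icc, ← abs_le, abs_div, abs_of_pos hr', div_le_one hr']; exact hs)
      rwa [mul_div_cancel₀ _ hr] at this
  have hg0 : g 0 = 0 := by simp [hg, hk0]
  have hgn : ∀ r, 0 ≤ r → 0 ≤ g r := fun r hr => by
    have := hgb' r 0 (by simpa using hr); simpa [hk0] using this
  set γ : ℝ → ℝ := fun u => g (max u 0) - g (max (-u) 0) with hγ
  have hγc : Continuous γ := by fun_prop
  have hγpos : ∀ u, 0 ≤ u → γ u = g u := by
    intro u hu; simp [hγ, hu, hg0]
  have hγodd : ∀ u, γ (-u) = - γ u := by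
    intro u; simp [hγ]
  set Φ : ℝ → ℝ := fun s => ∫ u in (0 : ℝ)..s, γ u with hΦ
  have hΦd : ∀ s, HasDerivAt Φ (γ s) s := fun s =>
    intervalIntegral.integral_hasDerivAt_right (hγc.intervalIntegrable _ _)
      hγc.stronglyMeasurable.stronglyMeasurableAtFilter hγc.continuousAt
  have hΦeven : ∀ s, Φ (-s) = Φ s := by
    intro s
    have h := intervalIntegral.integral_comp_neg (a := 0) (b := s) (f := γ)
    simp only [hΦ]
    simp only [neg_zero] at h
    rw [intervalIntegral.integral_symm, ← h]
    simp [hγodd]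
  have hΦpos : ∀ s, 0 ≤ s → s * g s ≤ Φ (2 * s) - Φ s ∧ 0 ≤ Φ s := by
    intro s hs
    constructor
    · have h1 : Φ (2 * s) - Φ s = ∫ u in s..(2 * s), γ u := by
        simp only [hΦ]
        rw [intervalIntegral.integral_interval_sub_left] <;>
          exact hγc.intervalIntegrable _ _
      rw [h1]
      have h2 : (∫ u in s..(2 * s), g s) ≤ ∫ u in s..(2 * s), γ u := by
        refine intervalIntegral.integral_mono_on (by linarith)
          (by simp) (hγc.intervalIntegrable _ _) ?_
        intro u hu
        rw [hγpos u (hs.trans hu.1)]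
        have := hu.1
        refine csSup_le ((nonempty_Icc.2 (by norm_num)).image _) ?_
        rintro _ ⟨τ, hτ, rfl⟩
        refine hgb' u _ ?_
        rw [abs_mul, abs_of_nonneg hs]
        have : |τ| ≤ 1 := abs_le.2 hτ
        nlinarith [abs_nonneg τ]
      simp only [intervalIntegral.integral_const, smul_eq_mul] at h2
      linarith
    · refine intervalIntegral.integral_nonneg hs ?_
      intro u hu
      rw [hγpos u hu.1]; exact hgn u hu.1
  have hΦge : ∀ s, s * k s ≤ Φ (2 * s) := by
    have key : ∀ s, |s| * |k s| ≤ Φ (2 * |s|) := by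
      intro s
      obtain ⟨h1, h2⟩ := hΦpos |s| (abs_nonneg s)
      have := mul_le_mul_of_nonneg_left (hgb' |s| s le_rfl) (abs_nonneg s)
      linarith
    intro s
    have h3 : Φ (2 * |s|) = Φ (2 * s) := by
      rcases abs_choice s with h | h
      · rw [h]
      · rw [h, mul_neg, hΦeven]
    rw [← h3]
    refine le_trans ?_ (key s)
    rw [← abs_mul]; exact le_abs_self _
  refine ⟨fun s => N t + d * (s - t) + Φ (2 * (s - t)), ?_, ?_, ?_⟩
  · have hΦC : ContDiff ℝ 1 Φ := by
      rw [contDiff_one_iff_deriv]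
      refine ⟨fun s => (hΦd s).differentiableAt, ?_⟩
      have : deriv Φ = γ := funext fun s => (hΦd s).deriv
      rw [this]; exact hγc
    fun_prop
  · have h0 : γ 0 = 0 := by simp [hγ]
    have h1 : HasDerivAt (fun s : ℝ => 2 * (s - t)) (2 * 1) t :=
      ((hasDerivAt_id t).sub_const t).const_mul 2
    have h2 : HasDerivAt Φ (γ 0) (2 * (t - t)) := by simpa using hΦd 0
    have h3 := h2.comp t h1
    have h4 : HasDerivAt (fun s : ℝ => N t + d * (s - t)) (d * 1) t :=
      (((hasDerivAt_id t).sub_const t).const_mul d).const_add _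
    have h5 := (h4.add h3).deriv
    rw [h0] at h5
    simpa [Function.comp_def, Pi.add_def] using h5
  · refine Eventually.of_forall fun s => ?_
    have h1 := hke (s - t)
    have h2 := hΦge (s - t)
    have h3 : Φ (2 * (t - t)) = 0 := by simp [hΦ]
    simp only [h3]
    rw [add_sub_cancel] at h1
    linarith

/-- A viscosity-type lower bound on the superdifferential gives monotonicity. -/
theorem monotoneOn_add_mul_of_superdiff {N : ℝ → ℝ} {a b C : ℝ}
    (hN : ContinuousOn N (Icc a b))
    (h : ∀ t ∈ Ioo a b, ∀ θ : ℝ → ℝ, ContDiff ℝ 1 θ →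
      IsLocalMax (fun s => N s - θ s) t → -C ≤ deriv θ t) :
    MonotoneOn (fun t => N t + C * t) (Icc a b) := by
  have main : ∀ C' > C, ∀ x ∈ Icc a b, ∀ y ∈ Icc a b, x ≤ y → N x + C' * x ≤ N y + C' * y := by
    intro C' hC' x hx y hy hxy
    by_contra hlt
    push Not at hlt
    set f : ℝ → ℝ := fun t => N t + C' * t with hf
    have hsub : Icc x y ⊆ Icc a b := Icc_subset_Icc hx.1 hy.2
    have hfc : ContinuousOn f (Icc x y) := (hN.mono hsub).add (by fun_prop)
    have hxy' : x < y := by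
      rcases hxy.lt_or_eq with h | h
      · exact h
      · subst h; exact absurd hlt (lt_irrefl _)
    have hlt' : f y < f x := hlt
    -- a point `c` slightly right of `x` with `f c > f y`
    obtain ⟨c, hc, hcf⟩ : ∃ c ∈ Ioo x y, f y < f c := by
      have h1 : Tendsto f (𝓝[Icc x y] x) (𝓝 (f x)) := hfc x ⟨le_rfl, hxy⟩
      have h2 : ∀ᶠ z in 𝓝[>] x, f y < f z := by
        have : 𝓝[>] x ≤ 𝓝[Icc x y] x := by
          rw [← nhdsWithin_Ioc_eq_nhdsGT hxy']
          exact nhdsWithin_mono _ Ioc_subset_Icc_self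
        exact (h1.mono_left this).eventually (lt_mem_nhds hlt')
      obtain ⟨c, hc1, hc2⟩ := (h2.and (Ioo_mem_nhdsGT hxy')).exists
      exact ⟨c, hc2, hc1⟩
    have hpos : 0 < (c - x) ^ 2 := by have := hc.1; have : 0 < c - x := by linarith
                                      positivity
    set K : ℝ := (|f x - f c| + 1) / (c - x) ^ 2 with hK
    have hK0 : 0 < K := by positivity
    set q : ℝ → ℝ := fun t => K * (max (c - t) 0) ^ 2 with hq
    have hqc : Continuous q := by fun_prop
    have hqd : ∀ t, HasDerivAt q (-(2 * K * max (c - t) 0)) t := by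
      have hm : ∀ s : ℝ, HasDerivAt (fun s : ℝ => (max s 0) ^ 2) (2 * max s 0) s := by
        intro s
        rcases lt_trichotomy s 0 with hs | hs | hs
        · have : (fun s : ℝ => (max s 0) ^ 2) =ᶠ[𝓝 s] fun _ => 0 := by
            filter_upwards [gt_mem_nhds hs] with z hz
            simp [max_eq_right hz.le]
          rw [max_eq_right hs.le, mul_zero]
          exact (hasDerivAt_const s (0 : ℝ)).congr_of_eventuallyEq this
        · subst hs
          rw [hasDerivAt_iff_isLittleO_nhds_zero]
          simp only [max_self, zero_add, mul_zero, smul_zero, sub_zero]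
          simp only [ne_eq, OfNat.ofNat_ne_zero, not_false_eq_true, zero_pow, sub_zero]
          have h1 : (fun h : ℝ => (max h 0) ^ 2) =O[𝓝 0] fun h : ℝ => h ^ 2 := by
            refine Asymptotics.IsBigO.of_bound 1 (Eventually.of_forall fun h => ?_)
            simp only [norm_pow, Real.norm_eq_abs, one_mul]
            refine pow_le_pow_left₀ (abs_nonneg _) ?_ 2
            rw [abs_of_nonneg (le_max_right _ _)]
            exact max_le (le_abs_self _) (abs_nonneg _)
          refine h1.trans_isLittleO ?_
          simpa using Asymptotics.isLittleO_pow_pow (𝕜 := ℝ) (m := 1) (n := 2) (by norm_num)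
        · have : (fun s : ℝ => (max s 0) ^ 2) =ᶠ[𝓝 s] fun s => s ^ 2 := by
            filter_upwards [lt_mem_nhds hs] with z hz
            simp [max_eq_left (le_of_lt hz)]
          rw [max_eq_left hs.le]
          have h2 := hasDerivAt_pow 2 s
          simp only [Nat.cast_ofNat, Nat.add_one_sub_one, pow_one] at h2
          exact h2.congr_of_eventuallyEq this
      intro t
      have h1 : HasDerivAt (fun t : ℝ => c - t) (-1) t := by
        simpa using (hasDerivAt_id t).const_sub c
      have h2 := ((hm (c - t)).comp t h1).const_mul K
      refine h2.congr_deriv ?_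
      ring
    have hqC : ContDiff ℝ 1 q := by
      rw [contDiff_one_iff_deriv]
      refine ⟨fun s => (hqd s).differentiableAt, ?_⟩
      have : deriv q = fun t => -(2 * K * max (c - t) 0) := funext fun s => (hqd s).deriv
      rw [this]; fun_prop
    obtain ⟨t, ht, hmax⟩ := isCompact_Icc.exists_isMaxOn (nonempty_Icc.2 hxy)
      (hfc.sub hqc.continuousOn)
    have hfq : ∀ s ∈ Icc x y, f s - q s ≤ f t - q t := fun s hs => hmax hs
    have hcq : q c = 0 := by simp [hq]
    have hq0 : ∀ s, 0 ≤ q s := fun s => by simp only [hq]; positivity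
    have htc := hfq c ⟨hc.1.le, hc.2.le⟩
    have htx : t ≠ x := by
      rintro rfl
      have h1 : q t = |f t - f c| + 1 := by
        simp only [hq, hK]
        rw [max_eq_left (by linarith [hc.1]), div_mul_cancel₀ _ hpos.ne']
      have := le_abs_self (f t - f c)
      linarith
    have hty : t ≠ y := by
      rintro rfl
      have := hq0 t
      linarith
    have htI : t ∈ Ioo x y := ⟨lt_of_le_of_ne ht.1 htx.symm, lt_of_le_of_ne ht.2 hty⟩
    have hd : HasDerivAt (fun s => -(C' * s) + q s) (-C' + -(2 * K * max (c - t) 0)) t := by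
      have h1 : HasDerivAt (fun s : ℝ => -(C' * s)) (-(C' * 1)) t :=
        ((hasDerivAt_id t).const_mul C').neg
      rw [mul_one] at h1
      exact h1.add (hqd t)
    have h5 := h t ⟨lt_of_le_of_lt hx.1 htI.1, lt_of_lt_of_le htI.2 hy.2⟩
      (fun s => -(C' * s) + q s) (by fun_prop) (by
        filter_upwards [Icc_mem_nhds htI.1 htI.2] with s hs
        have := hfq s hs
        simp only [hf] at this
        linarith)
    rw [hd.deriv] at h5
    have : 0 ≤ 2 * K * max (c - t) 0 := by positivity
    linarith
  intro x hx y hy hxy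
  refine le_of_forall_pos_le_add fun ε hε => ?_
  have h1 := main (C + ε / (y - x + 1)) (by
    have : 0 < y - x + 1 := by linarith
    have : 0 < ε / (y - x + 1) := by positivity
    linarith) x hx y hy hxy
  have h2 : 0 < y - x + 1 := by linarith
  have h3 : ε / (y - x + 1) * (y - x) ≤ ε := by
    rw [div_mul_eq_mul_div, div_le_iff₀ h2]; nlinarith
  simp only
  nlinarith

/-- Two functions whose superdifferentials are bounded from below by `h₁`, `h₂`, with
`h₁ + h₂ ≥ κ`, have a sum increasing at rate at least `κ`. -/
theorem le_sub_of_superdiff_add {N₁ N₂ h₁ h₂ : ℝ → ℝ} {a b C κ : ℝ} (hab : a ≤ b)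
    (hN₁ : ContinuousOn N₁ (Icc a b)) (hN₂ : ContinuousOn N₂ (Icc a b))
    (H₁ : ∀ t ∈ Ioo a b, ∀ θ : ℝ → ℝ, ContDiff ℝ 1 θ →
      IsLocalMax (fun s => N₁ s - θ s) t → h₁ t ≤ deriv θ t)
    (H₂ : ∀ t ∈ Ioo a b, ∀ θ : ℝ → ℝ, ContDiff ℝ 1 θ →
      IsLocalMax (fun s => N₂ s - θ s) t → h₂ t ≤ deriv θ t)
    (hC₁ : ∀ t ∈ Ioo a b, -C ≤ h₁ t) (hC₂ : ∀ t ∈ Ioo a b, -C ≤ h₂ t)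
    (hκ : ∀ t ∈ Ioo a b, κ ≤ h₁ t + h₂ t) :
    κ * (b - a) ≤ (N₁ b + N₂ b) - (N₁ a + N₂ a) := by
  rcases hab.lt_or_eq with hlt | rfl
  swap
  · simp
  have m₁ := monotoneOn_add_mul_of_superdiff hN₁
    fun t ht θ hθ hm => (hC₁ t ht).trans (H₁ t ht θ hθ hm)
  have m₂ := monotoneOn_add_mul_of_superdiff hN₂
    fun t ht θ hθ hm => (hC₂ t ht).trans (H₂ t ht θ hθ hm)
  set f : ℝ → ℝ := fun t => (N₁ t + C * t) + (N₂ t + C * t) with hf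
  have mf : MonotoneOn f (Icc a b) := m₁.add m₂
  have mf' : MonotoneOn f (uIcc a b) := by rwa [uIcc_of_le hab]
  have key : ∀ {N h : ℝ → ℝ}, ContinuousOn N (Icc a b) →
      (∀ t ∈ Ioo a b, ∀ θ : ℝ → ℝ, ContDiff ℝ 1 θ →
        IsLocalMax (fun s => N s - θ s) t → h t ≤ deriv θ t) →
      ∀ t ∈ Ioo a b, ∀ d, HasDerivAt N d t → h t ≤ d := by
    intro N h hN H t ht d hd
    have hext : Continuous (IccExtend hab ((Icc a b).domRestrict N)) :=
      continuousOn_iff_continuous_domRestrict.1 hN |>.Icc_extend'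
    have heq : IccExtend hab ((Icc a b).domRestrict N) =ᶠ[𝓝 t] N := by
      filter_upwards [Icc_mem_nhds ht.1 ht.2] with s hs
      rw [IccExtend_of_mem hab _ hs, domRestrict_apply]
    obtain ⟨θ, hθ, hθd, hmax⟩ := exists_contDiff_touching_above hext
      (hd.congr_of_eventuallyEq heq)
    have := H t ht θ hθ (hmax.congr (by
      filter_upwards [heq] with s hs
      rw [hs]))
    rwa [hθd] at this
  have hae : ∀ᵐ t, t ∈ Ioo a b → κ + 2 * C ≤ deriv f t := by
    filter_upwards [m₁.ae_differentiableWithinAt_of_mem, m₂.ae_differentiableWithinAt_of_mem]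
      with t h1 h2 ht
    have hn : Icc a b ∈ 𝓝 t := Icc_mem_nhds ht.1 ht.2
    have d1 := (h1 (Ioo_subset_Icc_self ht)).differentiableAt hn
    have d2 := (h2 (Ioo_subset_Icc_self ht)).differentiableAt hn
    have hlin : HasDerivAt (fun s : ℝ => C * s) C t := by
      simpa using (hasDerivAt_id t).const_mul C
    have e1 : HasDerivAt N₁ (deriv (fun t => N₁ t + C * t) t - C) t := by
      have := d1.hasDerivAt.sub hlin
      refine this.congr_of_eventuallyEq (Eventually.of_forall fun s => ?_)
      simp
    have e2 : HasDerivAt N₂ (deriv (fun t => N₂ t + C * t) t - C) t := by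
      have := d2.hasDerivAt.sub hlin
      refine this.congr_of_eventuallyEq (Eventually.of_forall fun s => ?_)
      simp
    have l1 := key hN₁ H₁ t ht _ e1
    have l2 := key hN₂ H₂ t ht _ e2
    have l3 := hκ t ht
    have e3 : deriv f t = deriv (fun t => N₁ t + C * t) t + deriv (fun t => N₂ t + C * t) t :=
      (d1.hasDerivAt.add d2.hasDerivAt).deriv
    linarith
  have hint := mf'.intervalIntegrable_deriv
  have hmem := mf'.intervalIntegral_deriv_mem_uIcc
  have hfab : 0 ≤ f b - f a := sub_nonneg.2 (mf ⟨le_rfl, hab⟩ ⟨hab, le_rfl⟩ hab)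
  rw [uIcc_of_le hfab] at hmem
  have hle : (∫ _ in a..b, (κ + 2 * C)) ≤ ∫ t in a..b, deriv f t := by
    refine intervalIntegral.integral_mono_ae_restrict hab (by simp) hint ?_
    rw [← MeasureTheory.restrict_Ioo_eq_restrict_Icc]
    exact (MeasureTheory.ae_restrict_iff' measurableSet_Ioo).2 hae
  simp only [intervalIntegral.integral_const, smul_eq_mul] at hle
  have := hmem.2
  simp only [hf] at this
  nlinarith

section Subgradients

open MeasureTheory MeasureTheory.Measure

/-- `y` is a subgradient of `f` at `X`. -/
def IsSubgrad {E : Type*} [NormedAddCommGroup E] [InnerProductSpace ℝ E] (f : E → ℝ)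
    (X y : E) : Prop :=
  ∀ X', f X + inner ℝ y (X' - X) ≤ f X'

variable {E : Type*} [NormedAddCommGroup E] [InnerProductSpace ℝ E] {f : E → ℝ}

theorem IsSubgrad.norm_le {L : NNReal} (hf : LipschitzWith L f) {X y : E}
    (h : IsSubgrad f X y) : ‖y‖ ≤ L := by
  have h1 := h (X + y)
  rw [add_sub_cancel_left, real_inner_self_eq_norm_sq] at h1
  have h2 := hf.dist_le_mul (X + y) X
  rw [dist_eq_norm, dist_eq_norm, add_sub_cancel_left] at h2
  have h3 := (le_abs_self _).trans h2
  by_contra hlt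
  push Not at hlt
  have : 0 < ‖y‖ := lt_of_le_of_lt L.2 hlt
  nlinarith

theorem IsSubgrad.monotone {X X' y y' : E} (h : IsSubgrad f X y) (h' : IsSubgrad f X' y') :
    0 ≤ inner ℝ (y' - y) (X' - X) := by
  have h1 := h X'
  have h2 := h' X
  rw [← neg_sub X' X, inner_neg_right] at h2
  rw [inner_sub_left]
  linarith

theorem convex_le_of_isSubgrad (hs : ∀ X, ∃ y, IsSubgrad f X y) (X d : E) {t : ℝ}
    (ht : t ∈ Icc (0 : ℝ) 1) : f (X + t • d) ≤ (1 - t) * f X + t * f (X + d) := by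
  obtain ⟨y, hy⟩ := hs (X + t • d)
  have h1 := hy X
  have h2 := hy (X + d)
  have e1 : X - (X + t • d) = -(t • d) := by abel
  have e2 : X + d - (X + t • d) = (1 - t) • d := by rw [sub_smul, one_smul]; abel
  rw [e1, inner_neg_right, inner_smul_right] at h1
  rw [e2, inner_smul_right] at h2
  have h3 := mul_le_mul_of_nonneg_left h1 (sub_nonneg.2 ht.2)
  have h4 := mul_le_mul_of_nonneg_left h2 ht.1
  nlinarith

/-- The resolvent `(I + ∂f)⁻¹` is defined everywhere. -/
theorem exists_isSubgrad_sub [FiniteDimensional ℝ E] {L : NNReal} (hf : LipschitzWith L f)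
    (hs : ∀ X, ∃ y, IsSubgrad f X y) (Z : E) : ∃ X, IsSubgrad f X (Z - X) := by
  have hc : Continuous fun X => f X + 1 / 2 * ‖X - Z‖ ^ 2 := by
    have := hf.continuous
    fun_prop
  obtain ⟨X, hX⟩ := hc.exists_forall_le (by
    have h1 : Tendsto (fun X : E => ‖X - Z‖) (cocompact E) atTop := by
      refine tendsto_atTop_mono (fun X => norm_sub_norm_le X Z) ?_
      exact tendsto_atTop_add_const_right _ _ (tendsto_norm_cocompact_atTop (E := E))
    have h2 : Tendsto (fun r : ℝ => r * (1 / 2 * r - L) + f Z) atTop atTop := by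
      refine tendsto_atTop_add_const_right _ _ (tendsto_id.atTop_mul_atTop₀ ?_)
      refine tendsto_atTop_add_const_right _ _ ?_
      exact tendsto_id.const_mul_atTop (by norm_num)
    refine tendsto_atTop_mono (fun X => ?_) (h2.comp h1)
    have h3 := hf.dist_le_mul X Z
    rw [dist_eq_norm, dist_eq_norm] at h3
    have h4 := (neg_le_of_abs_le h3)
    simp only [Function.comp]
    nlinarith)
  refine ⟨X, fun X' => ?_⟩
  set d := X' - X with hd
  have hX' : X + d = X' := by simp [hd]
  refine le_of_forall_pos_le_add fun ε hε => ?_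
  have key : ∀ t ∈ Ioc (0 : ℝ) 1, f X + inner ℝ (Z - X) d ≤ f X' + t * (1 / 2 * ‖d‖ ^ 2) := by
    intro t ht
    have h1 := hX (X + t • d)
    have h2 := convex_le_of_isSubgrad hs X d ⟨ht.1.le, ht.2⟩
    rw [hX'] at h2
    have e1 : X + t • d - Z = t • d - (Z - X) := by abel
    have e2 : ‖X - Z‖ = ‖Z - X‖ := norm_sub_rev _ _
    rw [e1, e2, norm_sub_sq_real (t • d), inner_smul_left, norm_smul, mul_pow, Real.norm_eq_abs,
      sq_abs] at h1
    simp only [conj_trivial] at h1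
    rw [real_inner_comm] at h1
    have h5 : t * (f X + inner ℝ (Z - X) d) ≤ t * (f X' + t * (1 / 2 * ‖d‖ ^ 2)) := by
      nlinarith
    exact le_of_mul_le_mul_left h5 ht.1
  have hpos : 0 < ‖d‖ ^ 2 + 1 := by positivity
  have h1 := key (min 1 (ε / (‖d‖ ^ 2 + 1))) ⟨lt_min one_pos (by positivity), min_le_left _ _⟩
  have h2 : min 1 (ε / (‖d‖ ^ 2 + 1)) * (1 / 2 * ‖d‖ ^ 2) ≤ ε := by
    calc _ ≤ ε / (‖d‖ ^ 2 + 1) * (‖d‖ ^ 2 + 1) := by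
          refine mul_le_mul (min_le_right _ _) (by nlinarith [sq_nonneg ‖d‖]) (by positivity)
            (by positivity)
      _ = ε := div_mul_cancel₀ _ hpos.ne'
  linarith

/-- Subgradients of a Lipschitz convex function are differentiable almost everywhere. -/
theorem exists_null_isSubgrad_diff [FiniteDimensional ℝ E] [MeasurableSpace E] [BorelSpace E]
    {L : NNReal} (hf : LipschitzWith L f) (hs : ∀ X, ∃ y, IsSubgrad f X y) :
    ∃ N : Set E, μH[(Module.finrank ℝ E : ℝ)] N = 0 ∧ ∀ X ∉ N, ∃ (y : E) (A : E →L[ℝ] E),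
      IsSubgrad f X y ∧ ∀ η > 0, ∃ r > 0, ∀ X', ‖X' - X‖ < r → ∀ y', IsSubgrad f X' y' →
        ‖y' - y - A (X' - X)‖ ≤ η * ‖X' - X‖ := by
  choose J hJ using exists_isSubgrad_sub hf hs
  have hmono : ∀ Z Z', ‖J Z' - J Z‖ ^ 2 ≤ inner ℝ (Z' - Z) (J Z' - J Z) := by
    intro Z Z'
    have h1 := (hJ Z).monotone (hJ Z')
    have e : Z' - J Z' - (Z - J Z) = (Z' - Z) - (J Z' - J Z) := by abel
    rw [e, inner_sub_left, real_inner_self_eq_norm_sq] at h1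
    linarith
  have hLip : LipschitzWith 1 J := by
    refine LipschitzWith.of_dist_le_mul fun Z' Z => ?_
    rw [dist_eq_norm, dist_eq_norm, NNReal.coe_one, one_mul]
    have h1 := hmono Z Z'
    have h2 := real_inner_le_norm (Z' - Z) (J Z' - J Z)
    by_contra hlt
    push Not at hlt
    have : 0 < ‖J Z' - J Z‖ := lt_of_le_of_lt (norm_nonneg _) hlt
    nlinarith
  have honto : ∀ X y, IsSubgrad f X y → J (X + y) = X := by
    intro X y hy
    have h1 := hy.monotone (hJ (X + y))
    have e : X + y - J (X + y) - y = -(J (X + y) - X) := by abel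
    rw [e, inner_neg_left, real_inner_self_eq_norm_sq] at h1
    have h2 : ‖J (X + y) - X‖ = 0 := by nlinarith [sq_nonneg ‖J (X + y) - X‖]
    exact sub_eq_zero.1 (norm_eq_zero.1 h2)
  set B₁ : Set E := {Z | ¬ DifferentiableAt ℝ J Z}
  set B₂ : Set E := {Z | DifferentiableAt ℝ J Z ∧ (fderiv ℝ J Z).det = 0}
  have hd0 : (0 : ℝ) ≤ (Module.finrank ℝ E : ℝ) := Nat.cast_nonneg _
  refine ⟨J '' B₁ ∪ J '' B₂, measure_union_null ?_ ?_, ?_⟩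
  · have h1 : μH[(Module.finrank ℝ E : ℝ)] B₁ = 0 := hLip.ae_differentiableAt
    have h2 := (hLip.lipschitzOnWith (s := B₁)).hausdorffMeasure_image_le hd0
    rw [h1, mul_zero] at h2
    exact le_antisymm h2 (zero_le)
  · exact addHaar_image_eq_zero_of_det_fderivWithin_eq_zero _
      (fun Z hZ => hZ.1.hasFDerivAt.hasFDerivWithinAt) (fun Z hZ => hZ.2)
  intro X hX
  obtain ⟨y, hy⟩ := hs X
  set Z := X + y with hZ
  have hJZ : J Z = X := honto X y hy
  have hdiff : DifferentiableAt ℝ J Z := by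
    by_contra h
    exact hX (Or.inl ⟨Z, h, hJZ⟩)
  have hdet : (fderiv ℝ J Z).det ≠ 0 := fun h => hX (Or.inr ⟨Z, ⟨hdiff, h⟩, hJZ⟩)
  set S := fderiv ℝ J Z with hS
  set Se := S.toContinuousLinearEquivOfDetNeZero hdet with hSe
  set W : E →L[ℝ] E := (Se.symm : E →L[ℝ] E) with hW
  have hWS : ∀ h, W (S h) = h := fun h => by
    have : Se h = S h := by simp [hSe]
    simp only [hW, ← this]
    simp
  set K := ‖W‖ + 1 with hK
  have hKpos : 0 < K := by positivity
  have hWle : ∀ h, ‖W h‖ ≤ K * ‖h‖ := fun h =>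
    (W.le_opNorm h).trans (by gcongr; simp [hK])
  refine ⟨y, W - ContinuousLinearMap.id ℝ E, hy, fun η hη => ?_⟩
  have hlin : ∀ ε > 0, ∃ δ > 0, ∀ Z', ‖Z' - Z‖ < δ →
      ‖J Z' - X - S (Z' - Z)‖ ≤ ε * ‖Z' - Z‖ := by
    intro ε hε
    have h1 := hdiff.hasFDerivAt.isLittleO.def hε
    obtain ⟨δ, hδ, h2⟩ := Metric.eventually_nhds_iff.1 h1
    refine ⟨δ, hδ, fun Z' hZ' => ?_⟩
    have h3 := h2 (by rwa [dist_eq_norm] : dist Z' Z < δ)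
    rwa [hJZ] at h3
  have hexp : ∀ {ε : ℝ} {Z' : E}, ε ≤ 1 / (2 * K) →
      ‖J Z' - X - S (Z' - Z)‖ ≤ ε * ‖Z' - Z‖ → ‖Z' - Z‖ ≤ 2 * K * ‖J Z' - X‖ := by
    intro ε Z' hε h
    have h1 := hWle (S (Z' - Z))
    rw [hWS] at h1
    have h2 : ‖S (Z' - Z)‖ ≤ ‖J Z' - X‖ + ‖J Z' - X - S (Z' - Z)‖ := by
      have := norm_sub_le (J Z' - X) (J Z' - X - S (Z' - Z))
      rwa [sub_sub_cancel] at this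
    have h3 : ‖J Z' - X - S (Z' - Z)‖ ≤ 1 / (2 * K) * ‖Z' - Z‖ := h.trans (by gcongr)
    have h4 : K * (1 / (2 * K) * ‖Z' - Z‖) = ‖Z' - Z‖ / 2 := by field_simp
    nlinarith
  set ε := min (1 / (2 * K)) (η / (2 * K * K)) with hε
  have hεpos : 0 < ε := lt_min (by positivity) (by positivity)
  obtain ⟨δ, hδ, hlinδ⟩ := hlin ε hεpos
  set δ' := δ / 2 with hδ'
  have hδ'pos : 0 < δ' := by positivity
  refine ⟨δ' / (2 * K) ^ 2, by positivity, fun X' hX' y' hy' => ?_⟩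
  set Z' := X' + y' with hZ'
  have hJZ' : J Z' = X' := honto X' y' hy'
  have hclose : ‖Z' - Z‖ < δ := by
    by_contra hfar
    push Not at hfar
    have hfar0 : 0 < ‖Z' - Z‖ := lt_of_lt_of_le hδ hfar
    set e := (‖Z' - Z‖)⁻¹ • (Z' - Z) with he
    have hen : ‖e‖ = 1 := by
      rw [he, norm_smul, norm_inv, norm_norm, inv_mul_cancel₀ hfar0.ne']
    have hZe : Z' - Z = ‖Z' - Z‖ • e := by
      rw [he, smul_smul, mul_inv_cancel₀ hfar0.ne', one_smul]
    set Z'' := Z + δ' • e with hZ''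
    have hn : ‖Z'' - Z‖ = δ' := by
      rw [hZ'', add_sub_cancel_left, norm_smul, hen, mul_one, Real.norm_eq_abs,
        abs_of_pos hδ'pos]
    have h1 := hexp (min_le_left _ _) (hlinδ Z'' (by rw [hn]; simp [hδ', hδ]))
    rw [hn] at h1
    have h2 := hmono Z Z''
    rw [hJZ, hZ'', add_sub_cancel_left, ← hZ'', inner_smul_left] at h2
    simp only [conj_trivial] at h2
    have h3 : 0 ≤ inner ℝ e (J Z' - J Z'') := by
      have h4 := hmono Z'' Z'
      have e1 : Z' - Z'' = (‖Z' - Z‖ - δ') • e := by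
        rw [sub_smul, ← hZe, hZ'']; abel
      rw [e1, inner_smul_left] at h4
      simp only [conj_trivial] at h4
      have h5 : 0 < ‖Z' - Z‖ - δ' := by rw [hδ']; linarith
      have h6 : 0 ≤ (‖Z' - Z‖ - δ') * inner ℝ e (J Z' - J Z'') := (sq_nonneg _).trans h4
      exact nonneg_of_mul_nonneg_right h6 h5
    have h7 : inner ℝ e (J Z'' - X) ≤ ‖X' - X‖ := by
      have h8 := real_inner_le_norm e (X' - X)
      rw [hen, one_mul] at h8
      rw [hJZ'] at h3
      have : inner ℝ e (X' - X) = inner ℝ e (X' - J Z'') + inner ℝ e (J Z'' - X) := by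
        rw [← inner_add_right]; congr 1; abel
      linarith
    have h9 : δ' ≤ (2 * K) ^ 2 * ‖X' - X‖ := by
      have h10 : δ' ^ 2 ≤ (2 * K) ^ 2 * (δ' * ‖X' - X‖) := by
        calc δ' ^ 2 ≤ (2 * K * ‖J Z'' - X‖) ^ 2 := by gcongr
          _ = (2 * K) ^ 2 * ‖J Z'' - X‖ ^ 2 := by ring
          _ ≤ (2 * K) ^ 2 * (δ' * inner ℝ e (J Z'' - X)) := by gcongr
          _ ≤ _ := by gcongr
      have : δ' * δ' ≤ δ' * ((2 * K) ^ 2 * ‖X' - X‖) := by linarith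
      exact le_of_mul_le_mul_left this hδ'pos
    rw [lt_div_iff₀ (by positivity)] at hX'
    linarith
  have h1 := hlinδ Z' hclose
  have h2 := hexp (min_le_left _ _) h1
  rw [hJZ'] at h1 h2
  have e1 : y' - y - (W - ContinuousLinearMap.id ℝ E) (X' - X) = -W (X' - X - S (Z' - Z)) := by
    rw [map_sub W, hWS]
    simp only [_root_.sub_apply, ContinuousLinearMap.id_apply, hZ, hZ']
    abel
  rw [e1, norm_neg]
  calc _ ≤ K * ‖X' - X - S (Z' - Z)‖ := hWle _
    _ ≤ K * (η / (2 * K * K) * (2 * K * ‖X' - X‖)) := by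
        gcongr
        refine h1.trans ?_
        gcongr
        exact min_le_right _ _
    _ = η * ‖X' - X‖ := by field_simp

/-- One-dimensional quadrature estimate. -/
theorem sub_le_of_increment_le {φ : ℝ → ℝ} {α β C : ℝ}
    (h : ∀ s ∈ Icc (0 : ℝ) 1, ∀ s' ∈ Icc (0 : ℝ) 1, s ≤ s' →
      φ s' - φ s ≤ (s' - s) * (α + s * β) + C * (s' - s) ^ 2) :
    φ 1 - φ 0 ≤ α + β / 2 := by
  have key : ∀ n : ℕ, 0 < n → φ 1 - φ 0 ≤ α + β / 2 + (C - β / 2) * (1 / (n : ℝ)) := by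
    intro n hn
    have hn' : (0 : ℝ) < n := Nat.cast_pos.2 hn
    have ind : ∀ i : ℕ, i ≤ n → φ (i / n) - φ 0 ≤
        i * α / n + β * (i * (i - 1) / 2) / n ^ 2 + C * i / n ^ 2 := by
      intro i
      induction i with
      | zero => intro _; simp
      | succ i ih =>
        intro hi
        have h1 := ih (by omega)
        have hi' : ((i : ℝ) + 1) ≤ n := by exact_mod_cast hi
        have hi0 : (0 : ℝ) ≤ i := Nat.cast_nonneg _
        have h2 := h (i / n) ⟨by positivity, by rw [div_le_one hn']; linarith⟩
          ((i + 1) / n) ⟨by positivity, by rw [div_le_one hn']; linarith⟩ (by gcongr; linarith)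
        push_cast
        have e : ((i : ℝ) + 1) / n - i / n = 1 / n := by ring
        rw [e] at h2
        have e2 : ((i : ℝ) + 1) * α / n + β * ((i + 1) * (i + 1 - 1) / 2) / n ^ 2
            + C * (i + 1) / n ^ 2 = (i * α / n + β * (i * (i - 1) / 2) / n ^ 2 + C * i / n ^ 2)
            + (1 / n * (α + i / n * β) + C * (1 / n) ^ 2) := by
          field_simp; ring
        linarith
    have h1 := ind n le_rfl
    rw [div_self hn'.ne'] at h1
    have e : (n : ℝ) * α / n + β * (n * (n - 1) / 2) / n ^ 2 + C * n / n ^ 2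
        = α + β / 2 + (C - β / 2) * (1 / (n : ℝ)) := by
      field_simp; ring
    linarith
  have hlim : Tendsto (fun n : ℕ => α + β / 2 + (C - β / 2) * (1 / (n : ℝ))) atTop
      (𝓝 (α + β / 2 + (C - β / 2) * 0)) :=
    (tendsto_one_div_atTop_nhds_zero_nat.const_mul _).const_add _
  rw [mul_zero, add_zero] at hlim
  exact ge_of_tendsto hlim (by filter_upwards [eventually_gt_atTop 0] with n hn using key n hn)

/-- Alexandrov's theorem for Lipschitz convex functions. -/
theorem exists_null_alexandrov [FiniteDimensional ℝ E] [MeasurableSpace E] [BorelSpace E]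
    {L : NNReal} (hf : LipschitzWith L f) (hs : ∀ X, ∃ y, IsSubgrad f X y) :
    ∃ N : Set E, μH[(Module.finrank ℝ E : ℝ)] N = 0 ∧ ∀ X ∉ N, ∃ (y : E) (A : E →L[ℝ] E),
      (∀ y', IsSubgrad f X y' → y' = y) ∧ (∀ a b, inner ℝ (A a) b = inner ℝ a (A b)) ∧
      (∀ a, 0 ≤ inner ℝ (A a) a) ∧
      ∀ η > 0, ∃ r > 0, ∀ h, ‖h‖ < r →
        |f (X + h) - f X - inner ℝ y h - 1 / 2 * inner ℝ (A h) h| ≤ η * ‖h‖ ^ 2 := by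
  obtain ⟨N, hN, H⟩ := exists_null_isSubgrad_diff hf hs
  refine ⟨N, hN, fun X hX => ?_⟩
  obtain ⟨y, A₀, hy, hA₀⟩ := H X hX
  have : CompleteSpace E := FiniteDimensional.complete ℝ E
  set A : E →L[ℝ] E := (1 / 2 : ℝ) • (A₀ + ContinuousLinearMap.adjoint A₀) with hA
  have hAq : ∀ h, inner ℝ (A h) h = inner ℝ (A₀ h) h := by
    intro h
    simp only [hA, _root_.smul_apply, _root_.add_apply,
      inner_smul_left, inner_add_left, ContinuousLinearMap.adjoint_inner_left, conj_trivial]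
    rw [real_inner_comm (A₀ h) h]; ring
  have hexp : ∀ η > 0, ∃ r > 0, ∀ h, ‖h‖ < r →
      |f (X + h) - f X - inner ℝ y h - 1 / 2 * inner ℝ (A h) h| ≤ η * ‖h‖ ^ 2 := by
    intro η hη
    obtain ⟨r, hr, hr'⟩ := hA₀ η hη
    refine ⟨r, hr, fun h hh => ?_⟩
    rw [hAq]
    choose g hg using fun s : ℝ => hs (X + s • h)
    have hg' : ∀ s ∈ Icc (0 : ℝ) 1,
        |inner ℝ (g s) h - inner ℝ y h - s * inner ℝ (A₀ h) h| ≤ s * (η * ‖h‖ ^ 2) := by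
      intro s hs
      have e0 : X + s • h - X = s • h := add_sub_cancel_left _ _
      have h0 : ‖s • h‖ = s * ‖h‖ := by rw [norm_smul, Real.norm_eq_abs, abs_of_nonneg hs.1]
      have h1 := hr' (X + s • h) (by
        rw [e0, h0]; nlinarith [norm_nonneg h, hs.1, hs.2]) (g s) (hg s)
      rw [e0, h0, map_smul] at h1
      have e : inner ℝ (g s) h - inner ℝ y h - s * inner ℝ (A₀ h) h
          = inner ℝ (g s - y - s • A₀ h) h := by
        simp only [inner_sub_left, inner_smul_left, conj_trivial]
      rw [e]
      refine (abs_real_inner_le_norm _ _).trans ?_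
      calc _ ≤ η * (s * ‖h‖) * ‖h‖ := by gcongr
        _ = _ := by ring
    have hinc : ∀ s s' : ℝ, f (X + s • h) + (s' - s) * inner ℝ (g s) h ≤ f (X + s' • h) := by
      intro s s'
      have h1 := hg s (X + s' • h)
      have e : X + s' • h - (X + s • h) = (s' - s) • h := by rw [sub_smul]; abel
      rwa [e, inner_smul_right] at h1
    set α := inner ℝ y h
    set β := inner ℝ (A₀ h) h
    set ρ := η * ‖h‖ ^ 2
    have hup := sub_le_of_increment_le (φ := fun s => f (X + s • h)) (α := α) (β := β + ρ)
      (C := |β + ρ|) (by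
        intro s hs s' hs' hss
        have h1 := hinc s' s
        have h2 := (abs_le.1 (hg' s' hs')).2
        have h3 : (s' - s) * inner ℝ (g s') h ≤ (s' - s) * (α + s' * (β + ρ)) :=
          mul_le_mul_of_nonneg_left (by linarith) (by linarith)
        have h4 : (s' - s) ^ 2 * (β + ρ) ≤ (s' - s) ^ 2 * |β + ρ| :=
          mul_le_mul_of_nonneg_left (le_abs_self _) (sq_nonneg _)
        nlinarith)
    have hlo := sub_le_of_increment_le (φ := fun s => -f (X + s • h)) (α := -α) (β := -(β - ρ))
      (C := 0) (by
        intro s hs s' hs' hss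
        have h1 := hinc s s'
        have h2 := (abs_le.1 (hg' s hs)).1
        have h3 : (s' - s) * (α + s * (β - ρ)) ≤ (s' - s) * inner ℝ (g s) h :=
          mul_le_mul_of_nonneg_left (by linarith) (by linarith)
        nlinarith)
    simp only [one_smul, zero_smul, add_zero] at hup hlo
    have hρ : 0 ≤ ρ := by positivity
    rw [abs_le]
    constructor <;> linarith
  refine ⟨y, A, fun y' hy' => ?_, ?_, ?_, hexp⟩
  · obtain ⟨r, hr, hr'⟩ := hA₀ 1 one_pos
    have := hr' X (by simpa using hr) y' hy'
    simp only [sub_self, map_zero, sub_zero, norm_zero, mul_zero] at this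
    exact sub_eq_zero.1 (norm_le_zero_iff.1 this)
  · intro a b
    simp only [hA, _root_.smul_apply, _root_.add_apply,
      inner_smul_left, inner_smul_right, inner_add_left, inner_add_right,
      ContinuousLinearMap.adjoint_inner_left, ContinuousLinearMap.adjoint_inner_right,
      conj_trivial]
    ring
  · intro a
    have key : ∀ η > 0, -(2 * η * ‖a‖ ^ 2) ≤ inner ℝ (A a) a := by
      intro η hη
      obtain ⟨r, hr, hr'⟩ := hexp η hη
      set s := r / (2 * (‖a‖ + 1)) with hsdef
      have hspos : 0 < s := by positivity
      have h1 := hr' (s • a) (by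
        rw [norm_smul, Real.norm_eq_abs, abs_of_pos hspos, hsdef, div_mul_eq_mul_div,
          div_lt_iff₀ (by positivity)]
        nlinarith [norm_nonneg a])
      have h2 := hy (X + s • a)
      rw [add_sub_cancel_left] at h2
      have h3 := (abs_le.1 h1).2
      simp only [map_smul, inner_smul_left, inner_smul_right, norm_smul, mul_pow, Real.norm_eq_abs,
        sq_abs, conj_trivial] at h2 h3
      have h4 : 0 ≤ s ^ 2 * (inner ℝ (A a) a + 2 * η * ‖a‖ ^ 2) := by nlinarith
      have := nonneg_of_mul_nonneg_right h4 (by positivity)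
      linarith
    refine le_of_forall_pos_le_add fun ε hε => ?_
    have h1 := key (ε / (2 * (‖a‖ ^ 2 + 1))) (by positivity)
    have h2 : 2 * (ε / (2 * (‖a‖ ^ 2 + 1))) * ‖a‖ ^ 2 ≤ ε := by
      have : 2 * (ε / (2 * (‖a‖ ^ 2 + 1))) * ‖a‖ ^ 2 = ε * (‖a‖ ^ 2 / (‖a‖ ^ 2 + 1)) := by
        field_simp
      rw [this]
      have h3 : ‖a‖ ^ 2 / (‖a‖ ^ 2 + 1) ≤ 1 := by
        rw [div_le_one (by positivity)]; linarith
      nlinarith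
    linarith

end Subgradients

section Envelope

variable {E : Type*} [NormedAddCommGroup E] [InnerProductSpace ℝ E]
  {α : Type*} [TopologicalSpace α] {K : Set α} {a : α → ℝ} {ξ : α → E}

/-- The upper envelope of the affine functions `X ↦ a k + ⟪ξ k, X⟫`, `k ∈ K`. -/
noncomputable def affineEnvelope (K : Set α) (a : α → ℝ) (ξ : α → E) (X : E) : ℝ :=
  sSup ((fun k => a k + inner ℝ (ξ k) X) '' K)

theorem continuousOn_affine (ha : ContinuousOn a K) (hξ : ContinuousOn ξ K) (X : E) :
    ContinuousOn (fun k => a k + inner ℝ (ξ k) X) K :=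
  ha.add (hξ.inner continuousOn_const)

theorem le_affineEnvelope (hK : IsCompact K) (ha : ContinuousOn a K) (hξ : ContinuousOn ξ K)
    {k : α} (hk : k ∈ K) (X : E) : a k + inner ℝ (ξ k) X ≤ affineEnvelope K a ξ X :=
  le_csSup (hK.image_of_continuousOn (continuousOn_affine ha hξ X)).bddAbove ⟨k, hk, rfl⟩

theorem exists_eq_affineEnvelope (hK : IsCompact K) (hne : K.Nonempty) (ha : ContinuousOn a K)
    (hξ : ContinuousOn ξ K) (X : E) : ∃ k ∈ K, affineEnvelope K a ξ X = a k + inner ℝ (ξ k) X := by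
  obtain ⟨k, hk, hmax⟩ := hK.exists_isMaxOn hne (continuousOn_affine ha hξ X)
  refine ⟨k, hk, le_antisymm (csSup_le (hne.image _) ?_) (le_affineEnvelope hK ha hξ hk X)⟩
  rintro _ ⟨k', hk', rfl⟩
  exact hmax hk'

theorem isSubgrad_affineEnvelope (hK : IsCompact K) (ha : ContinuousOn a K)
    (hξ : ContinuousOn ξ K) {k : α} (hk : k ∈ K) {X : E}
    (h : affineEnvelope K a ξ X = a k + inner ℝ (ξ k) X) :
    IsSubgrad (affineEnvelope K a ξ) X (ξ k) := by
  intro X'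
  have := le_affineEnvelope hK ha hξ hk X'
  rw [h, inner_sub_right]
  linarith

theorem exists_isSubgrad_affineEnvelope (hK : IsCompact K) (hne : K.Nonempty)
    (ha : ContinuousOn a K) (hξ : ContinuousOn ξ K) (X : E) :
    ∃ y, IsSubgrad (affineEnvelope K a ξ) X y := by
  obtain ⟨k, hk, h⟩ := exists_eq_affineEnvelope hK hne ha hξ X
  exact ⟨_, isSubgrad_affineEnvelope hK ha hξ hk h⟩

theorem exists_lipschitzWith_affineEnvelope (hK : IsCompact K) (hne : K.Nonempty)
    (ha : ContinuousOn a K) (hξ : ContinuousOn ξ K) :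
    ∃ L, LipschitzWith L (affineEnvelope K a ξ) := by
  obtain ⟨C, hC⟩ := hK.exists_bound_of_continuousOn hξ
  have key : ∀ X Y, affineEnvelope K a ξ X ≤ affineEnvelope K a ξ Y + C.toNNReal * dist X Y := by
    intro X Y
    obtain ⟨k, hk, h⟩ := exists_eq_affineEnvelope hK hne ha hξ X
    have h1 := le_affineEnvelope hK ha hξ hk Y
    have h2 := real_inner_le_norm (ξ k) (X - Y)
    rw [inner_sub_right] at h2
    have h3 : ‖ξ k‖ * ‖X - Y‖ ≤ C.toNNReal * dist X Y := by
      rw [dist_eq_norm]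
      gcongr
      exact (hC k hk).trans (Real.le_coe_toNNReal C)
    linarith
  exact ⟨C.toNNReal, LipschitzWith.of_le_add_mul _ key⟩

end Envelope

section Jets

open MeasureTheory MeasureTheory.Measure

variable {E : Type*} [NormedAddCommGroup E] [InnerProductSpace ℝ E]

/-- Two convex subgradients at points where a convex function is touched from above by
paraboloids of opening `lam` are Lipschitz dependent on the points. -/
theorem norm_slope_sub_le {F : E → ℝ} {lam : ℝ} (hlam : 0 < lam)
    (hs : ∀ X, ∃ y, IsSubgrad F X y) {X₁ X₂ p₁ p₂ : E}
    (h₁ : ∀ d, F (X₁ + d) ≤ F X₁ + inner ℝ p₁ d + lam * ‖d‖ ^ 2)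
    (h₂ : ∀ d, F (X₂ + d) ≤ F X₂ + inner ℝ p₂ d + lam * ‖d‖ ^ 2) :
    ‖p₁ - p₂‖ ≤ 2 * lam * ‖X₁ - X₂‖ := by
  obtain ⟨y, hy⟩ := hs X₁
  have hsq : ∀ v w : E, inner ℝ v ((2 * lam)⁻¹ • (v - w)) - inner ℝ w ((2 * lam)⁻¹ • (v - w))
      - lam * ‖(2 * lam)⁻¹ • (v - w)‖ ^ 2 = (4 * lam)⁻¹ * ‖v - w‖ ^ 2 := by
    intro v w
    rw [← inner_sub_left, inner_smul_right, norm_smul, real_inner_self_eq_norm_sq, mul_pow,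
      Real.norm_eq_abs, sq_abs]
    field_simp; ring
  have hyp : y = p₁ := by
    have h3 := h₁ ((2 * lam)⁻¹ • (y - p₁))
    have h4 := hy (X₁ + (2 * lam)⁻¹ • (y - p₁))
    rw [add_sub_cancel_left] at h4
    have h5 := hsq y p₁
    have h6 : (4 * lam)⁻¹ * ‖y - p₁‖ ^ 2 ≤ 0 := by linarith
    have h7 : ‖y - p₁‖ ^ 2 ≤ 0 := nonpos_of_mul_nonpos_right h6 (by positivity)
    have h8 : ‖y - p₁‖ = 0 := by nlinarith [norm_nonneg (y - p₁)]
    exact sub_eq_zero.1 (norm_eq_zero.1 h8)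
  subst hyp
  set d := (2 * lam)⁻¹ • (y - p₂) with hd
  have h3 := hy (X₂ + d)
  have h4 := h₂ d
  have h5 := hsq y p₂
  rw [← hd] at h5
  have h6 := h₁ (X₂ - X₁)
  rw [add_sub_cancel] at h6
  have e : X₂ + d - X₁ = (X₂ - X₁) + d := by abel
  rw [e, inner_add_right] at h3
  have h7 : (4 * lam)⁻¹ * ‖y - p₂‖ ^ 2 ≤ lam * ‖X₁ - X₂‖ ^ 2 := by
    rw [norm_sub_rev X₁ X₂]; linarith
  have h8 : ‖y - p₂‖ ^ 2 ≤ (2 * lam * ‖X₁ - X₂‖) ^ 2 := by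
    have := mul_le_mul_of_nonneg_left h7 (by positivity : 0 ≤ 4 * lam)
    rw [← mul_assoc, mul_inv_cancel₀ (by positivity)] at this
    linarith
  exact abs_le_of_sq_le_sq' h8 (by positivity) |>.2

/-- The transform `A ↦ λ - λ² A⁻¹` of a positive definite operator, in its
variational formulation. -/
theorem exists_infConvolution_operator [FiniteDimensional ℝ E] {A : E →L[ℝ] E} {ε lam : ℝ}
    (hε : 0 < ε) (hlam : 0 < lam)
    (hsym : ∀ a b, inner ℝ (A a) b = inner ℝ a (A b))
    (hpos : ∀ a, ε * ‖a‖ ^ 2 ≤ inner ℝ (A a) a) :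
    ∃ X V : E →L[ℝ] E, (∀ a b, inner ℝ (X a) b = inner ℝ a (X b)) ∧
      (∀ k, V k = 0 → k = 0) ∧
      (∀ k h, 1 / 2 * inner ℝ (X k) k ≤
        lam / 2 * ‖k‖ ^ 2 - lam * inner ℝ k h + 1 / 2 * inner ℝ (A h) h) ∧
      (∀ k, 1 / 2 * inner ℝ (X k) k =
        lam / 2 * ‖k‖ ^ 2 - lam * inner ℝ k (V k) + 1 / 2 * inner ℝ (A (V k)) (V k)) := by
  have hinj : Function.Injective (A : E →ₗ[ℝ] E) := by
    rw [← LinearMap.ker_eq_bot, LinearMap.ker_eq_bot']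
    intro a ha
    have h1 := hpos a
    have h2 : A a = 0 := ha
    rw [h2, inner_zero_left] at h1
    have h3 : ‖a‖ ^ 2 ≤ 0 := nonpos_of_mul_nonpos_right h1 hε
    have h4 : ‖a‖ = 0 := by nlinarith [norm_nonneg a]
    exact norm_eq_zero.1 h4
  set e := LinearEquiv.ofInjectiveEndo (A : E →ₗ[ℝ] E) hinj
  set W : E →L[ℝ] E := LinearMap.toContinuousLinearMap (e.symm : E →ₗ[ℝ] E)
  have hAW : ∀ k, A (W k) = k := fun k => e.apply_symm_apply k
  have hWsym : ∀ a b, inner ℝ (W a) b = inner ℝ a (W b) := by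
    intro a b
    conv_lhs => rw [← hAW b]
    rw [← hsym, hAW]
  set X : E →L[ℝ] E := lam • ContinuousLinearMap.id ℝ E - (lam ^ 2) • W with hX
  have hXk : ∀ k, X k = lam • k - (lam ^ 2) • W k := fun k => by simp [hX]
  have heq : ∀ k, 1 / 2 * inner ℝ (X k) k = lam / 2 * ‖k‖ ^ 2 - lam * inner ℝ k (lam • W k)
      + 1 / 2 * inner ℝ (A (lam • W k)) (lam • W k) := by
    intro k
    rw [hXk, map_smul, hAW]
    simp only [inner_sub_left, inner_smul_left, inner_smul_right, conj_trivial,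
      real_inner_self_eq_norm_sq]
    rw [hWsym]; ring
  refine ⟨X, lam • W, ?_, ?_, ?_, heq⟩
  · intro a b
    simp only [hXk, inner_sub_left, inner_sub_right, inner_smul_left, inner_smul_right,
      conj_trivial, hWsym]
  · intro k hk
    have : W k = 0 := (smul_eq_zero.1 hk).resolve_left hlam.ne'
    rw [← hAW k, this, map_zero]
  · intro k h
    rw [heq k]
    set v := lam • W k with hv
    have hAv : A v = lam • k := by rw [hv, map_smul, hAW]
    have h1 : 0 ≤ inner ℝ (A (h - v)) (h - v) :=
      (mul_nonneg hε.le (sq_nonneg _)).trans (hpos _)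
    rw [map_sub, inner_sub_left, inner_sub_right, inner_sub_right, hsym h v, hAv] at h1
    simp only [inner_smul_left, inner_smul_right, conj_trivial] at h1
    rw [hAv, inner_smul_left]
    simp only [conj_trivial]
    rw [real_inner_comm k h] at h1
    linarith

/-- Strict touching from above by a quadratic, from a second-order upper expansion of the
sup-convolution. -/
theorem exists_strict_touching [FiniteDimensional ℝ E] {K : Set E} (hK : IsCompact K)
    {u : E → ℝ} (hu : ContinuousOn u K) {lam c : ℝ} (hlam : 0 < lam) (hc : 0 < c) {x₀ X₀ : E}
    {A : E →L[ℝ] E} (hsym : ∀ a b, inner ℝ (A a) b = inner ℝ a (A b))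
    (hpos : ∀ a, 0 ≤ inner ℝ (A a) a)
    (hx : affineEnvelope K (fun x => u x - lam / 2 * ‖x‖ ^ 2) (fun x => lam • x) X₀ =
      u x₀ - lam / 2 * ‖x₀‖ ^ 2 + inner ℝ (lam • x₀) X₀)
    (hexp : ∀ η > 0, ∃ r > 0, ∀ h : E, ‖h‖ < r →
      affineEnvelope K (fun x => u x - lam / 2 * ‖x‖ ^ 2) (fun x => lam • x) (X₀ + h) ≤
      affineEnvelope K (fun x => u x - lam / 2 * ‖x‖ ^ 2) (fun x => lam • x) X₀
        + inner ℝ (lam • x₀) h + 1 / 2 * inner ℝ (A h) h + η * ‖h‖ ^ 2) :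
    ∃ X : E →L[ℝ] E, (∀ a b, inner ℝ (X a) b = inner ℝ a (X b)) ∧
      (∀ k h, 1 / 2 * inner ℝ (X k) k ≤
        lam / 2 * ‖k‖ ^ 2 - lam * inner ℝ k h + 1 / 2 * (inner ℝ (A h) h + c * ‖h‖ ^ 2)) ∧
      ∃ r > 0, ∀ x ∈ K, x ≠ x₀ → ‖x - x₀‖ < r → u x < u x₀
        + inner ℝ (lam • (x₀ - X₀)) (x - x₀) + 1 / 2 * inner ℝ (X (x - x₀)) (x - x₀) := by
  set A' : E →L[ℝ] E := A + c • ContinuousLinearMap.id ℝ E with hA'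
  have hA'h : ∀ h, inner ℝ (A' h) h = inner ℝ (A h) h + c * ‖h‖ ^ 2 := by
    intro h
    simp [hA', inner_add_left, inner_smul_left]
  obtain ⟨X, V, hX, hV, hle, heq⟩ := exists_infConvolution_operator (A := A') hc hlam
    (by intro a b; simp [hA', inner_add_left, inner_add_right, inner_smul_left,
      inner_smul_right, hsym])
    (by intro a; rw [hA'h]; linarith [hpos a])
  refine ⟨X, hX, fun k h => by rw [← hA'h]; exact hle k h, ?_⟩
  obtain ⟨r, hr, hr'⟩ := hexp (c / 4) (by positivity)
  refine ⟨r / (‖V‖ + 1), by positivity, fun x hxK hne hxr => ?_⟩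
  set k := x - x₀ with hk
  have hk0 : k ≠ 0 := sub_ne_zero.2 hne
  have hVk : 0 < ‖V k‖ := norm_pos_iff.2 fun h => hk0 (hV k h)
  have hVr : ‖V k‖ < r := by
    rw [lt_div_iff₀ (by positivity)] at hxr
    have := V.le_opNorm k
    nlinarith [norm_nonneg k]
  have h1 := hr' (V k) hVr
  have h2 := le_affineEnvelope (a := fun x => u x - lam / 2 * ‖x‖ ^ 2) (ξ := fun x => lam • x) hK
    (hu.sub (by fun_prop)) (by fun_prop) hxK (X₀ + V k)
  have h3 := heq k
  rw [hA'h] at h3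
  have hxk : x = x₀ + k := by rw [hk]; abel
  have h4 : 0 < c * ‖V k‖ ^ 2 := by positivity
  rw [hx] at h1
  have e1 : ‖x‖ ^ 2 = ‖x₀‖ ^ 2 + 2 * inner ℝ x₀ k + ‖k‖ ^ 2 := by rw [hxk, norm_add_sq_real]
  have e2 : inner ℝ (lam • x) (X₀ + V k) = lam * inner ℝ x₀ X₀ + lam * inner ℝ x₀ (V k)
      + lam * inner ℝ k X₀ + lam * inner ℝ k (V k) := by
    rw [hxk]; simp only [inner_smul_left, inner_add_left, inner_add_right, conj_trivial]; ring
  have e3 : inner ℝ (lam • (x₀ - X₀)) k = lam * inner ℝ x₀ k - lam * inner ℝ k X₀ := by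
    rw [real_inner_comm X₀ k]
    simp only [inner_smul_left, inner_sub_left, conj_trivial]; ring
  simp only [inner_smul_left, conj_trivial] at h1
  rw [e1, e2] at h2
  rw [e3, h3]
  linarith

/-- For almost every linear perturbation `q`, the maximizer of
`u x + w y - λ/4 ‖x - y‖² - ½ ⟪q, x + y⟫` is unique and both functions are strictly touched
from above there by quadratic functions satisfying the matrix inequality. -/
theorem exists_null_jets [FiniteDimensional ℝ E] [MeasurableSpace E] [BorelSpace E]
    {K : Set E} (hK : IsCompact K) (hne : K.Nonempty) {u w : E → ℝ} (hu : ContinuousOn u K)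
    (hw : ContinuousOn w K) {lam : ℝ} (hlam : 0 < lam) :
    ∃ N : Set E, μH[(Module.finrank ℝ E : ℝ)] N = 0 ∧ ∀ q ∉ N, ∀ x₀ ∈ K, ∀ y₀ ∈ K,
      (∀ x ∈ K, ∀ y ∈ K, u x + w y - lam / 4 * ‖x - y‖ ^ 2 - 1 / 2 * inner ℝ q (x + y) ≤
        u x₀ + w y₀ - lam / 4 * ‖x₀ - y₀‖ ^ 2 - 1 / 2 * inner ℝ q (x₀ + y₀)) →
      (∀ x ∈ K, ∀ y ∈ K, u x + w y - lam / 4 * ‖x - y‖ ^ 2 - 1 / 2 * inner ℝ q (x + y) =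
        u x₀ + w y₀ - lam / 4 * ‖x₀ - y₀‖ ^ 2 - 1 / 2 * inner ℝ q (x₀ + y₀) →
          x = x₀ ∧ y = y₀) ∧
      ∃ X Y : E →L[ℝ] E, (∀ a b, inner ℝ (X a) b = inner ℝ a (X b)) ∧
        (∀ a b, inner ℝ (Y a) b = inner ℝ a (Y b)) ∧
        (∀ k l, inner ℝ (X k) k + inner ℝ (Y l) l ≤ lam / 2 * ‖k - l‖ ^ 2) ∧
        ∃ r > 0,
          (∀ x ∈ K, x ≠ x₀ → ‖x - x₀‖ < r → u x < u x₀
            + inner ℝ ((lam / 2) • (x₀ - y₀) + (1 / 2 : ℝ) • q) (x - x₀)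
            + 1 / 2 * inner ℝ (X (x - x₀)) (x - x₀)) ∧
          (∀ y ∈ K, y ≠ y₀ → ‖y - y₀‖ < r → w y < w y₀
            + inner ℝ ((lam / 2) • (y₀ - x₀) + (1 / 2 : ℝ) • q) (y - y₀)
            + 1 / 2 * inner ℝ (Y (y - y₀)) (y - y₀)) := by
  set f₁ := affineEnvelope K (fun x => u x - lam / 2 * ‖x‖ ^ 2) (fun x : E => lam • x) with hf₁
  set f₂ := affineEnvelope K (fun x => w x - lam / 2 * ‖x‖ ^ 2) (fun x : E => lam • x) with hf₂
  set M := affineEnvelope (K ×ˢ K) (fun z : E × E => u z.1 + w z.2 - lam / 4 * ‖z.1 - z.2‖ ^ 2)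
    (fun z : E × E => -((1 / 2 : ℝ) • (z.1 + z.2))) with hM
  have ca₁ : ContinuousOn (fun x => u x - lam / 2 * ‖x‖ ^ 2) K := hu.sub (by fun_prop)
  have ca₂ : ContinuousOn (fun x => w x - lam / 2 * ‖x‖ ^ 2) K := hw.sub (by fun_prop)
  have cξ : ContinuousOn (fun x : E => lam • x) K := by fun_prop
  have cM : ContinuousOn (fun z : E × E => u z.1 + w z.2 - lam / 4 * ‖z.1 - z.2‖ ^ 2)
      (K ×ˢ K) :=
    ((hu.comp continuousOn_fst fun z hz => hz.1).add
      (hw.comp continuousOn_snd fun z hz => hz.2)).sub (by fun_prop)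
  have cξM : ContinuousOn (fun z : E × E => -((1 / 2 : ℝ) • (z.1 + z.2))) (K ×ˢ K) := by fun_prop
  have hKK : IsCompact (K ×ˢ K) := hK.prod hK
  have hneK : (K ×ˢ K).Nonempty := hne.prod hne
  obtain ⟨L₁, hL₁⟩ := exists_lipschitzWith_affineEnvelope hK hne ca₁ cξ
  obtain ⟨L₂, hL₂⟩ := exists_lipschitzWith_affineEnvelope hK hne ca₂ cξ
  obtain ⟨L₃, hL₃⟩ := exists_lipschitzWith_affineEnvelope hKK hneK cM cξM
  have s₁ := exists_isSubgrad_affineEnvelope hK hne ca₁ cξ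
  have s₂ := exists_isSubgrad_affineEnvelope hK hne ca₂ cξ
  obtain ⟨N₁, hN₁, HN₁⟩ := exists_null_alexandrov hL₁ s₁
  obtain ⟨N₂, hN₂, HN₂⟩ := exists_null_alexandrov hL₂ s₂
  obtain ⟨N₃, hN₃, HN₃⟩ := exists_null_alexandrov hL₃
    (exists_isSubgrad_affineEnvelope hKK hneK cM cξM)
  set F : E → ℝ := fun X => f₁ X + f₂ X with hF
  have hFs : ∀ X, ∃ y, IsSubgrad F X y := by
    intro X
    obtain ⟨y, hy⟩ := s₁ X
    obtain ⟨z, hz⟩ := s₂ X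
    refine ⟨y + z, fun X' => ?_⟩
    have h1 := hy X'
    have h2 := hz X'
    simp only [hF, inner_add_left]
    linarith
  -- `R X q`: the function `F - lam ‖·‖² - ⟪q, ·⟫` is maximal at `X`
  set R : E → E → Prop := fun X q => ∀ d, F (X + d) ≤ F X + inner ℝ (q + (2 * lam) • X) d
    + lam * ‖d‖ ^ 2 with hR
  have hRL : ∀ X₁ X₂ q₁ q₂, R X₁ q₁ → R X₂ q₂ → ‖q₁ - q₂‖ ≤ 4 * lam * ‖X₁ - X₂‖ := by
    intro X₁ X₂ q₁ q₂ h1 h2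
    have h3 := norm_slope_sub_le hlam hFs h1 h2
    have e : q₁ - q₂ = (q₁ + (2 * lam) • X₁ - (q₂ + (2 * lam) • X₂)) - (2 * lam) • (X₁ - X₂) := by
      rw [smul_sub]; abel
    rw [e]
    refine (norm_sub_le _ _).trans ?_
    rw [norm_smul, Real.norm_eq_abs, abs_of_pos (by positivity : 0 < 2 * lam)]
    linarith
  have hnull : μH[(Module.finrank ℝ E : ℝ)] {q | ∃ X ∈ N₁ ∪ N₂, R X q} = 0 := by
    classical
    set S : Set E := {X | X ∈ N₁ ∪ N₂ ∧ ∃ q, R X q} with hS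
    set Q : E → E := fun X => if h : ∃ q, R X q then h.choose else 0 with hQ
    have hQR : ∀ X, (∃ q, R X q) → R X (Q X) := by
      intro X h
      simp only [hQ, dif_pos h]
      exact h.choose_spec
    have hQL : LipschitzOnWith (4 * lam).toNNReal Q S := by
      refine LipschitzOnWith.of_dist_le_mul fun X hX Y hY => ?_
      rw [dist_eq_norm, dist_eq_norm, Real.coe_toNNReal _ (by positivity)]
      exact hRL _ _ _ _ (hQR X hX.2) (hQR Y hY.2)
    have hsub : {q | ∃ X ∈ N₁ ∪ N₂, R X q} ⊆ Q '' S := by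
      rintro q ⟨X, hX, hq⟩
      refine ⟨X, ⟨hX, q, hq⟩, ?_⟩
      have := hRL X X _ _ (hQR X ⟨q, hq⟩) hq
      rw [sub_self, norm_zero, mul_zero] at this
      exact sub_eq_zero.1 (norm_le_zero_iff.1 this)
    have h0 : μH[(Module.finrank ℝ E : ℝ)] S = 0 :=
      measure_mono_null (fun X hX => hX.1) (measure_union_null hN₁ hN₂)
    have h1 := hQL.hausdorffMeasure_image_le (Nat.cast_nonneg (Module.finrank ℝ E))
    rw [h0, mul_zero] at h1
    exact measure_mono_null hsub (le_antisymm h1 zero_le)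
  -- the basic inequality relating `F` and `M`
  have hstar : ∀ X q, F X - lam * ‖X‖ ^ 2 - inner ℝ q X ≤ M q + ‖q‖ ^ 2 / (4 * lam) := by
    intro X q
    obtain ⟨x, hx, hx'⟩ := exists_eq_affineEnvelope hK hne ca₁ cξ X
    obtain ⟨y, hy, hy'⟩ := exists_eq_affineEnvelope hK hne ca₂ cξ X
    have h1 := le_affineEnvelope hKK cM cξM (mk_mem_prod hx hy) q
    have h2 : 0 ≤ ‖(2 * lam) • X - lam • (x + y) + q‖ ^ 2 / (4 * lam) := by positivity
    have e : ‖(2 * lam) • X - lam • (x + y) + q‖ ^ 2 / (4 * lam) = ‖q‖ ^ 2 / (4 * lam)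
        + lam * ‖X‖ ^ 2 + lam / 4 * ‖x + y‖ ^ 2 - lam * inner ℝ x X - lam * inner ℝ y X
        + inner ℝ q X - 1 / 2 * inner ℝ q (x + y) := by
      rw [norm_add_sq_real, norm_sub_sq_real, norm_smul, norm_smul, Real.norm_eq_abs,
        Real.norm_eq_abs, mul_pow, mul_pow, sq_abs, sq_abs, inner_sub_left]
      simp only [inner_smul_left, inner_smul_right, conj_trivial]
      rw [real_inner_comm q X, real_inner_comm q (x + y), real_inner_comm (x + y) X,
        inner_add_left]
      field_simp; ring
    have e2 : ‖x + y‖ ^ 2 = 2 * ‖x‖ ^ 2 + 2 * ‖y‖ ^ 2 - ‖x - y‖ ^ 2 := by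
      rw [norm_add_sq_real, norm_sub_sq_real]; ring
    simp only [inner_neg_left, inner_smul_left, conj_trivial] at h1 hx' hy'
    rw [real_inner_comm q (x + y)] at h1
    simp only [hF]
    rw [hf₁, hf₂, hM, hx', hy']
    rw [e, e2] at h2
    linarith
  refine ⟨N₃ ∪ {q | ∃ X ∈ N₁ ∪ N₂, R X q}, measure_union_null hN₃ hnull, ?_⟩
  intro q hq x₀ hx₀ y₀ hy₀ hmax
  have hMq : ∀ x ∈ K, ∀ y ∈ K,
      u x + w y - lam / 4 * ‖x - y‖ ^ 2 - 1 / 2 * inner ℝ q (x + y) =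
        u x₀ + w y₀ - lam / 4 * ‖x₀ - y₀‖ ^ 2 - 1 / 2 * inner ℝ q (x₀ + y₀) →
      M q = u x + w y - lam / 4 * ‖x - y‖ ^ 2 - 1 / 2 * inner ℝ q (x + y) := by
    intro x hx y hy hxy
    refine le_antisymm (csSup_le (hneK.image _) ?_) ?_
    · rintro _ ⟨z, hz, rfl⟩
      have := hmax z.1 hz.1 z.2 hz.2
      simp only [inner_neg_left, inner_smul_left, conj_trivial]
      rw [real_inner_comm q]
      linarith
    · have := le_affineEnvelope hKK cM cξM (mk_mem_prod hx hy) q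
      simp only [inner_neg_left, inner_smul_left, conj_trivial] at this
      rw [real_inner_comm q] at this
      linarith
  -- the contact point associated with a maximizer
  have hcontact : ∀ x ∈ K, ∀ y ∈ K,
      u x + w y - lam / 4 * ‖x - y‖ ^ 2 - 1 / 2 * inner ℝ q (x + y) =
        u x₀ + w y₀ - lam / 4 * ‖x₀ - y₀‖ ^ 2 - 1 / 2 * inner ℝ q (x₀ + y₀) →
      ∀ X, X = (1 / 2 : ℝ) • (x + y) - (2 * lam)⁻¹ • q →
      f₁ X = u x - lam / 2 * ‖x‖ ^ 2 + inner ℝ (lam • x) X ∧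
      f₂ X = w y - lam / 2 * ‖y‖ ^ 2 + inner ℝ (lam • y) X ∧
      F X - lam * ‖X‖ ^ 2 - inner ℝ q X = M q + ‖q‖ ^ 2 / (4 * lam) := by
    intro x hx y hy hxy X hX
    have h1 := le_affineEnvelope hK ca₁ cξ hx X
    have h2 := le_affineEnvelope hK ca₂ cξ hy X
    have h3 := hstar X q
    have h4 := hMq x hx y hy hxy
    have e : u x - lam / 2 * ‖x‖ ^ 2 + inner ℝ (lam • x) X
        + (w y - lam / 2 * ‖y‖ ^ 2 + inner ℝ (lam • y) X) - lam * ‖X‖ ^ 2 - inner ℝ q X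
        = M q + ‖q‖ ^ 2 / (4 * lam) := by
      rw [h4, hX, norm_sub_sq_real]
      simp only [norm_smul, mul_pow, Real.norm_eq_abs, sq_abs, inner_smul_left, inner_smul_right,
        inner_sub_right, inner_add_right, inner_add_left, conj_trivial, norm_add_sq_real,
        norm_sub_sq_real, real_inner_self_eq_norm_sq]
      rw [real_inner_comm x y, real_inner_comm q x, real_inner_comm q y]
      field_simp; ring
    simp only [hF] at h3 ⊢
    simp only [← hf₁, ← hf₂] at h1 h2
    exact ⟨by linarith, by linarith, by linarith⟩
  set X₀ := (1 / 2 : ℝ) • (x₀ + y₀) - (2 * lam)⁻¹ • q with hX₀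
  obtain ⟨c₁, c₂, c₃⟩ := hcontact x₀ hx₀ y₀ hy₀ rfl X₀ hX₀
  have hRX : R X₀ q := by
    intro d
    have h1 := hstar (X₀ + d) q
    rw [norm_add_sq_real, inner_add_right] at h1
    rw [inner_add_left, inner_smul_left]
    simp only [conj_trivial]
    linarith
  have hX₀N : X₀ ∉ N₁ ∪ N₂ := fun h => hq (Or.inr ⟨X₀, h, hRX⟩)
  obtain ⟨p₁, A, up₁, symA, posA, expA⟩ := HN₁ X₀ fun h => hX₀N (Or.inl h)
  obtain ⟨p₂, B, up₂, symB, posB, expB⟩ := HN₂ X₀ fun h => hX₀N (Or.inr h)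
  obtain ⟨p₃, A₃, up₃, symA₃, posA₃, expA₃⟩ := HN₃ q fun h => hq (Or.inl h)
  have hp₁ := up₁ _ (isSubgrad_affineEnvelope hK ca₁ cξ hx₀ c₁)
  have hp₂ := up₂ _ (isSubgrad_affineEnvelope hK ca₂ cξ hy₀ c₂)
  have hMsub : ∀ x ∈ K, ∀ y ∈ K,
      u x + w y - lam / 4 * ‖x - y‖ ^ 2 - 1 / 2 * inner ℝ q (x + y) =
        u x₀ + w y₀ - lam / 4 * ‖x₀ - y₀‖ ^ 2 - 1 / 2 * inner ℝ q (x₀ + y₀) →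
      -((1 / 2 : ℝ) • (x + y)) = p₃ := by
    intro x hx y hy hxy
    refine up₃ _ (isSubgrad_affineEnvelope hKK cM cξM (mk_mem_prod hx hy) ?_)
    have := hMq x hx y hy hxy
    simp only [inner_neg_left, inner_smul_left, conj_trivial]
    rw [real_inner_comm q]
    rw [← hM]
    linarith
  have hp₃ := hMsub x₀ hx₀ y₀ hy₀ rfl
  refine ⟨fun x hx y hy hxy => ?_, ?_⟩
  · have h1 := hMsub x hx y hy hxy
    rw [← hp₃, neg_inj] at h1
    obtain ⟨d₁, d₂, -⟩ := hcontact x hx y hy hxy X₀ (by rw [h1])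
    have e₁ := up₁ _ (isSubgrad_affineEnvelope hK ca₁ cξ hx d₁)
    have e₂ := up₂ _ (isSubgrad_affineEnvelope hK ca₂ cξ hy d₂)
    exact ⟨smul_right_injective E hlam.ne' (e₁.trans hp₁.symm),
      smul_right_injective E hlam.ne' (e₂.trans hp₂.symm)⟩
  -- the quadratic inequality
  obtain ⟨C, hC, r₃, hr₃, hMC⟩ : ∃ C > 0, ∃ r > 0, ∀ k : E, ‖k‖ < r →
      M (q + k) + ‖q + k‖ ^ 2 / (4 * lam) ≤
        M q + ‖q‖ ^ 2 / (4 * lam) - inner ℝ X₀ k + C * ‖k‖ ^ 2 := by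
    obtain ⟨r, hr, hr'⟩ := expA₃ 1 one_pos
    refine ⟨‖A₃‖ + 1 + 1 / (4 * lam), by positivity, r, hr, fun k hk => ?_⟩
    have h1 := (abs_le.1 (hr' k hk)).2
    have h2 : inner ℝ (A₃ k) k ≤ ‖A₃‖ * ‖k‖ ^ 2 := by
      refine (real_inner_le_norm _ _).trans ?_
      rw [pow_two, ← mul_assoc]
      gcongr
      exact A₃.le_opNorm k
    have e : ‖q + k‖ ^ 2 / (4 * lam) = ‖q‖ ^ 2 / (4 * lam) + (2 * lam)⁻¹ * inner ℝ q k
        + 1 / (4 * lam) * ‖k‖ ^ 2 := by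
      rw [norm_add_sq_real]; field_simp; ring
    rw [e, hX₀]
    rw [← hp₃] at h1
    simp only [inner_neg_left, inner_sub_left, inner_smul_left, conj_trivial] at h1 ⊢
    have h3 : 0 ≤ ‖A₃‖ * ‖k‖ ^ 2 := by positivity
    simp only [← hM] at h1
    linarith
  obtain ⟨c, hc, hAB⟩ : ∃ c > 0, ∀ h, 1 / 2 * (inner ℝ (A h) h + inner ℝ (B h) h)
      + c * ‖h‖ ^ 2 ≤ lam * ‖h‖ ^ 2 := by
    refine ⟨1 / (8 * C), by positivity, fun h => ?_⟩
    obtain ⟨r₁, hr₁, h₁⟩ := expA (1 / (16 * C)) (by positivity)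
    obtain ⟨r₂, hr₂, h₂⟩ := expB (1 / (16 * C)) (by positivity)
    set s := 1 / (2 * C) with hs
    have hspos : 0 < s := by positivity
    set ρ := min (min r₁ r₂) (r₃ / s) with hρ
    have hρpos : 0 < ρ := lt_min (lt_min hr₁ hr₂) (by positivity)
    set τ := ρ / (2 * (‖h‖ + 1)) with hτ
    have hτpos : 0 < τ := by positivity
    have hτh : ‖τ • h‖ < ρ := by
      rw [norm_smul, Real.norm_eq_abs, abs_of_pos hτpos, hτ, div_mul_eq_mul_div,
        div_lt_iff₀ (by positivity)]
      nlinarith [norm_nonneg h]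
    set g := τ • h with hg
    have a₁ := (abs_le.1 (h₁ g (hτh.trans_le ((min_le_left _ _).trans (min_le_left _ _))))).1
    have a₂ := (abs_le.1 (h₂ g (hτh.trans_le ((min_le_left _ _).trans (min_le_right _ _))))).1
    have hk : ‖-(s • g)‖ = s * ‖g‖ := by
      rw [norm_neg, norm_smul, Real.norm_eq_abs, abs_of_pos hspos]
    have a₃ := hMC (-(s • g)) (by
      rw [hk]
      have := hτh.trans_le (min_le_right _ _)
      rw [lt_div_iff₀ hspos] at this
      linarith)
    have a₄ := hstar (X₀ + g) (q + -(s • g))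
    rw [hk] at a₃
    rw [← hp₁] at a₁
    rw [← hp₂] at a₂
    have e2 : (2 * lam) * inner ℝ X₀ g = lam * inner ℝ x₀ g + lam * inner ℝ y₀ g - inner ℝ q g := by
      rw [hX₀]
      simp only [inner_sub_left, inner_smul_left, inner_add_left, conj_trivial]
      field_simp
    simp only [inner_neg_right, inner_neg_left, inner_smul_left, inner_smul_right,
      inner_add_left, inner_add_right, conj_trivial, norm_add_sq_real X₀,
      real_inner_self_eq_norm_sq] at a₁ a₂ a₃ a₄
    rw [real_inner_comm X₀ g] at a₄
    simp only [hF, ← hf₁, ← hf₂] at a₁ a₂ a₄ c₃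
    have e3 : C * (s * ‖g‖) ^ 2 = s / 2 * ‖g‖ ^ 2 := by rw [hs]; field_simp
    have e4 : 1 / (16 * C) = s / 8 := by rw [hs]; field_simp; norm_num
    have e5 : 1 / (8 * C) = s / 4 := by rw [hs]; field_simp; norm_num
    rw [e4] at a₁ a₂
    rw [e3] at a₃
    have fin : 1 / 2 * (inner ℝ (A g) g + inner ℝ (B g) g) + s / 4 * ‖g‖ ^ 2
        ≤ lam * ‖g‖ ^ 2 := by linarith
    rw [e5]
    simp only [hg, map_smul, inner_smul_left, inner_smul_right, conj_trivial, norm_smul, mul_pow,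
      Real.norm_eq_abs, sq_abs] at fin
    have : τ ^ 2 * (1 / 2 * (inner ℝ (A h) h + inner ℝ (B h) h) + s / 4 * ‖h‖ ^ 2)
        ≤ τ ^ 2 * (lam * ‖h‖ ^ 2) := by linarith
    exact le_of_mul_le_mul_left this (by positivity)
  obtain ⟨X, symX, leX, r₁, hr₁, tX⟩ := exists_strict_touching hK hu hlam hc symA posA c₁ (by
    intro η hη
    obtain ⟨r, hr, hr'⟩ := expA η hη
    refine ⟨r, hr, fun h hh => ?_⟩
    have := (abs_le.1 (hr' h hh)).2
    rw [← hp₁] at this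
    linarith)
  obtain ⟨Y, symY, leY, r₂, hr₂, tY⟩ := exists_strict_touching hK hw hlam hc symB posB c₂ (by
    intro η hη
    obtain ⟨r, hr, hr'⟩ := expB η hη
    refine ⟨r, hr, fun h hh => ?_⟩
    have := (abs_le.1 (hr' h hh)).2
    rw [← hp₂] at this
    linarith)
  refine ⟨X, Y, symX, symY, fun k l => ?_, min r₁ r₂, lt_min hr₁ hr₂, ?_, ?_⟩
  · have h1 := leX k ((1 / 2 : ℝ) • (k + l))
    have h2 := leY l ((1 / 2 : ℝ) • (k + l))
    have h3 := hAB ((1 / 2 : ℝ) • (k + l))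
    have e1 : inner ℝ k ((1 / 2 : ℝ) • (k + l)) = 1 / 2 * (‖k‖ ^ 2 + inner ℝ k l) := by
      rw [inner_smul_right, inner_add_right, real_inner_self_eq_norm_sq]
    have e2 : inner ℝ l ((1 / 2 : ℝ) • (k + l)) = 1 / 2 * (inner ℝ k l + ‖l‖ ^ 2) := by
      rw [inner_smul_right, inner_add_right, real_inner_self_eq_norm_sq, real_inner_comm k l]
    have e3 : ‖(1 / 2 : ℝ) • (k + l)‖ ^ 2 = 1 / 4 * (‖k‖ ^ 2 + 2 * inner ℝ k l + ‖l‖ ^ 2) := by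
      rw [norm_smul, mul_pow, norm_add_sq_real, Real.norm_eq_abs, sq_abs]; ring
    rw [e1] at h1
    rw [e2] at h2
    rw [norm_sub_sq_real]
    rw [e3] at h1 h2 h3
    linarith
  · intro x hx hne hr
    have := tX x hx hne (hr.trans_le (min_le_left _ _))
    have e : lam • (x₀ - X₀) = (lam / 2) • (x₀ - y₀) + (1 / 2 : ℝ) • q := by
      rw [hX₀]
      have : lam * (2 * lam)⁻¹ = 1 / 2 := by field_simp
      simp only [smul_sub, smul_add, smul_smul, this]
      module
    rwa [e] at this
  · intro y hy hne hr
    have := tY y hy hne (hr.trans_le (min_le_right _ _))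
    have e : lam • (y₀ - X₀) = (lam / 2) • (y₀ - x₀) + (1 / 2 : ℝ) • q := by
      rw [hX₀]
      have : lam * (2 * lam)⁻¹ = 1 / 2 := by field_simp
      simp only [smul_sub, smul_add, smul_smul, this]
      module
    rwa [e] at this

end Jets

section ParametricMax

variable {α : Type*} {g : ℝ → α → ℝ} {B : Set α}

/-- The maximum over `B` of `g t`. -/
noncomputable def paramMax (g : ℝ → α → ℝ) (B : Set α) (t : ℝ) : ℝ := sSup (g t '' B)

theorem paramMax_le (hne : B.Nonempty) {t c : ℝ} (h : ∀ x ∈ B, g t x ≤ c) :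
    paramMax g B t ≤ c := by
  refine csSup_le (hne.image _) ?_
  rintro _ ⟨x, hx, rfl⟩
  exact h x hx

variable [TopologicalSpace α]

theorem le_paramMax (hB : IsCompact B) (hg : Continuous (↿g)) (t : ℝ) {x : α} (hx : x ∈ B) :
    g t x ≤ paramMax g B t := by
  have : Continuous (g t) := hg.comp (Continuous.prodMk_right t)
  exact le_csSup (hB.image this).bddAbove ⟨x, hx, rfl⟩

theorem exists_eq_paramMax (hB : IsCompact B) (hne : B.Nonempty) (hg : Continuous (↿g)) (t : ℝ) :
    ∃ x ∈ B, paramMax g B t = g t x := by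
  have : Continuous (g t) := hg.comp (Continuous.prodMk_right t)
  obtain ⟨x, hx, hmax⟩ := hB.exists_isMaxOn hne this.continuousOn
  exact ⟨x, hx, le_antisymm (paramMax_le hne fun y hy => hmax hy) (le_paramMax hB hg t hx)⟩

theorem continuous_paramMax (hB : IsCompact B) (hg : Continuous (↿g)) :
    Continuous (paramMax g B) := hB.continuous_sSup hg

/-- Maximizers stay close to a strict maximizer under perturbation of the parameter. -/
theorem eventually_argmax_mem (hB : IsCompact B) (hg : Continuous (↿g)) {t₀ : ℝ} {x₀ : α}
    (hx₀ : x₀ ∈ B) (hstrict : ∀ y ∈ B, y ≠ x₀ → g t₀ y < g t₀ x₀) {U : Set α} (hU : IsOpen U)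
    (hxU : x₀ ∈ U) :
    ∀ᶠ t in 𝓝 t₀, ∀ y ∈ B, (∀ z ∈ B, g t z ≤ g t y) → y ∈ U := by
  have hc : IsCompact (B \ U) := hB.diff hU
  have hg' : Continuous fun z : ℝ × α => g z.1 z.2 - g z.1 x₀ :=
    hg.sub (hg.comp (continuous_fst.prodMk continuous_const))
  have h : ∀ᶠ t in 𝓝 t₀, ∀ y ∈ B \ U, g t y - g t x₀ < 0 := by
    refine hc.eventually_forall_of_forall_eventually fun y hy => ?_
    have h1 : g t₀ y - g t₀ x₀ < 0 := by
      have := hstrict y hy.1 (by rintro rfl; exact hy.2 hxU)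
      linarith
    exact hg'.continuousAt.eventually_lt continuousAt_const h1
  filter_upwards [h] with t ht y hy hmax
  by_contra hyU
  have h1 := ht y ⟨hy, hyU⟩
  have h2 := hmax x₀ hx₀
  linarith

end ParametricMax

section Parabolic

variable {E : Type*} [NormedAddCommGroup E] [InnerProductSpace ℝ E]

/-- The quadratic function with centre `c`, slope `p` and Hessian `A`. -/
noncomputable def quad (c p : E) (A : E →L[ℝ] E) (y : E) : ℝ :=
  inner ℝ p (y - c) + 1 / 2 * inner ℝ (A (y - c)) (y - c)

theorem continuous_quad (c p : E) (A : E →L[ℝ] E) : Continuous (quad c p A) := by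
  unfold quad; fun_prop

theorem quad_recenter {c p : E} {A : E →L[ℝ] E} (hA : ∀ a b, inner ℝ (A a) b = inner ℝ a (A b))
    (x y : E) : quad c p A y = quad c p A x + quad x (p + A (x - c)) A y := by
  have e : y - c = (x - c) + (y - x) := by abel
  unfold quad
  rw [e, map_add]
  simp only [inner_add_left, inner_add_right]
  rw [hA (y - x) (x - c), real_inner_comm (A (x - c)) (y - x)]
  ring

/-- `u` is a viscosity subsolution of `-∂ₜu + F ≤ 0` on `(0,T) × Ω`, tested with the sums of a
`C¹` function of time and a quadratic function of space. -/
def IsParabolicSub (T : ℝ) (Ω : Set E) (u : ℝ → E → ℝ) (F : ℝ → E → E → (E →L[ℝ] E) → ℝ) :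
    Prop :=
  ∀ t ∈ Ioo 0 T, ∀ x ∈ Ω, ∀ θ : ℝ → ℝ, ContDiff ℝ 1 θ → ∀ (p : E) (A : E →L[ℝ] E),
    (∀ a b, inner ℝ (A a) b = inner ℝ a (A b)) →
    IsLocalMax (fun z : ℝ × E => u z.1 z.2 - θ z.1 - quad x p A z.2) (t, x) →
    F t x p A ≤ deriv θ t

variable {T : ℝ} {Ω : Set E} {u : ℝ → E → ℝ} {F : ℝ → E → E → (E →L[ℝ] E) → ℝ}

theorem continuous_sub_quad (hu : Continuous (↿u)) (c p : E) (A : E →L[ℝ] E) :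
    Continuous (↿fun (t : ℝ) (y : E) => u t y - quad c p A y) :=
  hu.sub ((continuous_quad c p A).comp continuous_snd)

/-- The superdifferential of `t ↦ max_B (u t - quad)` is controlled at interior maximizers. -/
theorem IsParabolicSub.le_deriv_of_isLocalMax (h : IsParabolicSub T Ω u F)
    (hu : Continuous (↿u)) {B : Set E} (hB : IsCompact B) {c p : E} {A : E →L[ℝ] E}
    (hA : ∀ a b, inner ℝ (A a) b = inner ℝ a (A b)) {t : ℝ} (ht : t ∈ Ioo 0 T) {x : E}
    (hxΩ : x ∈ Ω) (hxB : B ∈ 𝓝 x)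
    (hx : paramMax (fun s y => u s y - quad c p A y) B t = u t x - quad c p A x)
    {θ : ℝ → ℝ} (hθ : ContDiff ℝ 1 θ)
    (hmax : IsLocalMax (fun s => paramMax (fun s y => u s y - quad c p A y) B s - θ s) t) :
    F t x (p + A (x - c)) A ≤ deriv θ t := by
  refine h t ht x hxΩ θ hθ _ A hA ?_
  have h1 : ∀ᶠ z : ℝ × E in 𝓝 (t, x), z.2 ∈ B := continuous_snd.continuousAt.eventually hxB
  have h2 : ∀ᶠ z : ℝ × E in 𝓝 (t, x),
      paramMax (fun s y => u s y - quad c p A y) B z.1 - θ z.1 ≤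
      paramMax (fun s y => u s y - quad c p A y) B t - θ t :=
    (continuous_fst.tendsto (t, x)).eventually hmax
  filter_upwards [h1, h2] with z hz1 hz2
  have h3 := le_paramMax hB (continuous_sub_quad hu c p A) z.1 hz1
  rw [quad_recenter hA x z.2] at h3
  have h4 : quad x (p + A (x - c)) A x = 0 := by simp [quad]
  rw [h4]
  linarith

/-- The doubled functional, tilted by the linear function of slope `q`. -/
noncomputable def doubled (u w : ℝ → E → ℝ) (lam : ℝ) (q : E) (t : ℝ) (z : E × E) : ℝ :=
  u t z.1 + w t z.2 - lam / 4 * ‖z.1 - z.2‖ ^ 2 - 1 / 2 * inner ℝ q (z.1 + z.2)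

theorem continuous_doubled {w : ℝ → E → ℝ} (hu : Continuous (↿u)) (hw : Continuous (↿w))
    (lam : ℝ) (q : E) : Continuous (↿(doubled u w lam q)) := by
  have h1 : Continuous fun a : ℝ × E × E => u a.1 a.2.1 :=
    hu.comp (continuous_fst.prodMk (continuous_fst.comp continuous_snd))
  have h2 : Continuous fun a : ℝ × E × E => w a.1 a.2.2 :=
    hw.comp (continuous_fst.prodMk (continuous_snd.comp continuous_snd))
  change Continuous fun a : ℝ × E × E => u a.1 a.2.1 + w a.1 a.2.2
    - lam / 4 * ‖a.2.1 - a.2.2‖ ^ 2 - 1 / 2 * inner ℝ q (a.2.1 + a.2.2)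
  fun_prop

/-- At a time where the tilted doubled functional has second-order jets, its maximum increases
linearly from the left. -/
theorem exists_left_linear_growth [FiniteDimensional ℝ E] {K : Set E} (hK : IsCompact K)
    (hΩ : IsOpen Ω) (hΩK : Ω ⊆ K) {w : ℝ → E → ℝ} {F₂ : ℝ → E → E → (E →L[ℝ] E) → ℝ}
    (hu : Continuous (↿u)) (hw : Continuous (↿w))
    (hsu : IsParabolicSub T Ω u F) (hsw : IsParabolicSub T Ω w F₂)
    (hcF : ∀ x₀ ∈ Ω, ∀ p₀ A, ∀ η > 0, ∃ r > 0, ∀ t ∈ Icc 0 T, ∀ x ∈ Ω, ∀ p,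
      ‖x - x₀‖ < r → ‖p - p₀‖ < r → F t x₀ p₀ A - η ≤ F t x p A)
    (hcF₂ : ∀ x₀ ∈ Ω, ∀ p₀ A, ∀ η > 0, ∃ r > 0, ∀ t ∈ Icc 0 T, ∀ x ∈ Ω, ∀ p,
      ‖x - x₀‖ < r → ‖p - p₀‖ < r → F₂ t x₀ p₀ A - η ≤ F₂ t x p A)
    (hbF : ∀ ρ, ∃ C, ∀ t ∈ Icc 0 T, ∀ x ∈ Ω, ∀ p A, ‖p‖ ≤ ρ → ‖A‖ ≤ ρ → -C ≤ F t x p A)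
    (hbF₂ : ∀ ρ, ∃ C, ∀ t ∈ Icc 0 T, ∀ x ∈ Ω, ∀ p A, ‖p‖ ≤ ρ → ‖A‖ ≤ ρ → -C ≤ F₂ t x p A)
    {lam κ : ℝ} (hκ : 0 < κ) {q : E} {t₀ : ℝ} (ht₀ : t₀ ∈ Ioo 0 T) {x₀ y₀ : E} (hx₀ : x₀ ∈ Ω)
    (hy₀ : y₀ ∈ Ω)
    (hmax : ∀ x ∈ K, ∀ y ∈ K, u t₀ x + w t₀ y - lam / 4 * ‖x - y‖ ^ 2
      - 1 / 2 * inner ℝ q (x + y) ≤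
        u t₀ x₀ + w t₀ y₀ - lam / 4 * ‖x₀ - y₀‖ ^ 2 - 1 / 2 * inner ℝ q (x₀ + y₀))
    (huniq : ∀ x ∈ K, ∀ y ∈ K, u t₀ x + w t₀ y - lam / 4 * ‖x - y‖ ^ 2
      - 1 / 2 * inner ℝ q (x + y) =
        u t₀ x₀ + w t₀ y₀ - lam / 4 * ‖x₀ - y₀‖ ^ 2 - 1 / 2 * inner ℝ q (x₀ + y₀) →
          x = x₀ ∧ y = y₀)
    {X Y : E →L[ℝ] E} (hX : ∀ a b, inner ℝ (X a) b = inner ℝ a (X b))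
    (hY : ∀ a b, inner ℝ (Y a) b = inner ℝ a (Y b))
    (hXY : ∀ k l, inner ℝ (X k) k + inner ℝ (Y l) l ≤ lam / 2 * ‖k - l‖ ^ 2)
    {r : ℝ} (hr : 0 < r)
    (htu : ∀ x ∈ K, x ≠ x₀ → ‖x - x₀‖ < r → u t₀ x < u t₀ x₀
      + quad x₀ ((lam / 2) • (x₀ - y₀) + (1 / 2 : ℝ) • q) X x)
    (htw : ∀ y ∈ K, y ≠ y₀ → ‖y - y₀‖ < r → w t₀ y < w t₀ y₀
      + quad y₀ ((lam / 2) • (y₀ - x₀) + (1 / 2 : ℝ) • q) Y y)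
    (hF : ∀ t ∈ Icc 0 T, κ ≤ F t x₀ ((lam / 2) • (x₀ - y₀) + (1 / 2 : ℝ) • q) X
      + F₂ t y₀ ((lam / 2) • (y₀ - x₀) + (1 / 2 : ℝ) • q) Y) :
    ∀ᶠ t in 𝓝[<] t₀, ∀ x ∈ K, ∀ y ∈ K,
      u t x + w t y - lam / 4 * ‖x - y‖ ^ 2 - 1 / 2 * inner ℝ q (x + y) ≤
        u t₀ x₀ + w t₀ y₀ - lam / 4 * ‖x₀ - y₀‖ ^ 2 - 1 / 2 * inner ℝ q (x₀ + y₀)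
          - κ / 2 * (t₀ - t) := by
  -- the local analysis of one of the two functions
  have loc : ∀ {v : ℝ → E → ℝ} {G : ℝ → E → E → (E →L[ℝ] E) → ℝ}, Continuous (↿v) →
      IsParabolicSub T Ω v G →
      (∀ x₀ ∈ Ω, ∀ p₀ A, ∀ η > 0, ∃ r > 0, ∀ t ∈ Icc 0 T, ∀ x ∈ Ω, ∀ p,
        ‖x - x₀‖ < r → ‖p - p₀‖ < r → G t x₀ p₀ A - η ≤ G t x p A) →
      ∀ {z p : E} {A : E →L[ℝ] E}, z ∈ Ω → (∀ a b, inner ℝ (A a) b = inner ℝ a (A b)) →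
      (∀ x ∈ K, x ≠ z → ‖x - z‖ < r → v t₀ x < v t₀ z + quad z p A x) →
      ∃ ρ > 0, Metric.closedBall z ρ ⊆ K ∧
        paramMax (fun s y => v s y - quad z p A y) (Metric.closedBall z ρ) t₀ = v t₀ z ∧
        ∀ᶠ t in 𝓝 t₀, ∀ θ : ℝ → ℝ, ContDiff ℝ 1 θ →
        IsLocalMax (fun s => paramMax (fun s y => v s y - quad z p A y)
          (Metric.closedBall z ρ) s - θ s) t → G t z p A - κ / 4 ≤ deriv θ t := by
    intro v G hv hsv hcG z p A hz hA hst
    obtain ⟨rc, hrc, hrc'⟩ := hcG z hz p A (κ / 4) (by positivity)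
    obtain ⟨rΩ, hrΩ, hrΩ'⟩ := Metric.isOpen_iff.1 hΩ z hz
    set ρ := min (min r rΩ) (min rc (rc / (‖A‖ + 1))) / 2 with hρ
    have hm : 0 < min (min r rΩ) (min rc (rc / (‖A‖ + 1))) := by positivity
    have hρ0 : 0 < ρ := by positivity
    have hρm : ρ < min (min r rΩ) (min rc (rc / (‖A‖ + 1))) := by rw [hρ]; linarith
    have hρr : ρ < r := hρm.trans_le ((min_le_left _ _).trans (min_le_left _ _))
    have hρΩ : ρ < rΩ := hρm.trans_le ((min_le_left _ _).trans (min_le_right _ _))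
    have hρc : ρ < rc := hρm.trans_le ((min_le_right _ _).trans (min_le_left _ _))
    have hρA : ρ < rc / (‖A‖ + 1) := hρm.trans_le ((min_le_right _ _).trans (min_le_right _ _))
    rw [lt_div_iff₀ (by positivity)] at hρA
    have hBΩ : Metric.closedBall z ρ ⊆ Ω := (Metric.closedBall_subset_ball hρΩ).trans hrΩ'
    have hBc : IsCompact (Metric.closedBall z ρ) := isCompact_closedBall z ρ
    have hzz : quad z p A z = 0 := by simp [quad]
    have hzB : z ∈ Metric.closedBall z ρ := Metric.mem_closedBall_self hρ0.le
    have hstr : ∀ y ∈ Metric.closedBall z ρ, y ≠ z →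
        v t₀ y - quad z p A y < v t₀ z - quad z p A z := by
      intro y hy hne
      have hy' : ‖y - z‖ ≤ ρ := by rwa [Metric.mem_closedBall, dist_eq_norm] at hy
      have := hst y (hΩK (hBΩ hy)) hne (hy'.trans_lt hρr)
      linarith
    refine ⟨ρ, hρ0, hBΩ.trans hΩK, le_antisymm (paramMax_le ⟨z, hzB⟩ fun y hy => ?_) ?_, ?_⟩
    · rcases eq_or_ne y z with rfl | hne
      · linarith
      · linarith [hstr y hy hne]
    · have := le_paramMax hBc (continuous_sub_quad hv z p A) t₀ hzB
      linarith
    · filter_upwards [eventually_argmax_mem hBc (continuous_sub_quad hv z p A) hzB hstr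
        Metric.isOpen_ball (Metric.mem_ball_self hρ0), Ioo_mem_nhds ht₀.1 ht₀.2] with t ht htI
      intro θ hθ hθmax
      obtain ⟨x, hxB, hx⟩ := exists_eq_paramMax hBc ⟨z, hzB⟩ (continuous_sub_quad hv z p A) t
      have hxball := ht x hxB fun y hy => by
        rw [← hx]; exact le_paramMax hBc (continuous_sub_quad hv z p A) t hy
      have h1 := hsv.le_deriv_of_isLocalMax hv hBc hA htI (hBΩ hxB)
        (mem_of_superset (Metric.isOpen_ball.mem_nhds hxball) Metric.ball_subset_closedBall)
        hx hθ hθmax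
      have hxz : ‖x - z‖ < ρ := by rwa [Metric.mem_ball, dist_eq_norm] at hxball
      refine (hrc' t (Ioo_subset_Icc_self htI) x (hBΩ hxB) (p + A (x - z)) (hxz.trans hρc)
        ?_).trans h1
      rw [add_sub_cancel_left]
      have := A.le_opNorm (x - z)
      nlinarith [norm_nonneg A, norm_nonneg (x - z)]
  set p := (lam / 2) • (x₀ - y₀) + (1 / 2 : ℝ) • q with hp
  set p' := (lam / 2) • (y₀ - x₀) + (1 / 2 : ℝ) • q with hp'
  obtain ⟨ρ₁, hρ₁, hK₁, hN₁, hE₁⟩ := loc hu hsu hcF hx₀ hX htu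
  obtain ⟨ρ₂, hρ₂, hK₂, hN₂, hE₂⟩ := loc hw hsw hcF₂ hy₀ hY htw
  set N₁ := paramMax (fun s y => u s y - quad x₀ p X y) (Metric.closedBall x₀ ρ₁)
  set N₂ := paramMax (fun s y => w s y - quad y₀ p' Y y) (Metric.closedBall y₀ ρ₂)
  have hB₁ : IsCompact (Metric.closedBall x₀ ρ₁) := isCompact_closedBall _ _
  have hB₂ : IsCompact (Metric.closedBall y₀ ρ₂) := isCompact_closedBall _ _
  have hN₁c : Continuous N₁ := continuous_paramMax hB₁ (continuous_sub_quad hu _ _ _)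
  have hN₂c : Continuous N₂ := continuous_paramMax hB₂ (continuous_sub_quad hw _ _ _)
  obtain ⟨C₁, hC₁⟩ := hbF (max ‖p‖ ‖X‖)
  obtain ⟨C₂, hC₂⟩ := hbF₂ (max ‖p'‖ ‖Y‖)
  have hΨc := continuous_doubled hu hw lam q
  have hE₃ := eventually_argmax_mem (hK.prod hK) hΨc (t₀ := t₀)
    (mk_mem_prod (hΩK hx₀) (hΩK hy₀)) (by
      rintro ⟨x, y⟩ ⟨hx, hy⟩ hne
      refine lt_of_le_of_ne (hmax x hx y hy) fun h => hne ?_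
      obtain ⟨rfl, rfl⟩ := huniq x hx y hy h
      rfl)
    ((Metric.isOpen_ball (x := x₀) (ε := ρ₁)).prod (Metric.isOpen_ball (x := y₀) (ε := ρ₂)))
    (mk_mem_prod (Metric.mem_ball_self hρ₁) (Metric.mem_ball_self hρ₂))
  obtain ⟨ε, hε, hball⟩ := Metric.eventually_nhds_iff.1
    ((hE₁.and hE₂).and (hE₃.and (Ioo_mem_nhds ht₀.1 ht₀.2)))
  filter_upwards [Ioo_mem_nhdsLT (by linarith : t₀ - ε < t₀)] with t ht
  have hball' : ∀ s ∈ Icc t t₀, dist s t₀ < ε := by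
    intro s hs
    rw [Real.dist_eq, abs_lt]
    constructor <;> linarith [hs.1, hs.2, ht.1]
  have key := le_sub_of_superdiff_add (N₁ := N₁) (N₂ := N₂)
    (h₁ := fun s => F s x₀ p X - κ / 4) (h₂ := fun s => F₂ s y₀ p' Y - κ / 4)
    (C := max C₁ C₂ + κ / 4) (κ := κ / 2) ht.2.le hN₁c.continuousOn hN₂c.continuousOn
    (fun s hs => (hball (hball' s (Ioo_subset_Icc_self hs))).1.1)
    (fun s hs => (hball (hball' s (Ioo_subset_Icc_self hs))).1.2)
    (fun s hs => by
      have hsI := (hball (hball' s (Ioo_subset_Icc_self hs))).2.2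
      have := hC₁ s (Ioo_subset_Icc_self hsI) x₀ hx₀ p X (le_max_left _ _) (le_max_right _ _)
      linarith [le_max_left C₁ C₂])
    (fun s hs => by
      have hsI := (hball (hball' s (Ioo_subset_Icc_self hs))).2.2
      have := hC₂ s (Ioo_subset_Icc_self hsI) y₀ hy₀ p' Y (le_max_left _ _) (le_max_right _ _)
      linarith [le_max_right C₁ C₂])
    (fun s hs => by
      have hsI := (hball (hball' s (Ioo_subset_Icc_self hs))).2.2
      have := hF s (Ioo_subset_Icc_self hsI)
      linarith)
  rw [hN₁, hN₂] at key
  obtain ⟨⟨x₁, y₁⟩, ⟨hx₁K, hy₁K⟩, hxy₁⟩ := (hK.prod hK).exists_isMaxOn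
    ⟨(x₀, y₀), mk_mem_prod (hΩK hx₀) (hΩK hy₀)⟩
    (hΨc.comp (Continuous.prodMk_right t)).continuousOn
  obtain ⟨hx₁, hy₁⟩ := (hball (hball' t ⟨le_rfl, ht.2.le⟩)).2.1 (x₁, y₁)
    (mk_mem_prod hx₁K hy₁K) fun z hz => hxy₁ hz
  intro x hx y hy
  refine le_trans (hxy₁ (mk_mem_prod hx hy)) ?_
  have l₁ := le_paramMax hB₁ (continuous_sub_quad hu x₀ p X) t (Metric.ball_subset_closedBall hx₁)
  have l₂ := le_paramMax hB₂ (continuous_sub_quad hw y₀ p' Y) t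
    (Metric.ball_subset_closedBall hy₁)
  change u t x₁ + w t y₁ - lam / 4 * ‖x₁ - y₁‖ ^ 2 - 1 / 2 * inner ℝ q (x₁ + y₁) ≤ _
  change u t x₁ - quad x₀ p X x₁ ≤ N₁ t at l₁
  change w t y₁ - quad y₀ p' Y y₁ ≤ N₂ t at l₂
  have hxy := hXY (x₁ - x₀) (y₁ - y₀)
  unfold quad at l₁ l₂
  set k := x₁ - x₀ with hk
  set l := y₁ - y₀ with hl
  have ex : x₁ = x₀ + k := by rw [hk]; abel
  have ey : y₁ = y₀ + l := by rw [hl]; abel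
  have e1 : ‖x₁ - y₁‖ ^ 2 = ‖x₀ - y₀‖ ^ 2 + 2 * inner ℝ (x₀ - y₀) (k - l) + ‖k - l‖ ^ 2 := by
    rw [← norm_add_sq_real]; congr 2; rw [ex, ey]; abel
  have e2 : inner ℝ q (x₁ + y₁) = inner ℝ q (x₀ + y₀) + inner ℝ q k + inner ℝ q l := by
    rw [← inner_add_right, ← inner_add_right]; congr 1; rw [ex, ey]; abel
  have e3 : inner ℝ p k = lam / 2 * inner ℝ (x₀ - y₀) k + 1 / 2 * inner ℝ q k := by
    rw [hp, inner_add_left, inner_smul_left, inner_smul_left]; rfl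
  have e4 : inner ℝ p' l = -(lam / 2 * inner ℝ (x₀ - y₀) l) + 1 / 2 * inner ℝ q l := by
    rw [hp', inner_add_left, inner_smul_left, inner_smul_left, ← neg_sub x₀ y₀, inner_neg_left]
    simp
  rw [e1, e2]
  rw [inner_sub_right]
  rw [e3] at l₁
  rw [e4] at l₂
  linarith

end Parabolic

section IntegratedGrowth

open MeasureTheory

/-- If almost every function `t ↦ M q t` increases linearly from the left at `t₀`, and all of them
satisfy a uniform one-sided bound, then the integral over `q` also increases from the left. -/
theorem eventually_integral_lt_of_left_growth {α : Type*} [MeasurableSpace α] {ν : Measure α}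
    [IsFiniteMeasure ν] (hν : ν ≠ 0) {M : α → ℝ → ℝ} {t₀ κ C : ℝ} (hκ : 0 < κ)
    (hM : ∀ t, Integrable (fun q => M q t) ν)
    (h₁ : ∀ᵐ q ∂ν, ∀ᶠ t in 𝓝[<] t₀, M q t ≤ M q t₀ - κ * (t₀ - t))
    (h₂ : ∀ᶠ t in 𝓝[<] t₀, ∀ᵐ q ∂ν, M q t ≤ M q t₀ + C * (t₀ - t)) :
    ∀ᶠ t in 𝓝[<] t₀, ∫ q, M q t ∂ν < ∫ q, M q t₀ ∂ν := by
  have hlt : ∀ᶠ t in 𝓝[<] t₀, t < t₀ := eventually_mem_nhdsWithin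
  set g : ℝ → α → ℝ := fun t q => max ((M q t - M q t₀) / (t₀ - t)) (-κ) with hg
  have hint : ∀ t, Integrable (fun q => (M q t - M q t₀) / (t₀ - t)) ν := fun t =>
    ((hM t).sub (hM t₀)).div_const _
  have hgi : ∀ t, Integrable (g t) ν := fun t => (hint t).sup (integrable_const _)
  have lim : Tendsto (fun t => ∫ q, g t q ∂ν) (𝓝[<] t₀) (𝓝 (∫ _, (-κ) ∂ν)) := by
    refine tendsto_integral_filter_of_dominated_convergence (fun _ => max κ |C|)
      (.of_forall fun t => (hgi t).aestronglyMeasurable) ?_ (integrable_const _) ?_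
    · filter_upwards [h₂, hlt] with t ht htt
      filter_upwards [ht] with q hq
      have hpos : 0 < t₀ - t := by linarith
      have : (M q t - M q t₀) / (t₀ - t) ≤ C := by
        rw [div_le_iff₀ hpos]; linarith
      rw [Real.norm_eq_abs, abs_le]
      constructor
      · have := le_max_right ((M q t - M q t₀) / (t₀ - t)) (-κ)
        have := le_max_left κ |C|
        simp only [hg]; linarith
      · refine max_le (this.trans ((le_abs_self C).trans (le_max_right _ _))) ?_
        have := le_max_left κ |C|
        linarith
    · filter_upwards [h₁] with q hq
      refine tendsto_const_nhds.congr' ?_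
      filter_upwards [hq, hlt] with t ht htt
      have hpos : 0 < t₀ - t := by linarith
      symm
      refine max_eq_right ?_
      rw [div_le_iff₀ hpos]; linarith
  have hneg : ∫ _, (-κ) ∂ν < 0 := by
    have : 0 < ν.real univ := by
      exact ENNReal.toReal_pos (by simpa using hν) (measure_ne_top _ _)
    rw [integral_const, smul_eq_mul]
    nlinarith
  filter_upwards [lim.eventually_lt_const hneg, hlt] with t ht htt
  have hpos : 0 < t₀ - t := by linarith
  have h3 : ∫ q, (M q t - M q t₀) / (t₀ - t) ∂ν < 0 :=
    (integral_mono (hint t) (hgi t) fun q => le_max_left _ _).trans_lt ht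
  rw [integral_div, integral_sub (hM t) (hM t₀), div_lt_iff₀ hpos] at h3
  linarith

end IntegratedGrowth

section Comparison

variable {E : Type*} [NormedAddCommGroup E] [InnerProductSpace ℝ E]
  {T : ℝ} {Ω K : Set E} {u w : ℝ → E → ℝ} {F F₂ : ℝ → E → E → (E →L[ℝ] E) → ℝ}

/-- For a large penalization parameter, almost maximizers of the doubled functional are interior
and maximizers are close to the diagonal. -/
theorem exists_penalization (hK : IsCompact K) (hu : Continuous (↿u)) (hw : Continuous (↿w))
    {D : ℝ} (hD : ∀ x ∈ K, ‖x‖ ≤ D)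
    (hbd : ∀ t ∈ Icc 0 T, ∀ x ∈ K, (x ∉ Ω ∨ t = T) → u t x + w t x ≤ 0) {μ ε : ℝ} (hμ : 0 < μ)
    (hε : 0 < ε) :
    ∃ lam > 0, (∀ t ∈ Icc 0 T, ∀ x ∈ K, ∀ y ∈ K,
        μ / 4 ≤ u t x + w t y - lam / 4 * ‖x - y‖ ^ 2 → x ∈ Ω ∧ y ∈ Ω ∧ t < T) ∧
      ∀ t ∈ Icc 0 T, ∀ q, ‖q‖ ≤ 1 → ∀ x ∈ K, ∀ y ∈ K,
        doubled u w lam q t (x, x) ≤ doubled u w lam q t (x, y) →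
        ‖x - y‖ ≤ ε ∧ lam * ‖x - y‖ ^ 2 ≤ 6 * ε := by
  have hc : IsCompact (Icc 0 T ×ˢ K) := isCompact_Icc.prod hK
  have hu' : Continuous fun z : ℝ × E => u z.1 z.2 := hu
  have hw' : Continuous fun z : ℝ × E => w z.1 z.2 := hw
  obtain ⟨B₁, hB₁⟩ := hc.exists_bound_of_continuousOn hu'.continuousOn
  obtain ⟨B₂, hB₂⟩ := hc.exists_bound_of_continuousOn hw'.continuousOn
  obtain ⟨δ₁, hδ₁, hU₁⟩ := Metric.uniformContinuousOn_iff.1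
    (hc.uniformContinuousOn_of_continuous hu'.continuousOn) (min (μ / 8) ε) (by positivity)
  obtain ⟨δ₂, hδ₂, hU₂⟩ := Metric.uniformContinuousOn_iff.1
    (hc.uniformContinuousOn_of_continuous hw'.continuousOn) (min (μ / 8) ε) (by positivity)
  set δ := min (min δ₁ δ₂) ε with hδ
  have hδ0 : 0 < δ := by positivity
  set B := |B₁| + |B₂| + |B₂| + |D| + 1 with hB
  have hB0 : 0 < B := by positivity
  have close : ∀ t ∈ Icc 0 T, ∀ x ∈ K, ∀ y ∈ K, ‖x - y‖ < δ →
      |u t x - u t y| < min (μ / 8) ε ∧ |w t x - w t y| < min (μ / 8) ε := by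
    intro t ht x hx y hy hxy
    have hd : dist (t, x) (t, y) = ‖x - y‖ := by
      rw [Prod.dist_eq, dist_self, dist_eq_norm]; exact max_eq_right (norm_nonneg _)
    constructor
    · have := hU₁ (t, x) ⟨ht, hx⟩ (t, y) ⟨ht, hy⟩
        (by rw [hd]; exact hxy.trans_le ((min_le_left _ _).trans (min_le_left _ _)))
      rwa [Real.dist_eq] at this
    · have := hU₂ (t, x) ⟨ht, hx⟩ (t, y) ⟨ht, hy⟩
        (by rw [hd]; exact hxy.trans_le ((min_le_left _ _).trans (min_le_right _ _)))
      rwa [Real.dist_eq] at this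
  have far : ∀ d : ℝ, 4 * B / δ ^ 2 / 4 * d ^ 2 < B → 0 ≤ d → d < δ := by
    intro d h hd
    have h' : B * d ^ 2 < B * δ ^ 2 := by
      have e : 4 * B / δ ^ 2 / 4 * d ^ 2 = B * d ^ 2 / δ ^ 2 := by field_simp
      rw [e, div_lt_iff₀ (by positivity)] at h
      linarith
    have := lt_of_mul_lt_mul_left h' hB0.le
    nlinarith
  refine ⟨4 * B / δ ^ 2, by positivity, ?_, ?_⟩
  · intro t ht x hx y hy h
    have a1 := (le_abs_self _).trans ((hB₁ (t, x) ⟨ht, hx⟩).trans (le_abs_self B₁))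
    have a2 := (le_abs_self _).trans ((hB₂ (t, y) ⟨ht, hy⟩).trans (le_abs_self B₂))
    simp only at a1 a2
    have hxy := far ‖x - y‖ (by
      have := abs_nonneg B₂; have := abs_nonneg D; linarith) (norm_nonneg _)
    obtain ⟨c1, c2⟩ := close t ht x hx y hy hxy
    have c1' := (abs_lt.1 c1).2.trans_le (min_le_left _ _)
    have c2' := (abs_lt.1 c2).1
    have c3 := min_le_left (μ / 8) ε
    have hn : 0 ≤ 4 * B / δ ^ 2 / 4 * ‖x - y‖ ^ 2 := by positivity
    refine ⟨?_, ?_, ?_⟩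
    · by_contra hxΩ
      have := hbd t ht x hx (Or.inl hxΩ)
      linarith
    · by_contra hyΩ
      have := hbd t ht y hy (Or.inl hyΩ)
      linarith
    · refine lt_of_le_of_ne ht.2 fun htT => ?_
      have := hbd t ht x hx (Or.inr htT)
      linarith
  · intro t ht q hq x hx y hy h
    unfold doubled at h
    simp only [sub_self, norm_zero] at h
    have a1 := abs_le.1 ((hB₂ (t, x) ⟨ht, hx⟩).trans (le_abs_self B₂))
    have a2 := abs_le.1 ((hB₂ (t, y) ⟨ht, hy⟩).trans (le_abs_self B₂))
    simp only at a1 a2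
    have e : inner ℝ q (x + x) - inner ℝ q (x + y) = inner ℝ q (x - y) := by
      rw [← inner_sub_right]; congr 1; abel
    have b1 : |inner ℝ q (x - y)| ≤ ‖x - y‖ := by
      refine (abs_real_inner_le_norm q (x - y)).trans ?_
      nlinarith [norm_nonneg (x - y)]
    have b2 : ‖x - y‖ ≤ 2 * |D| := by
      have := norm_sub_le x y
      linarith [hD x hx, hD y hy, le_abs_self D]
    have b3 := (abs_le.1 b1).2
    have hxy := far ‖x - y‖ (by
      have := abs_nonneg B₁; linarith [a1.1, a2.2]) (norm_nonneg _)
    obtain ⟨-, c2⟩ := close t ht x hx y hy hxy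
    have c2' := (abs_lt.1 c2).1
    have c3 := min_le_right (μ / 8) ε
    have c4 : ‖x - y‖ ≤ ε := hxy.le.trans (min_le_right _ _)
    exact ⟨c4, by linarith⟩

/-- One-sided Lipschitz bound in time for the maximum of the doubled functional. -/
theorem exists_crude_growth (hK : IsCompact K) (hne : K.Nonempty) (hΩ : IsOpen Ω) (hΩK : Ω ⊆ K)
    (hu : Continuous (↿u)) (hw : Continuous (↿w))
    (hsu : IsParabolicSub T Ω u F) (hsw : IsParabolicSub T Ω w F₂)
    (hbF : ∀ ρ, ∃ C, ∀ t ∈ Icc 0 T, ∀ x ∈ Ω, ∀ p A, ‖p‖ ≤ ρ → ‖A‖ ≤ ρ → -C ≤ F t x p A)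
    (hbF₂ : ∀ ρ, ∃ C, ∀ t ∈ Icc 0 T, ∀ x ∈ Ω, ∀ p A, ‖p‖ ≤ ρ → ‖A‖ ≤ ρ → -C ≤ F₂ t x p A)
    {D : ℝ} (hD : ∀ x ∈ K, ‖x‖ ≤ D) {lam μ r₀ : ℝ} (hlam : 0 < lam) (hμ : 0 < μ) (hr₀ : 0 ≤ r₀)
    (hr : r₀ * D ≤ μ / 16)
    (hI : ∀ t ∈ Icc 0 T, ∀ x ∈ K, ∀ y ∈ K,
        μ / 4 ≤ u t x + w t y - lam / 4 * ‖x - y‖ ^ 2 → x ∈ Ω ∧ y ∈ Ω ∧ t < T) :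
    ∃ C, ∃ τ > 0, ∀ q, ‖q‖ ≤ r₀ → ∀ t s, 0 ≤ t → t ≤ s → s ≤ T → s ≤ t + τ →
      μ / 2 ≤ paramMax (doubled u w lam q) (K ×ˢ K) t →
      paramMax (doubled u w lam q) (K ×ˢ K) t ≤
        paramMax (doubled u w lam q) (K ×ˢ K) s + C * (s - t) := by
  have hc : IsCompact (Icc 0 T ×ˢ K) := isCompact_Icc.prod hK
  have hu' : Continuous fun z : ℝ × E => u z.1 z.2 := hu
  have hw' : Continuous fun z : ℝ × E => w z.1 z.2 := hw
  obtain ⟨τ₁, hτ₁, hU₁⟩ := Metric.uniformContinuousOn_iff.1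
    (hc.uniformContinuousOn_of_continuous hu'.continuousOn) (μ / 16) (by positivity)
  obtain ⟨τ₂, hτ₂, hU₂⟩ := Metric.uniformContinuousOn_iff.1
    (hc.uniformContinuousOn_of_continuous hw'.continuousOn) (μ / 16) (by positivity)
  have hD0 : 0 ≤ D := by
    obtain ⟨x, hx⟩ := hne
    exact (norm_nonneg x).trans (hD x hx)
  set ρ := r₀ + lam * (2 * D) + lam with hρ
  obtain ⟨C₁, hC₁⟩ := hbF ρ
  obtain ⟨C₂, hC₂⟩ := hbF₂ ρ
  set L : E →L[ℝ] E := lam • ContinuousLinearMap.id ℝ E with hL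
  have hLs : ∀ a b, inner ℝ (L a) b = inner ℝ a (L b) := by
    intro a b; simp [hL, inner_smul_left, inner_smul_right]
  have hLn : ‖L‖ ≤ ρ := by
    have h1 : ‖L‖ ≤ lam * 1 := by
      rw [hL, norm_smul, Real.norm_of_nonneg hlam.le]
      exact mul_le_mul_of_nonneg_left ContinuousLinearMap.norm_id_le hlam.le
    have : 0 ≤ lam * (2 * D) := by positivity
    linarith
  refine ⟨C₁ + C₂, min τ₁ τ₂ / 2, by positivity, ?_⟩
  intro q hq t s ht0 hts hsT hsτ hμt
  have hΨ := continuous_doubled hu hw lam q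
  obtain ⟨⟨x, y⟩, ⟨hx, hy⟩, hxy⟩ := exists_eq_paramMax (hK.prod hK) (hne.prod hne) hΨ t
  simp only at hx hy
  set c : E := (1 / 2 : ℝ) • (x + y) with hcdef
  have hcn : ‖c‖ ≤ D := by
    rw [hcdef, norm_smul]
    have := norm_add_le x y
    norm_num
    linarith [hD x hx, hD y hy]
  have hqK : ∀ z z', z ∈ K → z' ∈ K → -(μ / 16) ≤ 1 / 2 * inner ℝ q (z + z') := by
    intro z z' hz hz'
    have h1 := (abs_le.1 (abs_real_inner_le_norm q (z + z'))).1
    have h2 := norm_add_le z z'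
    have h3 : ‖q‖ * ‖z + z'‖ ≤ r₀ * (2 * D) :=
      mul_le_mul hq (by linarith [hD z hz, hD z' hz']) (norm_nonneg _) hr₀
    linarith
  have split : ∀ s' x' y', (u s' x' - quad c ((1 / 2 : ℝ) • q) L x')
      + (w s' y' - quad c ((1 / 2 : ℝ) • q) L y') =
      u s' x' + w s' y' - lam / 2 * (‖x' - c‖ ^ 2 + ‖y' - c‖ ^ 2)
        - 1 / 2 * inner ℝ q (x' + y') + inner ℝ q c := by
    intro s' x' y'
    have hq : ∀ z, quad c ((1 / 2 : ℝ) • q) L z =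
        1 / 2 * inner ℝ q z - 1 / 2 * inner ℝ q c + lam / 2 * ‖z - c‖ ^ 2 := by
      intro z
      have e : L (z - c) = lam • (z - c) := rfl
      unfold quad
      rw [e, real_inner_smul_left, real_inner_smul_left, real_inner_self_eq_norm_sq,
        inner_sub_right]
      ring
    rw [hq, hq, inner_add_right]
    ring
  have par : ∀ x' y' : E, ‖x' - y'‖ ^ 2 ≤ 2 * (‖x' - c‖ ^ 2 + ‖y' - c‖ ^ 2) := by
    intro x' y'
    have e : x' - y' = (x' - c) - (y' - c) := by abel
    rw [e]
    have := parallelogram_law_with_norm ℝ (x' - c) (y' - c)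
    nlinarith [sq_nonneg ‖x' - c + (y' - c)‖]
  have le_doubled : ∀ s' x' y', (u s' x' - quad c ((1 / 2 : ℝ) • q) L x')
      + (w s' y' - quad c ((1 / 2 : ℝ) • q) L y') ≤
      doubled u w lam q s' (x', y') + inner ℝ q c := by
    intro s' x' y'
    rw [split]
    unfold doubled
    nlinarith [par x' y']
  have eq_doubled : ∀ s', (u s' x - quad c ((1 / 2 : ℝ) • q) L x)
      + (w s' y - quad c ((1 / 2 : ℝ) • q) L y) =
      doubled u w lam q s' (x, y) + inner ℝ q c := by
    intro s'
    rw [split]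
    unfold doubled
    have e1 : x - c = (1 / 2 : ℝ) • (x - y) := by rw [hcdef]; module
    have e2 : y - c = -((1 / 2 : ℝ) • (x - y)) := by rw [hcdef]; module
    rw [e1, e2, norm_neg, norm_smul]
    norm_num
    ring
  -- values at nearby times
  have near : ∀ s' ∈ Icc t s, |u s' x - u t x| < μ / 16 ∧ |w s' y - w t y| < μ / 16 := by
    intro s' hs'
    have hs'I : s' ∈ Icc 0 T := ⟨ht0.trans hs'.1, hs'.2.trans hsT⟩
    have htI : t ∈ Icc 0 T := ⟨ht0, hts.trans hsT⟩
    have hd : ∀ z : E, dist (s', z) (t, z) < min τ₁ τ₂ := by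
      intro z
      have hm : 0 < min τ₁ τ₂ := by positivity
      rw [Prod.dist_eq, dist_self, Real.dist_eq]
      refine max_lt ?_ hm
      rw [abs_lt]
      constructor <;> linarith [hs'.1, hs'.2]
    have h1 := hU₁ (s', x) ⟨hs'I, hx⟩ (t, x) ⟨htI, hx⟩ ((hd x).trans_le (min_le_left _ _))
    have h2 := hU₂ (s', y) ⟨hs'I, hy⟩ (t, y) ⟨htI, hy⟩ ((hd y).trans_le (min_le_right _ _))
    rw [Real.dist_eq] at h1 h2
    exact ⟨h1, h2⟩
  have near' : ∀ s' ∈ Icc t s, μ / 2 - μ / 8 + inner ℝ q c ≤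
      (u s' x - quad c ((1 / 2 : ℝ) • q) L x) + (w s' y - quad c ((1 / 2 : ℝ) • q) L y) := by
    intro s' hs'
    have h1 := eq_doubled t
    have h2 := (abs_lt.1 (near s' hs').1).1
    have h3 := (abs_lt.1 (near s' hs').2).1
    linarith
  -- the two decoupled maxima
  have mono : ∀ {v : ℝ → E → ℝ} {G : ℝ → E → E → (E →L[ℝ] E) → ℝ} {C : ℝ}, Continuous (↿v) →
      IsParabolicSub T Ω v G →
      (∀ t ∈ Icc 0 T, ∀ x ∈ Ω, ∀ p A, ‖p‖ ≤ ρ → ‖A‖ ≤ ρ → -C ≤ G t x p A) →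
      (∀ s' ∈ Icc t s, ∀ z ∈ K, (∀ z' ∈ K, v s' z' - quad c ((1 / 2 : ℝ) • q) L z' ≤
        v s' z - quad c ((1 / 2 : ℝ) • q) L z) → z ∈ Ω) →
      paramMax (fun s y => v s y - quad c ((1 / 2 : ℝ) • q) L y) K t ≤
        paramMax (fun s y => v s y - quad c ((1 / 2 : ℝ) • q) L y) K s + C * (s - t) := by
    intro v G C hv hsv hbG hin
    have hcv := continuous_sub_quad hv c ((1 / 2 : ℝ) • q) L
    have := monotoneOn_add_mul_of_superdiff (C := C) (a := t) (b := s)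
      (continuous_paramMax hK hcv).continuousOn (by
        intro s' hs' θ hθ hθm
        have hs'I : s' ∈ Ioo 0 T := ⟨ht0.trans_lt hs'.1, hs'.2.trans_le hsT⟩
        obtain ⟨z, hz, hzmax⟩ := exists_eq_paramMax hK hne hcv s'
        have hzΩ := hin s' (Ioo_subset_Icc_self hs') z hz fun z' hz' => by
          have := le_paramMax hK hcv s' hz'
          rw [hzmax] at this
          exact this
        refine (hbG s' (Ioo_subset_Icc_self hs'I) z hzΩ _ _ ?_ hLn).trans
          (hsv.le_deriv_of_isLocalMax hv hK hLs hs'I hzΩ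
            (mem_of_superset (hΩ.mem_nhds hzΩ) hΩK) hzmax hθ hθm)
        have h1 : ‖(1 / 2 : ℝ) • q‖ ≤ r₀ := by
          rw [norm_smul]; norm_num; linarith [norm_nonneg q]
        have h2 : ‖L (z - c)‖ ≤ lam * (2 * D) := by
          have e : L (z - c) = lam • (z - c) := rfl
          rw [e, norm_smul, Real.norm_of_nonneg hlam.le]
          have := norm_sub_le z c
          exact mul_le_mul_of_nonneg_left (by linarith [hD z hz]) hlam.le
        have := norm_add_le ((1 / 2 : ℝ) • q) (L (z - c))
        linarith)
    have := this ⟨le_rfl, hts⟩ ⟨hts, le_rfl⟩ hts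
    simp only at this
    linarith
  have hinI : ∀ s' ∈ Icc t s, s' ∈ Icc 0 T := fun s' hs' => ⟨ht0.trans hs'.1, hs'.2.trans hsT⟩
  have m₁ := mono hu hsu hC₁ (by
    intro s' hs' z hz hzmax
    refine (hI s' (hinI s' hs') z hz y hy ?_).1
    have h1 := near' s' hs'
    have h2 := hzmax x hx
    have h3 := le_doubled s' z y
    have h4 := hqK z y hz hy
    unfold doubled at h3
    simp only at h3
    linarith)
  have m₂ := mono hw hsw hC₂ (by
    intro s' hs' z hz hzmax
    refine (hI s' (hinI s' hs') x hx z hz ?_).2.1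
    have h1 := near' s' hs'
    have h2 := hzmax y hy
    have h3 := le_doubled s' x z
    have h4 := hqK x z hx hz
    unfold doubled at h3
    simp only at h3
    linarith)
  have l₁ := le_paramMax hK (continuous_sub_quad hu c ((1 / 2 : ℝ) • q) L) t hx
  have l₂ := le_paramMax hK (continuous_sub_quad hw c ((1 / 2 : ℝ) • q) L) t hy
  obtain ⟨x', hx', e₁⟩ :=
    exists_eq_paramMax hK hne (continuous_sub_quad hu c ((1 / 2 : ℝ) • q) L) s
  obtain ⟨y', hy', e₂⟩ :=
    exists_eq_paramMax hK hne (continuous_sub_quad hw c ((1 / 2 : ℝ) • q) L) s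
  have l₃ := le_doubled s x' y'
  have l₄ := le_paramMax (hK.prod hK) hΨ s (mk_mem_prod hx' hy')
  have l₅ := eq_doubled t
  rw [e₁] at m₁
  rw [e₂] at m₂
  rw [hxy]
  linarith

end Comparison

section ComparisonPrinciple

open MeasureTheory MeasureTheory.Measure

variable {E : Type*} [NormedAddCommGroup E] [InnerProductSpace ℝ E]
  {T : ℝ} {Ω K : Set E} {u w : ℝ → E → ℝ} {F F₂ : ℝ → E → E → (E →L[ℝ] E) → ℝ}

theorem paramMax_doubled_le_add {D r₀ : ℝ} (hK : IsCompact K) (hne : K.Nonempty)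
    (hu : Continuous (↿u)) (hw : Continuous (↿w)) (hD : ∀ x ∈ K, ‖x‖ ≤ D) {lam : ℝ} {q q' : E}
    (hq : ‖q - q'‖ ≤ r₀) (t : ℝ) :
    paramMax (doubled u w lam q) (K ×ˢ K) t ≤
      paramMax (doubled u w lam q') (K ×ˢ K) t + r₀ * D := by
  refine paramMax_le (hne.prod hne) ?_
  rintro ⟨x, y⟩ ⟨hx, hy⟩
  have h1 := le_paramMax (hK.prod hK) (continuous_doubled hu hw lam q') t (mk_mem_prod hx hy)
  have h2 := (abs_le.1 (abs_real_inner_le_norm (q - q') (x + y))).1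
  have h3 := norm_add_le x y
  have h4 : ‖q - q'‖ * ‖x + y‖ ≤ r₀ * (2 * D) :=
    mul_le_mul hq (by linarith [hD x hx, hD y hy]) (norm_nonneg _) ((norm_nonneg _).trans hq)
  rw [inner_sub_left] at h2
  unfold doubled at h1 ⊢
  simp only at h1 ⊢
  linarith

theorem continuous_paramMax_doubled (hK : IsCompact K) (hu : Continuous (↿u))
    (hw : Continuous (↿w)) (lam : ℝ) :
    Continuous (fun z : ℝ × E => paramMax (doubled u w lam z.2) (K ×ˢ K) z.1) := by
  have h1 : Continuous fun a : (ℝ × E) × E × E => u a.1.1 a.2.1 :=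
    hu.comp (f := fun a : (ℝ × E) × E × E => (a.1.1, a.2.1)) (by fun_prop)
  have h2 : Continuous fun a : (ℝ × E) × E × E => w a.1.1 a.2.2 :=
    hw.comp (f := fun a : (ℝ × E) × E × E => (a.1.1, a.2.2)) (by fun_prop)
  have h3 : Continuous fun a : (ℝ × E) × E × E => doubled u w lam a.1.2 a.1.1 a.2 := by
    unfold doubled
    fun_prop
  exact (hK.prod hK).continuous_sSup (f := fun (z : ℝ × E) => doubled u w lam z.2 z.1) h3

variable [FiniteDimensional ℝ E]

/-- Comparison principle for a pair of parabolic subsolutions whose operators satisfy the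
structure condition of the theory of viscosity solutions. Neither operator needs to be continuous
in time. -/
theorem add_nonpos_of_isParabolicSub (hK : IsCompact K) (hΩ : IsOpen Ω) (hΩK : Ω ⊆ K)
    (hu : Continuous (↿u)) (hw : Continuous (↿w))
    (hsu : IsParabolicSub T Ω u F) (hsw : IsParabolicSub T Ω w F₂)
    (hcF : ∀ x₀ ∈ Ω, ∀ p₀ A, ∀ η > 0, ∃ r > 0, ∀ t ∈ Icc 0 T, ∀ x ∈ Ω, ∀ p,
      ‖x - x₀‖ < r → ‖p - p₀‖ < r → F t x₀ p₀ A - η ≤ F t x p A)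
    (hcF₂ : ∀ x₀ ∈ Ω, ∀ p₀ A, ∀ η > 0, ∃ r > 0, ∀ t ∈ Icc 0 T, ∀ x ∈ Ω, ∀ p,
      ‖x - x₀‖ < r → ‖p - p₀‖ < r → F₂ t x₀ p₀ A - η ≤ F₂ t x p A)
    (hbF : ∀ ρ, ∃ C, ∀ t ∈ Icc 0 T, ∀ x ∈ Ω, ∀ p A, ‖p‖ ≤ ρ → ‖A‖ ≤ ρ → -C ≤ F t x p A)
    (hbF₂ : ∀ ρ, ∃ C, ∀ t ∈ Icc 0 T, ∀ x ∈ Ω, ∀ p A, ‖p‖ ≤ ρ → ‖A‖ ≤ ρ → -C ≤ F₂ t x p A)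
    {κ C₀ : ℝ} (hκ : 0 < κ) (hC₀ : 0 ≤ C₀)
    (hG : ∀ lam > 0, ∀ t ∈ Icc 0 T, ∀ x ∈ Ω, ∀ y ∈ Ω, ∀ (p p' : E) (A B : E →L[ℝ] E),
      (∀ a b, inner ℝ (A a) b = inner ℝ a (A b)) → (∀ a b, inner ℝ (B a) b = inner ℝ a (B b)) →
      (∀ k l, inner ℝ (A k) k + inner ℝ (B l) l ≤ lam / 2 * ‖k - l‖ ^ 2) →
      κ - C₀ * (lam * ‖x - y‖ ^ 2 + ‖x - y‖ * (1 + ‖p‖) + ‖p + p'‖) ≤ F t x p A + F₂ t y p' B)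
    (hbd : ∀ t ∈ Icc 0 T, ∀ x ∈ K, (x ∉ Ω ∨ t = T) → u t x + w t x ≤ 0) :
    ∀ t ∈ Icc 0 T, ∀ x ∈ K, u t x + w t x ≤ 0 := by
  intro tt htt xx hxx
  by_contra hpos
  push Not at hpos
  borelize E
  set μ := u tt xx + w tt xx with hμ
  have hne : K.Nonempty := ⟨xx, hxx⟩
  obtain ⟨D, hD1, hD⟩ : ∃ D, 1 ≤ D ∧ ∀ x ∈ K, ‖x‖ ≤ D := by
    obtain ⟨D, hD⟩ := hK.exists_bound_of_continuousOn (f := id) continuousOn_id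
    exact ⟨max 1 D, le_max_left _ _, fun x hx => (hD x hx).trans (le_max_right _ _)⟩
  have hD0 : 0 < D := by linarith
  set ε := κ / (42 * (C₀ + 1)) with hε
  have hε0 : 0 < ε := by positivity
  obtain ⟨lam, hlam, hI, hII⟩ := exists_penalization hK hu hw hD hbd hpos hε0
  set r₀ := min 1 (min (κ / (4 * (C₀ + 1))) (μ / (16 * D))) with hr₀
  have hr₀0 : 0 < r₀ := by positivity
  have hr₀1 : r₀ ≤ 1 := min_le_left _ _
  have hr₀κ : C₀ * r₀ ≤ κ / 4 := by
    have h := (min_le_right (1 : ℝ) _).trans (min_le_left (κ / (4 * (C₀ + 1))) (μ / (16 * D)))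
    rw [← hr₀, le_div_iff₀ (by positivity)] at h
    nlinarith
  have hr₀D : r₀ * D ≤ μ / 16 := by
    have h := (min_le_right (1 : ℝ) _).trans (min_le_right (κ / (4 * (C₀ + 1))) (μ / (16 * D)))
    rw [← hr₀, le_div_iff₀ (by positivity)] at h
    linarith
  have hεκ : C₀ * (21 / 2 * ε) ≤ κ / 4 := by
    have h : ε * (42 * (C₀ + 1)) = κ := by rw [hε]; field_simp
    nlinarith
  obtain ⟨C, τ, hτ, hcrude⟩ := exists_crude_growth hK hne hΩ hΩK hu hw hsu hsw hbF hbF₂ hD hlam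
    hpos hr₀0.le hr₀D hI
  set M : E → ℝ → ℝ := fun q t => paramMax (doubled u w lam q) (K ×ˢ K) t with hM
  have hMc : Continuous fun z : ℝ × E => M z.2 z.1 := continuous_paramMax_doubled hK hu hw lam
  set ball := Metric.closedBall (0 : E) r₀ with hball
  have hballc : IsCompact ball := isCompact_closedBall _ _
  have hmem : ∀ q ∈ ball, ‖q‖ ≤ r₀ := fun q hq => by simpa [hball] using hq
  have h0ball : (0 : E) ∈ ball := Metric.mem_closedBall_self hr₀0.le
  set H : Measure E := μH[(Module.finrank ℝ E : ℝ)] with hH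
  have : IsAddHaarMeasure H := isAddHaarMeasure_hausdorffMeasure
  set ν : Measure E := H.restrict ball with hν
  have : IsFiniteMeasure ν := ⟨by
    rw [hν, restrict_apply_univ]; exact hballc.measure_lt_top⟩
  have hνpos : 0 < ν.real univ := by
    refine ENNReal.toReal_pos ?_ (measure_ne_top _ _)
    rw [hν, restrict_apply_univ]
    exact (Metric.measure_closedBall_pos H 0 hr₀0).ne'
  have hν0 : ν ≠ 0 := by
    rintro h
    rw [h] at hνpos
    simp at hνpos
  have hMi : ∀ t, Integrable (fun q => M q t) ν := fun t =>
    (hMc.comp (Continuous.prodMk_right t)).continuousOn.integrableOn_compact hballc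
  set m : ℝ → ℝ := fun t => ∫ q, M q t ∂ν with hm
  have hmc : Continuous m := by
    have := continuous_parametric_integral_of_continuous (μ := H)
      (f := fun (t : ℝ) (q : E) => M q t) (by exact hMc) hballc
    convert this using 1
  -- at maximizers
  have hinner : ∀ q ∈ ball, ∀ z z', z ∈ K → z' ∈ K → -(μ / 16) ≤ 1 / 2 * inner ℝ q (z + z') := by
    intro q hq z z' hz hz'
    have h1 := (abs_le.1 (abs_real_inner_le_norm q (z + z'))).1
    have h2 := norm_add_le z z'
    have h3 : ‖q‖ * ‖z + z'‖ ≤ r₀ * (2 * D) :=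
      mul_le_mul (hmem q hq) (by linarith [hD z hz, hD z' hz']) (norm_nonneg _) hr₀0.le
    linarith
  have hmaxI : ∀ q ∈ ball, ∀ t ∈ Icc 0 T, μ / 2 ≤ M q t → ∃ x ∈ Ω, ∃ y ∈ Ω, t < T ∧
      M q t = doubled u w lam q t (x, y) := by
    intro q hq t ht hMt
    obtain ⟨⟨x, y⟩, ⟨hx, hy⟩, hxy⟩ :=
      exists_eq_paramMax (hK.prod hK) (hne.prod hne) (continuous_doubled hu hw lam q) t
    have h1 := hinner q hq x y hx hy
    have h2 : M q t = doubled u w lam q t (x, y) := hxy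
    obtain ⟨hxΩ, hyΩ, htT⟩ := hI t ht x hx y hy (by
      have h3 := h2
      unfold doubled at h3
      simp only at h3
      linarith)
    exact ⟨x, hxΩ, y, hyΩ, htT, h2⟩
  -- linear growth from the left for almost every tilt
  have hfine : ∀ t₀ ∈ Ioo 0 T, (∀ q ∈ ball, μ / 2 ≤ M q t₀) →
      ∀ᵐ q ∂ν, ∀ᶠ t in 𝓝[<] t₀, M q t ≤ M q t₀ - κ / 4 * (t₀ - t) := by
    intro t₀ ht₀ hMt₀
    have hut : Continuous (u t₀) := hu.comp (Continuous.prodMk_right t₀)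
    have hwt : Continuous (w t₀) := hw.comp (Continuous.prodMk_right t₀)
    obtain ⟨N, hN, hjets⟩ := exists_null_jets hK hne hut.continuousOn hwt.continuousOn hlam
    have hNae : ∀ᵐ q ∂ν, q ∉ N := ae_restrict_of_ae (measure_eq_zero_iff_ae_notMem.1 hN)
    filter_upwards [hNae, ae_restrict_mem hballc.measurableSet] with q hqN hqb
    obtain ⟨x₀, hx₀, y₀, hy₀, -, hMxy⟩ :=
      hmaxI q hqb t₀ (Ioo_subset_Icc_self ht₀) (hMt₀ q hqb)
    have hmax : ∀ x ∈ K, ∀ y ∈ K, doubled u w lam q t₀ (x, y) ≤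
        doubled u w lam q t₀ (x₀, y₀) := by
      intro x hx y hy
      rw [← hMxy]
      exact le_paramMax (hK.prod hK) (continuous_doubled hu hw lam q) t₀ (mk_mem_prod hx hy)
    obtain ⟨huniq, X, Y, hX, hY, hXY, r, hr, htu, htw⟩ :=
      hjets q hqN x₀ (hΩK hx₀) y₀ (hΩK hy₀) hmax
    have hq1 : ‖q‖ ≤ 1 := (hmem q hqb).trans hr₀1
    obtain ⟨hd1, hd2⟩ := hII t₀ (Ioo_subset_Icc_self ht₀) q hq1 x₀ (hΩK hx₀) y₀ (hΩK hy₀)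
      (hmax x₀ (hΩK hx₀) x₀ (hΩK hx₀))
    have hgrow := exists_left_linear_growth hK hΩ hΩK hu hw hsu hsw hcF hcF₂ hbF hbF₂
      (half_pos hκ) ht₀ hx₀ hy₀ hmax huniq hX hY hXY hr
      (fun x hx hxne hxr => by
        have := htu x hx hxne hxr
        unfold quad
        linarith)
      (fun y hy hyne hyr => by
        have := htw y hy hyne hyr
        unfold quad
        linarith)
      (by
        intro t ht
        refine le_trans ?_ (hG lam hlam t ht x₀ hx₀ y₀ hy₀ _ _ X Y hX hY hXY)
        have e1 : (lam / 2) • (x₀ - y₀) + (1 / 2 : ℝ) • q + ((lam / 2) • (y₀ - x₀)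
            + (1 / 2 : ℝ) • q) = q := by module
        rw [e1]
        have e2 : ‖(lam / 2) • (x₀ - y₀) + (1 / 2 : ℝ) • q‖ ≤ lam / 2 * ‖x₀ - y₀‖ + 1 / 2 := by
          refine (norm_add_le _ _).trans ?_
          rw [norm_smul, norm_smul, Real.norm_of_nonneg (by positivity)]
          norm_num
          linarith
        have e3 := mul_le_mul_of_nonneg_left e2 (norm_nonneg (x₀ - y₀))
        have e4 : lam * ‖x₀ - y₀‖ ^ 2 + ‖x₀ - y₀‖ * (1 + ‖(lam / 2) • (x₀ - y₀)
            + (1 / 2 : ℝ) • q‖) + ‖q‖ ≤ 21 / 2 * ε + r₀ := by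
          have := hmem q hqb
          nlinarith
        have := mul_le_mul_of_nonneg_left e4 hC₀
        linarith)
    filter_upwards [hgrow] with t ht
    refine paramMax_le (hne.prod hne) ?_
    rintro ⟨x, y⟩ ⟨hx, hy⟩
    have := ht x hx y hy
    rw [hMxy]
    unfold doubled
    simp only
    linarith
  have hdini : ∀ t₀ ∈ Ioo 0 T, ∀ t₁ ∈ Ico 0 t₀, (∀ t ∈ Icc t₁ t₀, ∀ q ∈ ball, μ / 2 ≤ M q t) →
      ∀ᶠ t in 𝓝[<] t₀, m t < m t₀ := by
    intro t₀ ht₀ t₁ ht₁ hlow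
    refine eventually_integral_lt_of_left_growth (C := C) hν0 (κ := κ / 4) (by positivity) hMi
      (hfine t₀ ht₀ (hlow t₀ ⟨ht₁.2.le, le_rfl⟩)) ?_
    filter_upwards [Ioo_mem_nhdsLT (max_lt ht₁.2 (by linarith : t₀ - τ < t₀))] with t ht
    filter_upwards [ae_restrict_mem hballc.measurableSet] with q hq
    have h1 := (le_max_left t₁ (t₀ - τ)).trans_lt ht.1
    have h2 := (le_max_right t₁ (t₀ - τ)).trans_lt ht.1
    exact hcrude q (hmem q hq) t t₀ (ht₁.1.trans h1.le) ht.2.le ht₀.2.le (by linarith)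
      (hlow t ⟨h1.le, ht.2.le⟩ q hq)
  have hq2 : ∀ q ∈ ball, ∀ q' ∈ ball, ∀ t, M q t ≤ M q' t + μ / 8 := by
    intro q hq q' hq' t
    have h : ‖q - q'‖ ≤ 2 * r₀ := by
      have := norm_sub_le q q'
      linarith [hmem q hq, hmem q' hq']
    have := paramMax_doubled_le_add hK hne hu hw hD (lam := lam) h t
    simp only [hM]
    linarith
  -- the maximum of the averaged functional over time
  obtain ⟨t₁, ht₁, hmt₁⟩ := isCompact_Icc.exists_isMaxOn ⟨tt, htt⟩ hmc.continuousOn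
  have hMt₁ : ∀ q ∈ ball, 3 / 4 * μ ≤ M q t₁ := by
    by_contra! hcon
    obtain ⟨q, hq, hlt⟩ := hcon
    have h1 : m t₁ ≤ ∫ _, (7 / 8 * μ) ∂ν := by
      refine integral_mono_ae (hMi t₁) (integrable_const _) ?_
      filter_upwards [ae_restrict_mem hballc.measurableSet] with q' hq'
      have := hq2 q' hq' q hq t₁
      linarith
    have h2 : ∫ _, (15 / 16 * μ) ∂ν ≤ m tt := by
      refine integral_mono_ae (integrable_const _) (hMi tt) ?_
      filter_upwards [ae_restrict_mem hballc.measurableSet] with q' hq'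
      have h3 := le_paramMax (hK.prod hK) (continuous_doubled hu hw lam q') tt
        (mk_mem_prod hxx hxx)
      have h4 := hinner (-q') (by rw [hball, mem_closedBall_zero_iff, norm_neg]; exact hmem q' hq')
        xx xx hxx hxx
      rw [inner_neg_left] at h4
      unfold doubled at h3
      simp only [sub_self, norm_zero] at h3
      change _ ≤ M q' tt at h3
      linarith
    have h3 : m tt ≤ m t₁ := hmt₁ htt
    rw [integral_const, smul_eq_mul] at h1 h2
    nlinarith
  obtain ⟨-, -, -, -, ht₁T, -⟩ := hmaxI 0 h0ball t₁ ht₁ (by linarith [hMt₁ 0 h0ball])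
  have hlow : ∀ᶠ t in 𝓝 t₁, 5 / 8 * μ < M 0 t :=
    (hMc.comp (continuous_id.prodMk continuous_const)).continuousAt.eventually_const_lt (by
      have := hMt₁ 0 h0ball
      change _ < M 0 t₁
      linarith)
  obtain ⟨δ, hδ, hlow'⟩ := Metric.eventually_nhds_iff.1 hlow
  set s := t₁ + min δ (T - t₁) / 2 with hs
  have hTt : 0 < T - t₁ := by linarith
  have hm0 : 0 < min δ (T - t₁) := lt_min hδ hTt
  have hst : t₁ < s := by linarith
  have hsT : s < T := by have := min_le_right δ (T - t₁); linarith
  have hlows : ∀ t ∈ Icc t₁ s, ∀ q ∈ ball, μ / 2 ≤ M q t := by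
    intro t ht q hq
    have h1 := hlow' (y := t) (by
      rw [Real.dist_eq, abs_lt]
      have := min_le_left δ (T - t₁)
      constructor <;> linarith [ht.1, ht.2])
    have := hq2 0 h0ball q hq t
    linarith
  obtain ⟨t₂, ht₂, hmt₂⟩ := (isCompact_Icc (a := t₁) (b := s)).exists_isMinOn
    ⟨s, hst.le, le_rfl⟩ hmc.continuousOn
  have down : ∀ t₀ ∈ Ioc t₁ s, ∃ t ∈ Icc t₁ t₀, m t < m t₀ := by
    intro t₀ ht₀
    have hev := hdini t₀ ⟨ht₁.1.trans_lt ht₀.1, ht₀.2.trans_lt hsT⟩ t₁ ⟨ht₁.1, ht₀.1⟩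
      (fun t ht => hlows t ⟨ht.1, ht.2.trans ht₀.2⟩)
    obtain ⟨t, ht, ht'⟩ := (hev.and (Ioo_mem_nhdsLT ht₀.1)).exists
    exact ⟨t, Ioo_subset_Icc_self ht', ht⟩
  obtain ⟨t, ht, htm⟩ := down s ⟨hst, le_rfl⟩
  have h1 : m t₂ ≤ m t := hmt₂ ht
  have h2 : m s ≤ m t₁ := hmt₁ ⟨ht₁.1.trans hst.le, hsT.le⟩
  have h3 : t₂ ≠ t₁ := by
    rintro rfl
    linarith
  obtain ⟨t', ht', htm'⟩ := down t₂ ⟨lt_of_le_of_ne ht₂.1 (Ne.symm h3), ht₂.2⟩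
  have h4 : m t₂ ≤ m t' := hmt₂ ⟨ht'.1, ht'.2.trans ht₂.2⟩
  linarith

end ComparisonPrinciple

section ControlHamiltonian

theorem sSup_image_le_add {ι : Type*} {U : Set ι} (hU : U.Nonempty) {φ ψ : ι → ℝ} {e : ℝ}
    (hψ : BddAbove (ψ '' U)) (h : ∀ a ∈ U, φ a ≤ ψ a + e) :
    sSup (φ '' U) ≤ sSup (ψ '' U) + e := by
  refine csSup_le (hU.image _) ?_
  rintro _ ⟨a, ha, rfl⟩
  have := le_csSup hψ (mem_image_of_mem ψ ha)
  linarith [h a ha]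

variable {E ι : Type*} [NormedAddCommGroup E] [InnerProductSpace ℝ E]

/-- The generator integrand `-⟪f, p⟫ - ½ ⟪A s, s⟫ - l` of a controlled diffusion. -/
noncomputable def genTerm (f s : E) (l : ℝ) (p : E) (A : E →L[ℝ] E) : ℝ :=
  -inner ℝ f p - 1 / 2 * inner ℝ (A s) s - l

/-- The Hamiltonian of a controlled diffusion with control set `U`. -/
noncomputable def ctrlHam (U : Set ι) (f s : ℝ → E → ι → E) (l : E → ι → ℝ) (t : ℝ) (x p : E)
    (A : E →L[ℝ] E) : ℝ :=
  sSup ((fun a => genTerm (f t x a) (s t x a) (l x a) p A) '' U)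

theorem abs_inner_clm_le (A : E →L[ℝ] E) (x y : E) : |inner ℝ (A x) y| ≤ ‖A‖ * ‖x‖ * ‖y‖ :=
  (abs_real_inner_le_norm _ _).trans
    (mul_le_mul_of_nonneg_right (A.le_opNorm x) (norm_nonneg y))

theorem abs_genTerm_le {f s : E} {l B : ℝ} (hf : ‖f‖ ≤ B) (hs : ‖s‖ ≤ B) (hl : |l| ≤ B) (p : E)
    (A : E →L[ℝ] E) : |genTerm f s l p A| ≤ B * ‖p‖ + ‖A‖ * B ^ 2 + B := by
  have hB : 0 ≤ B := (norm_nonneg f).trans hf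
  have h1 : |inner ℝ f p| ≤ B * ‖p‖ := (abs_real_inner_le_norm f p).trans (by gcongr)
  have h2 : |inner ℝ (A s) s| ≤ ‖A‖ * B ^ 2 :=
    (abs_inner_clm_le A s s).trans (by rw [mul_assoc, ← sq]; gcongr)
  unfold genTerm
  rw [abs_le] at *
  constructor <;> linarith [h1.1, h1.2, h2.1, h2.2, hl.1, hl.2]

theorem abs_genTerm_sub_le {f f' s s' p p' : E} {l l' B L r : ℝ} (hf : ‖f‖ ≤ B) (hs : ‖s‖ ≤ B)
    (hs' : ‖s'‖ ≤ B) (hff : ‖f - f'‖ ≤ L * r) (hss : ‖s - s'‖ ≤ L * r) (hll : |l - l'| ≤ L * r)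
    (hpp : ‖p - p'‖ ≤ r) (A : E →L[ℝ] E) :
    |genTerm f s l p A - genTerm f' s' l' p' A| ≤ (B + L * ‖p'‖ + ‖A‖ * B * L + L) * r := by
  have hB : 0 ≤ B := (norm_nonneg f).trans hf
  have hLr : 0 ≤ L * r := (norm_nonneg _).trans hff
  have h1 : |inner ℝ f (p - p')| ≤ B * r := (abs_real_inner_le_norm _ _).trans (by gcongr)
  have h2 : |inner ℝ (f - f') p'| ≤ (L * r) * ‖p'‖ :=
    (abs_real_inner_le_norm _ _).trans (by gcongr)
  have h3 : |inner ℝ (A (s - s')) s| ≤ ‖A‖ * (L * r) * B :=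
    (abs_inner_clm_le A _ _).trans (by gcongr)
  have h4 : |inner ℝ (A s') (s - s')| ≤ ‖A‖ * B * (L * r) :=
    (abs_inner_clm_le A _ _).trans (by gcongr)
  have e : genTerm f s l p A - genTerm f' s' l' p' A = -inner ℝ f (p - p') - inner ℝ (f - f') p'
      - 1 / 2 * inner ℝ (A (s - s')) s - 1 / 2 * inner ℝ (A s') (s - s') - (l - l') := by
    unfold genTerm
    simp only [map_sub, inner_sub_left, inner_sub_right]
    ring
  rw [e]
  rw [abs_le] at *
  constructor <;> linarith [h1.1, h1.2, h2.1, h2.2, h3.1, h3.2, h4.1, h4.2, hll.1, hll.2]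

/-- The structure inequality at the level of a single control. -/
theorem genTerm_neg_le {f f' s s' p p' : E} {l l' B L r lam : ℝ} (hlam : 0 ≤ lam) (hf' : ‖f'‖ ≤ B)
    (hff : ‖f - f'‖ ≤ L * r) (hss : ‖s - s'‖ ≤ L * r) (hll : |l - l'| ≤ L * r)
    {A A' : E →L[ℝ] E}
    (hAA : ∀ a b, inner ℝ (A a) a + inner ℝ (A' b) b ≤ lam / 2 * ‖a - b‖ ^ 2) :
    genTerm f' s' l' (-p') (-A') ≤ genTerm f s l p A
      + (B * ‖p + p'‖ + L * r * ‖p‖ + lam * (L * r) ^ 2 + L * r) := by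
  have hLr : 0 ≤ L * r := (norm_nonneg _).trans hff
  have h1 : inner ℝ f' (p + p') ≤ B * ‖p + p'‖ := (real_inner_le_norm _ _).trans (by gcongr)
  have h2 : inner ℝ (f - f') p ≤ L * r * ‖p‖ := (real_inner_le_norm _ _).trans (by gcongr)
  have h3 := hAA s s'
  have h4 : lam / 2 * ‖s - s'‖ ^ 2 ≤ lam / 2 * (L * r) ^ 2 := by gcongr
  have h5 : 0 ≤ lam * (L * r) ^ 2 := by positivity
  have h6 := (abs_le.1 hll).2
  rw [inner_add_right] at h1
  rw [inner_sub_left] at h2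
  unfold genTerm
  simp only [inner_neg_right, inner_neg_left, _root_.neg_apply]
  linarith

variable {U : Set ι} {f s : ℝ → E → ι → E} {l : E → ι → ℝ} {T B L : ℝ} {Ω : Set E}

theorem bddAbove_genTerm (hf : ∀ t ∈ Icc 0 T, ∀ x ∈ Ω, ∀ a ∈ U, ‖f t x a‖ ≤ B)
    (hs : ∀ t ∈ Icc 0 T, ∀ x ∈ Ω, ∀ a ∈ U, ‖s t x a‖ ≤ B)
    (hl : ∀ x ∈ Ω, ∀ a ∈ U, |l x a| ≤ B) {t : ℝ} (ht : t ∈ Icc 0 T) {x : E} (hx : x ∈ Ω) (p : E)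
    (A : E →L[ℝ] E) :
    BddAbove ((fun a => genTerm (f t x a) (s t x a) (l x a) p A) '' U) := by
  refine ⟨B * ‖p‖ + ‖A‖ * B ^ 2 + B, ?_⟩
  rintro _ ⟨a, ha, rfl⟩
  exact (abs_le.1 (abs_genTerm_le (hf t ht x hx a ha) (hs t ht x hx a ha) (hl x hx a ha) p A)).2

theorem abs_ctrlHam_le (hU : U.Nonempty)
    (hf : ∀ t ∈ Icc 0 T, ∀ x ∈ Ω, ∀ a ∈ U, ‖f t x a‖ ≤ B)
    (hs : ∀ t ∈ Icc 0 T, ∀ x ∈ Ω, ∀ a ∈ U, ‖s t x a‖ ≤ B)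
    (hl : ∀ x ∈ Ω, ∀ a ∈ U, |l x a| ≤ B) {t : ℝ} (ht : t ∈ Icc 0 T) {x : E} (hx : x ∈ Ω) (p : E)
    (A : E →L[ℝ] E) : |ctrlHam U f s l t x p A| ≤ B * ‖p‖ + ‖A‖ * B ^ 2 + B := by
  have key : ∀ a ∈ U, |genTerm (f t x a) (s t x a) (l x a) p A| ≤ B * ‖p‖ + ‖A‖ * B ^ 2 + B :=
    fun a ha => abs_genTerm_le (hf t ht x hx a ha) (hs t ht x hx a ha) (hl x hx a ha) p A
  rw [abs_le]
  constructor
  · obtain ⟨a, ha⟩ := hU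
    exact (abs_le.1 (key a ha)).1.trans (le_csSup (bddAbove_genTerm hf hs hl ht hx p A)
      (mem_image_of_mem (fun a => genTerm (f t x a) (s t x a) (l x a) p A) ha))
  · refine csSup_le (hU.image _) ?_
    rintro _ ⟨a, ha, rfl⟩
    exact (abs_le.1 (key a ha)).2

theorem ctrlHam_le_add (hU : U.Nonempty)
    (hf : ∀ t ∈ Icc 0 T, ∀ x ∈ Ω, ∀ a ∈ U, ‖f t x a‖ ≤ B)
    (hs : ∀ t ∈ Icc 0 T, ∀ x ∈ Ω, ∀ a ∈ U, ‖s t x a‖ ≤ B)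
    (hl : ∀ x ∈ Ω, ∀ a ∈ U, |l x a| ≤ B)
    (hfL : ∀ t ∈ Icc 0 T, ∀ x ∈ Ω, ∀ y ∈ Ω, ∀ a ∈ U, ‖f t x a - f t y a‖ ≤ L * ‖x - y‖)
    (hsL : ∀ t ∈ Icc 0 T, ∀ x ∈ Ω, ∀ y ∈ Ω, ∀ a ∈ U, ‖s t x a - s t y a‖ ≤ L * ‖x - y‖)
    (hlL : ∀ x ∈ Ω, ∀ y ∈ Ω, ∀ a ∈ U, |l x a - l y a| ≤ L * ‖x - y‖) (hL : 0 ≤ L)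
    {x₀ : E} (hx₀ : x₀ ∈ Ω) (p₀ : E) (A : E →L[ℝ] E) {η : ℝ} (hη : 0 < η) :
    ∃ r > 0, ∀ t ∈ Icc 0 T, ∀ x ∈ Ω, ∀ p, ‖x - x₀‖ < r → ‖p - p₀‖ < r →
      ctrlHam U f s l t x₀ p₀ A ≤ ctrlHam U f s l t x p A + η ∧
      ctrlHam U f s l t x p A ≤ ctrlHam U f s l t x₀ p₀ A + η := by
  set c := |B| + L * ‖p₀‖ + ‖A‖ * |B| * L + L with hc
  have hc0 : 0 ≤ c := by positivity
  refine ⟨η / (c + 1), by positivity, ?_⟩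
  intro t ht x hx p hxr hpr
  have hcη : c * (η / (c + 1)) ≤ η := by
    rw [mul_div_assoc', div_le_iff₀ (by positivity)]; nlinarith
  have key : ∀ a ∈ U, |genTerm (f t x a) (s t x a) (l x a) p A
      - genTerm (f t x₀ a) (s t x₀ a) (l x₀ a) p₀ A| ≤ η := by
    intro a ha
    have hm : L * ‖x - x₀‖ ≤ L * (η / (c + 1)) := mul_le_mul_of_nonneg_left hxr.le hL
    refine (abs_genTerm_sub_le (B := |B|) ((hf t ht x hx a ha).trans (le_abs_self B))
      ((hs t ht x hx a ha).trans (le_abs_self B)) ((hs t ht x₀ hx₀ a ha).trans (le_abs_self B))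
      ((hfL t ht x hx x₀ hx₀ a ha).trans hm) ((hsL t ht x hx x₀ hx₀ a ha).trans hm)
      ((hlL x hx x₀ hx₀ a ha).trans hm) hpr.le A).trans hcη
  constructor
  · exact sSup_image_le_add hU (bddAbove_genTerm hf hs hl ht hx p A) fun a ha => by
      linarith [(abs_le.1 (key a ha)).1]
  · exact sSup_image_le_add hU (bddAbove_genTerm hf hs hl ht hx₀ p₀ A) fun a ha => by
      linarith [(abs_le.1 (key a ha)).2]

/-- Comparison principle for the Hamilton-Jacobi-Bellman equation on a bounded domain, for strict
subsolutions. The second function plays the role of the negative of a supersolution. -/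
theorem add_nonpos_of_ctrlHam [FiniteDimensional ℝ E] {K : Set E} {u w : ℝ → E → ℝ}
    (hU : U.Nonempty)
    (hf : ∀ t ∈ Icc 0 T, ∀ x ∈ Ω, ∀ a ∈ U, ‖f t x a‖ ≤ B)
    (hs : ∀ t ∈ Icc 0 T, ∀ x ∈ Ω, ∀ a ∈ U, ‖s t x a‖ ≤ B)
    (hl : ∀ x ∈ Ω, ∀ a ∈ U, |l x a| ≤ B)
    (hfL : ∀ t ∈ Icc 0 T, ∀ x ∈ Ω, ∀ y ∈ Ω, ∀ a ∈ U, ‖f t x a - f t y a‖ ≤ L * ‖x - y‖)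
    (hsL : ∀ t ∈ Icc 0 T, ∀ x ∈ Ω, ∀ y ∈ Ω, ∀ a ∈ U, ‖s t x a - s t y a‖ ≤ L * ‖x - y‖)
    (hlL : ∀ x ∈ Ω, ∀ y ∈ Ω, ∀ a ∈ U, |l x a - l y a| ≤ L * ‖x - y‖) (hL : 0 ≤ L)
    (hK : IsCompact K) (hΩ : IsOpen Ω) (hΩK : Ω ⊆ K)
    (hu : Continuous (↿u)) (hw : Continuous (↿w)) {κ : ℝ} (hκ : 0 < κ)
    (hsu : IsParabolicSub T Ω u fun t x p A => κ + ctrlHam U f s l t x p A)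
    (hsw : IsParabolicSub T Ω w fun t x p A => κ - ctrlHam U f s l t x (-p) (-A))
    (hbd : ∀ t ∈ Icc 0 T, ∀ x ∈ K, (x ∉ Ω ∨ t = T) → u t x + w t x ≤ 0) :
    ∀ t ∈ Icc 0 T, ∀ x ∈ K, u t x + w t x ≤ 0 := by
  refine add_nonpos_of_isParabolicSub hK hΩ hΩK hu hw hsu hsw ?_ ?_ ?_ ?_ hκ
    (C₀ := |B| + L + L ^ 2) (by positivity) ?_ hbd
  · intro x₀ hx₀ p₀ A η hη
    obtain ⟨r, hr, h⟩ := ctrlHam_le_add hU hf hs hl hfL hsL hlL hL hx₀ p₀ A hη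
    refine ⟨r, hr, fun t ht x hx p hxr hpr => ?_⟩
    linarith [(h t ht x hx p hxr hpr).1]
  · intro x₀ hx₀ p₀ A η hη
    obtain ⟨r, hr, h⟩ := ctrlHam_le_add hU hf hs hl hfL hsL hlL hL hx₀ (-p₀) (-A) hη
    refine ⟨r, hr, fun t ht x hx p hxr hpr => ?_⟩
    have e : ‖-p - -p₀‖ < r := by rwa [← norm_neg, neg_sub, neg_sub_neg]
    linarith [(h t ht x hx (-p) hxr e).2]
  · intro ρ
    refine ⟨|B| * ρ + ρ * |B| ^ 2 + |B|, fun t ht x hx p A hp hA => ?_⟩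
    have h := (abs_le.1 (abs_ctrlHam_le hU hf hs hl ht hx p A)).1
    have hB := le_abs_self B
    have h1 : B * ‖p‖ ≤ |B| * ρ := mul_le_mul hB hp (norm_nonneg _) (abs_nonneg _)
    have h2 : ‖A‖ * B ^ 2 ≤ ρ * |B| ^ 2 := by
      rw [sq_abs]; exact mul_le_mul_of_nonneg_right hA (sq_nonneg _)
    linarith
  · intro ρ
    refine ⟨|B| * ρ + ρ * |B| ^ 2 + |B|, fun t ht x hx p A hp hA => ?_⟩
    have h := (abs_le.1 (abs_ctrlHam_le hU hf hs hl ht hx (-p) (-A))).2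
    rw [norm_neg, norm_neg] at h
    have hB := le_abs_self B
    have h1 : B * ‖p‖ ≤ |B| * ρ := mul_le_mul hB hp (norm_nonneg _) (abs_nonneg _)
    have h2 : ‖A‖ * B ^ 2 ≤ ρ * |B| ^ 2 := by
      rw [sq_abs]; exact mul_le_mul_of_nonneg_right hA (sq_nonneg _)
    linarith
  · intro lam hlam t ht x hx y hy p p' A A' hA hA' hAA
    have key : ctrlHam U f s l t y (-p') (-A') ≤ ctrlHam U f s l t x p A
        + (B * ‖p + p'‖ + L * ‖x - y‖ * ‖p‖ + lam * (L * ‖x - y‖) ^ 2 + L * ‖x - y‖) :=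
      sSup_image_le_add hU (bddAbove_genTerm hf hs hl ht hx p A) fun a ha =>
        genTerm_neg_le hlam.le (hf t ht y hy a ha) (hfL t ht x hx y hy a ha)
          (hsL t ht x hx y hy a ha) (hlL x hx y hy a ha) hAA
    have hB := le_abs_self B
    have h0 := abs_nonneg B
    have n1 := norm_nonneg (x - y)
    have n2 := norm_nonneg p
    have n3 := norm_nonneg (p + p')
    have h1 : B * ‖p + p'‖ ≤ |B| * ‖p + p'‖ := mul_le_mul_of_nonneg_right hB n3
    have a1 : 0 ≤ lam * ‖x - y‖ ^ 2 := by positivity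
    have a2 : 0 ≤ ‖x - y‖ * (1 + ‖p‖) := by positivity
    have b1 : 0 ≤ (|B| + L) * (lam * ‖x - y‖ ^ 2) := by positivity
    have b2 : 0 ≤ (|B| + L ^ 2) * (‖x - y‖ * (1 + ‖p‖)) := by positivity
    have b3 : 0 ≤ (L + L ^ 2) * ‖p + p'‖ := by positivity
    nlinarith

end ControlHamiltonian

section TestFunctions

/-- The growth function `1 + P^(m+2) + ξ^(m+2)`. -/
def growthFn (m : ℕ) (x : Vec3) : ℝ := 1 + x 0 ^ (m + 2) + x 1 ^ (m + 2)

/-- The gradient of `growthFn`. -/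
def growthGrad (m : ℕ) (x : Vec3) : Vec3 :=
  ![(m + 2) * x 0 ^ (m + 1), (m + 2) * x 1 ^ (m + 1), 0]

/-- The Hessian of `growthFn`. -/
def growthHess (m : ℕ) (x : Vec3) : Mat3 :=
  !![(m + 2) * (m + 1) * x 0 ^ m, 0, 0; 0, (m + 2) * (m + 1) * x 1 ^ m, 0; 0, 0, 0]

theorem hasFDerivAt_growthFn (m : ℕ) (x : Vec3) :
    HasFDerivAt (growthFn m) (dotCLM (growthGrad m x)) x := by
  have h0 := (hasFDerivAt_apply (𝕜 := ℝ) (F' := fun _ : Fin 3 => ℝ) 0 x).pow (m + 2)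
  have h1 := (hasFDerivAt_apply (𝕜 := ℝ) (F' := fun _ : Fin 3 => ℝ) 1 x).pow (m + 2)
  refine ((h0.const_add 1).add h1).congr_fderiv ?_
  ext y
  simp [dotCLM, growthGrad, Fin.sum_univ_three]

theorem hasFDerivAt_growthGrad (m : ℕ) (x : Vec3) :
    HasFDerivAt (growthGrad m) (matCLM (growthHess m x)) x := by
  have h0 := ((hasFDerivAt_apply (𝕜 := ℝ) (F' := fun _ : Fin 3 => ℝ) 0 x).pow (m + 1)).const_mul
    ((m : ℝ) + 2)
  have h1 := ((hasFDerivAt_apply (𝕜 := ℝ) (F' := fun _ : Fin 3 => ℝ) 1 x).pow (m + 1)).const_mul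
    ((m : ℝ) + 2)
  rw [hasFDerivAt_pi']
  intro i
  fin_cases i
  · refine h0.congr_fderiv ?_
    ext y
    simp [matCLM, dotCLM, growthHess, Fin.sum_univ_three]
    ring
  · refine h1.congr_fderiv ?_
    ext y
    simp [matCLM, dotCLM, growthHess, Fin.sum_univ_three]
    ring
  · refine (hasFDerivAt_const (0 : ℝ) x).congr_fderiv ?_
    ext y
    simp [matCLM, dotCLM, growthHess, Fin.sum_univ_three]

/-- The quadratic polynomial with centre `c`, gradient `p` and Hessian `M` in coordinates. -/
def quadVec (c p : Vec3) (M : Mat3) (y : Vec3) : ℝ :=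
  p ⬝ᵥ (y - c) + 1 / 2 * ((M *ᵥ (y - c)) ⬝ᵥ (y - c))

theorem hasFDerivAt_quadVec {M : Mat3} (hM : M.IsSymm) (c p y : Vec3) :
    HasFDerivAt (quadVec c p M) (dotCLM (p + M *ᵥ (y - c))) y := by
  have h (i : Fin 3) := (hasFDerivAt_apply (𝕜 := ℝ) (F' := fun _ : Fin 3 => ℝ) i y).sub_const (c i)
  have hm (i : Fin 3) := ((h 0).const_mul (M i 0)).add ((h 1).const_mul (M i 1)) |>.add
    ((h 2).const_mul (M i 2))
  have hp := (((h 0).const_mul (p 0)).add ((h 1).const_mul (p 1))).add ((h 2).const_mul (p 2))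
  have hq := ((((hm 0).mul (h 0)).add ((hm 1).mul (h 1))).add ((hm 2).mul (h 2))).const_mul (1 / 2)
  refine ((hp.add hq).congr_of_eventuallyEq (Eventually.of_forall fun z => ?_)).congr_fderiv ?_
  · simp [quadVec, dotProduct, mulVec, Fin.sum_univ_three]
  ext z
  have h01 := hM.apply 0 1
  have h02 := hM.apply 0 2
  have h12 := hM.apply 1 2
  simp [dotCLM, Fin.sum_univ_three, mulVec, dotProduct, h01, h02, h12]
  ring

theorem hasFDerivAt_add_mulVec (M : Mat3) (c p y : Vec3) :
    HasFDerivAt (fun y => p + M *ᵥ (y - c)) (matCLM M) y := by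
  have h (i : Fin 3) := (hasFDerivAt_apply (𝕜 := ℝ) (F' := fun _ : Fin 3 => ℝ) i y).sub_const (c i)
  rw [hasFDerivAt_pi']
  intro i
  have hm := (((h 0).const_mul (M i 0)).add ((h 1).const_mul (M i 1)) |>.add
    ((h 2).const_mul (M i 2))).const_add (p i)
  have e : (fun y : Vec3 => (p + M *ᵥ (y - c)) i) = fun y =>
      p i + (M i 0 * (y 0 - c 0) + M i 1 * (y 1 - c 1) + M i 2 * (y 2 - c 2)) := by
    ext z
    simp [mulVec, dotProduct, Fin.sum_univ_three]
  rw [e]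
  refine hm.congr_fderiv ?_
  ext z
  simp [matCLM, dotCLM, Fin.sum_univ_three]

/-- The barrier `e^{Λ(T-t)} (1 + P^(m+2) + ξ^(m+2))`. -/
def barrier (T Λ : ℝ) (m : ℕ) (z : ℝ × Vec3) : ℝ :=
  Real.exp (Λ * (T - z.1)) * growthFn m z.2

theorem continuous_growthFn (m : ℕ) : Continuous (growthFn m) := by
  unfold growthFn; fun_prop

theorem continuous_barrier (T Λ : ℝ) (m : ℕ) : Continuous (barrier T Λ m) := by
  unfold barrier
  have := continuous_growthFn m
  fun_prop

theorem continuous_growthGrad (m : ℕ) : Continuous (growthGrad m) :=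
  continuous_iff_continuousAt.2 fun x => (hasFDerivAt_growthGrad m x).continuousAt

theorem continuous_growthHess (m : ℕ) : Continuous (growthHess m) := by
  refine continuous_matrix fun i j => ?_
  fin_cases i <;> fin_cases j <;> simp [growthHess] <;> fun_prop

theorem isC12_add_quadVec_add_barrier {T R H Λ : ℝ} {θ : ℝ → ℝ} (hθ : ContDiff ℝ 1 θ) {M : Mat3}
    (hM : M.IsSymm) (c p : Vec3) (m : ℕ) (d : ℝ) :
    IsC12 T R H (fun z => θ z.1 + quadVec c p M z.2 + d * barrier T Λ m z)
      (fun z => deriv θ z.1 - d * Λ * barrier T Λ m z)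
      (fun z => p + M *ᵥ (z.2 - c) + (d * Real.exp (Λ * (T - z.1))) • growthGrad m z.2)
      (fun z => M + (d * Real.exp (Λ * (T - z.1))) • growthHess m z.2) := by
  have hb := continuous_barrier T Λ m
  have hg := continuous_growthGrad m
  have hh := continuous_growthHess m
  have hq : Continuous (quadVec c p M) :=
    continuous_iff_continuousAt.2 fun x => (hasFDerivAt_quadVec hM c p x).continuousAt
  have hq' : Continuous (fun y => p + M *ᵥ (y - c)) :=
    continuous_iff_continuousAt.2 fun x => (hasFDerivAt_add_mulVec M c p x).continuousAt
  have hθc := hθ.continuous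
  have hθ' := hθ.continuous_deriv le_rfl
  refine ⟨Continuous.continuousOn (by fun_prop), fun z _ => HasDerivAt.hasDerivWithinAt ?_,
    fun z _ => HasFDerivAt.hasFDerivWithinAt ?_, fun z _ => HasFDerivAt.hasFDerivWithinAt ?_,
    Continuous.continuousOn (by fun_prop), Continuous.continuousOn ?_,
    Continuous.continuousOn (by fun_prop)⟩
  · have h1 : HasDerivAt θ (deriv θ z.1) z.1 :=
      (hθ.differentiable one_ne_zero).differentiableAt.hasDerivAt
    have h2 := ((((hasDerivAt_id z.1).const_sub T).const_mul Λ).exp.mul_const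
      (growthFn m z.2)).const_mul d
    refine ((h1.add_const (quadVec c p M z.2)).add h2).congr_deriv ?_
    simp [barrier]
    ring
  · have h1 := ((hasFDerivAt_growthFn m z.2).const_mul (Real.exp (Λ * (T - z.1)))).const_mul d
    refine (((hasFDerivAt_quadVec hM c p z.2).const_add (θ z.1)).add h1).congr_fderiv ?_
    ext y
    simp [dotCLM, Fin.sum_univ_three]
    ring
  · have h1 := (hasFDerivAt_growthGrad m z.2).const_smul (d * Real.exp (Λ * (T - z.1)))
    refine ((hasFDerivAt_add_mulVec M c p z.2).add h1).congr_fderiv ?_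
    ext y i
    simp [matCLM, dotCLM, Fin.sum_univ_three]
    ring
  · exact (hq'.comp continuous_snd).add (by fun_prop)

end TestFunctions

section Coordinates

theorem genTerm_toLp (f s p : Vec3) (l : ℝ) (M : Mat3) :
    genTerm (WithLp.toLp 2 f : EuclideanSpace ℝ (Fin 3)) (WithLp.toLp 2 s) l (WithLp.toLp 2 p)
      (toEuclideanCLM (𝕜 := ℝ) M) =
      -(∑ j, f j * p j) - (1 / 2) * (vecMulVec s s * M).trace - l := by
  simp only [genTerm, toEuclideanCLM_toLp, EuclideanSpace.inner_toLp_toLp]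
  simp [dotProduct, mulVec, trace, vecMulVec, mul_apply, Fin.sum_univ_three]
  ring

theorem quad_toLp (c p y : Vec3) (M : Mat3) :
    quad (WithLp.toLp 2 c : EuclideanSpace ℝ (Fin 3)) (WithLp.toLp 2 p)
      (toEuclideanCLM (𝕜 := ℝ) M) (WithLp.toLp 2 y) = quadVec c p M y := by
  simp only [quad, ← WithLp.toLp_sub, toEuclideanCLM_toLp, EuclideanSpace.inner_toLp_toLp]
  simp [quadVec, dotProduct, mulVec, Fin.sum_univ_three]
  ring

theorem isSymm_of_toEuclideanCLM_symmetric {M : Mat3}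
    (h : ∀ a b : EuclideanSpace ℝ (Fin 3), inner ℝ (toEuclideanCLM (𝕜 := ℝ) M a) b =
      inner ℝ a (toEuclideanCLM (𝕜 := ℝ) M b)) : M.IsSymm := by
  ext i j
  have := h (WithLp.toLp 2 (Pi.single i 1)) (WithLp.toLp 2 (Pi.single j 1))
  simp only [toEuclideanCLM_toLp, EuclideanSpace.inner_toLp_toLp] at this
  simpa using this

theorem norm_toLp_three_le (v : Vec3) :
    ‖(WithLp.toLp 2 v : EuclideanSpace ℝ (Fin 3))‖ ≤ |v 0| + |v 1| + |v 2| := by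
  rw [EuclideanSpace.norm_eq]
  refine Real.sqrt_le_iff.2 ⟨by positivity, ?_⟩
  simp only [Fin.sum_univ_three, Real.norm_eq_abs]
  nlinarith [mul_nonneg (abs_nonneg (v 0)) (abs_nonneg (v 1)),
    mul_nonneg (abs_nonneg (v 0)) (abs_nonneg (v 2)),
    mul_nonneg (abs_nonneg (v 1)) (abs_nonneg (v 2))]

theorem abs_apply_le_norm_three (x : EuclideanSpace ℝ (Fin 3)) (i : Fin 3) : |x i| ≤ ‖x‖ :=
  PiLp.norm_apply_le x i

end Coordinates

namespace HJBData

/-- The standing assumptions (C1), (C2) and the regularity of the time dependent coefficients. -/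
structure Admissible (D : HJBData) (L₁ L₂ : ℝ) : Prop where
  T_pos : 0 < D.T
  R_pos : 0 < D.R
  H_gt : 1 < D.H
  N_pos : 0 < D.N
  C_pos : 0 < D.C
  A_pos : 0 < D.A
  α_pos : 0 < D.α
  β_pos : 0 < D.β
  ϱ_pos : 0 < D.ϱ
  k_pos : 0 < D.k
  γ_pos : 0 < D.γ
  L₁_pos : 0 < L₁
  L₂_pos : 0 < L₂
  lip_b : ∀ t ∈ Icc 0 D.T, ∀ P ∈ Ici D.R, ∀ P' ∈ Ici D.R, ∀ u ∈ D.ctrl,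
    |D.b t P u - D.b t P' u| ≤ L₁ * |P - P'|
  lip_σ : ∀ t ∈ Icc 0 D.T, ∀ P ∈ Ici D.R, ∀ P' ∈ Ici D.R, ∀ u ∈ D.ctrl,
    |D.σ t P u - D.σ t P' u| ≤ L₁ * |P - P'|
  growth : ∀ t ∈ Icc 0 D.T, ∀ P ∈ Ici D.R, ∀ u ∈ D.ctrl,
    |D.b t P u| ^ 2 + |D.σ t P u| ^ 2 ≤ L₂ ^ 2 * (1 + P ^ 2)
  cont_θ : ContinuousOn D.θf (Icc 0 D.T)
  cont_s : ContinuousOn D.sf (Icc 0 D.T)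
  cont_ℓ : ContinuousOn D.ℓf (Icc 0 D.T)
  smooth_ζ : ContDiff ℝ 1 D.ζ
  ζ_mem : ∀ r : ℝ, D.ζ r ∈ Icc (0 : ℝ) 1
  ζ_zero : ∀ r : ℝ, D.H < |r| → D.ζ r = 0

variable {D : HJBData} {L₁ L₂ : ℝ}

theorem Admissible.ctrl_nonempty (h : D.Admissible L₁ L₂) : D.ctrl.Nonempty :=
  ⟨(0, 0), ⟨⟨le_rfl, h.N_pos.le⟩, ⟨le_rfl, h.C_pos.le⟩⟩⟩

theorem Admissible.abs_b_le (h : D.Admissible L₁ L₂) {t P : ℝ} {u : ℝ × ℝ} (ht : t ∈ Icc 0 D.T)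
    (hP : D.R ≤ P) (hu : u ∈ D.ctrl) : |D.b t P u| ≤ L₂ * (1 + P) := by
  have hP0 : 0 < P := h.R_pos.trans_le hP
  have := h.growth t ht P hP u hu
  have h2 := h.L₂_pos
  refine abs_le_of_sq_le_sq' ?_ (by positivity) |> abs_le.2
  nlinarith [sq_abs (D.b t P u), sq_nonneg (|D.σ t P u|), mul_pos (pow_pos h2 2) hP0]

theorem Admissible.abs_σ_le (h : D.Admissible L₁ L₂) {t P : ℝ} {u : ℝ × ℝ} (ht : t ∈ Icc 0 D.T)
    (hP : D.R ≤ P) (hu : u ∈ D.ctrl) : |D.σ t P u| ≤ L₂ * (1 + P) := by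
  have hP0 : 0 < P := h.R_pos.trans_le hP
  have := h.growth t ht P hP u hu
  have h2 := h.L₂_pos
  refine abs_le_of_sq_le_sq' ?_ (by positivity) |> abs_le.2
  nlinarith [sq_abs (D.σ t P u), sq_nonneg (|D.b t P u|), mul_pos (pow_pos h2 2) hP0]

theorem Admissible.exists_time_bound (h : D.Admissible L₁ L₂) :
    ∃ B, 0 ≤ B ∧ ∀ t ∈ Icc 0 D.T, |D.θf t| ≤ B ∧ |D.sf t| ≤ B ∧ |D.ℓf t| ≤ B := by
  obtain ⟨B₁, h₁⟩ := isCompact_Icc.exists_bound_of_continuousOn h.cont_θ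
  obtain ⟨B₂, h₂⟩ := isCompact_Icc.exists_bound_of_continuousOn h.cont_s
  obtain ⟨B₃, h₃⟩ := isCompact_Icc.exists_bound_of_continuousOn h.cont_ℓ
  refine ⟨|B₁| + |B₂| + |B₃|, by positivity, fun t ht => ?_⟩
  have e₁ := (h₁ t ht).trans (le_abs_self _)
  have e₂ := (h₂ t ht).trans (le_abs_self _)
  have e₃ := (h₃ t ht).trans (le_abs_self _)
  rw [Real.norm_eq_abs] at e₁ e₂ e₃
  refine ⟨?_, ?_, ?_⟩ <;> linarith [abs_nonneg B₁, abs_nonneg B₂, abs_nonneg B₃]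

/-- The relative rate `ϱ⁻¹ (Θ + A c^α η^β - ℓ(t))` of the second component of the volatility. -/
def rate (D : HJBData) (t r : ℝ) (u : ℝ × ℝ) : ℝ :=
  D.ϱ⁻¹ * (r + D.A * u.2 ^ D.α * u.1 ^ D.β - D.ℓf t)

theorem vol_one (D : HJBData) (t : ℝ) (x : Vec3) (u : ℝ × ℝ) :
    D.vol t x u 1 = -(D.rate t (x 2) u * x 1) := by
  simp [vol, rate]
  ring

theorem Admissible.exists_rate_bound (h : D.Admissible L₁ L₂) :
    ∃ W, 0 ≤ W ∧ ∀ t ∈ Icc 0 D.T, ∀ r ∈ Icc (-D.H) D.H, ∀ u ∈ D.ctrl, |D.rate t r u| ≤ W := by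
  obtain ⟨B, hB, hb⟩ := h.exists_time_bound
  have hϱ := h.ϱ_pos
  have hA := h.A_pos
  have hC := h.C_pos
  have hN := h.N_pos
  have hH : 0 < D.H := one_pos.trans h.H_gt
  refine ⟨D.ϱ⁻¹ * (D.H + D.A * D.C ^ D.α * D.N ^ D.β + B), by positivity, ?_⟩
  rintro t ht r hr ⟨η, c⟩ ⟨hη, hc⟩
  rw [rate, abs_mul, abs_of_pos (inv_pos.2 hϱ)]
  refine mul_le_mul_of_nonneg_left ?_ (inv_pos.2 hϱ).le
  have h1 : c ^ D.α ≤ D.C ^ D.α := Real.rpow_le_rpow hc.1 hc.2 h.α_pos.le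
  have h2 : η ^ D.β ≤ D.N ^ D.β := Real.rpow_le_rpow hη.1 hη.2 h.β_pos.le
  have h3 : 0 ≤ c ^ D.α := Real.rpow_nonneg hc.1 _
  have h4 : 0 ≤ η ^ D.β := Real.rpow_nonneg hη.1 _
  have h5 : D.A * c ^ D.α * η ^ D.β ≤ D.A * D.C ^ D.α * D.N ^ D.β := by gcongr
  have h6 : 0 ≤ D.A * c ^ D.α * η ^ D.β := by positivity
  have h7 := abs_le.1 (hb t ht).2.2
  have h8 := hr.1
  have h9 := hr.2
  rw [abs_le]
  constructor <;> linarith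

theorem abs_rate_sub_le (hϱ : 0 < D.ϱ) (t r r' : ℝ) (u : ℝ × ℝ) :
    |D.rate t r u - D.rate t r' u| = D.ϱ⁻¹ * |r - r'| := by
  rw [rate, rate, ← mul_sub, abs_mul, abs_of_pos (inv_pos.2 hϱ)]
  congr 2
  ring

theorem Admissible.running_factor_mem (h : D.Admissible L₁ L₂) {u : ℝ × ℝ} (hu : u ∈ D.ctrl) :
    |D.k * u.1 ^ D.γ| ≤ D.k * D.N ^ D.γ := by
  have hk := h.k_pos
  rw [abs_of_nonneg (mul_nonneg hk.le (Real.rpow_nonneg hu.1.1 _))]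
  exact mul_le_mul_of_nonneg_left (Real.rpow_le_rpow hu.1.1 hu.1.2 h.γ_pos.le) hk.le

theorem Admissible.exists_lipschitz_ζ (h : D.Admissible L₁ L₂) :
    ∃ Z, 0 ≤ Z ∧ ∀ r r', |D.ζ r - D.ζ r'| ≤ Z * |r - r'| := by
  have hc : HasCompactSupport D.ζ := by
    refine HasCompactSupport.intro (isCompact_Icc (a := -D.H) (b := D.H)) fun r hr => h.ζ_zero r ?_
    by_contra hcon
    exact hr (abs_le.1 (not_lt.1 hcon))
  obtain ⟨Z, hZ⟩ := h.smooth_ζ.lipschitzWith_of_hasCompactSupport hc one_ne_zero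
  exact ⟨Z, Z.2, fun r r' => by simpa [Real.dist_eq] using hZ.dist_le_mul r r'⟩

theorem Admissible.abs_ζ_le (h : D.Admissible L₁ L₂) (r : ℝ) : |D.ζ r| ≤ 1 := by
  rw [abs_of_nonneg (h.ζ_mem r).1]
  exact (h.ζ_mem r).2

theorem abs_mul_sub_mul_le {a b a' b' A B e f : ℝ} (ha : |a| ≤ A) (hb : |b'| ≤ B)
    (haa : |a - a'| ≤ e) (hbb : |b - b'| ≤ f) : |a * b - a' * b'| ≤ A * f + e * B := by
  have e1 : a * b - a' * b' = a * (b - b') + (a - a') * b' := by ring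
  rw [e1]
  refine (abs_add_le _ _).trans ?_
  rw [abs_mul, abs_mul]
  have := (abs_nonneg _).trans ha
  have := (abs_nonneg _).trans haa
  gcongr

/-- The part of the state space on which the price and the wealth are at most `ρ`. -/
def box (D : HJBData) (ρ : ℝ) : Set Vec3 := {x | x ∈ Qbar D.R D.H ∧ x 0 ≤ ρ ∧ x 1 ≤ ρ}

theorem Admissible.exists_box_bound (h : D.Admissible L₁ L₂) (ρ : ℝ) :
    ∃ B, ∀ t ∈ Icc 0 D.T, ∀ x ∈ D.box ρ, ∀ u ∈ D.ctrl,
      ‖(WithLp.toLp 2 (D.drift t x u) : EuclideanSpace ℝ (Fin 3))‖ ≤ B ∧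
      ‖(WithLp.toLp 2 (D.vol t x u) : EuclideanSpace ℝ (Fin 3))‖ ≤ B ∧ |D.runCost x u| ≤ B := by
  obtain ⟨B, hB, hb⟩ := h.exists_time_bound
  obtain ⟨W, hW, hw⟩ := h.exists_rate_bound
  have hL := h.L₂_pos
  have hk := h.k_pos
  have hN := h.N_pos
  refine ⟨L₂ * (1 + |ρ|) + W * |ρ| + B + D.k * D.N ^ D.γ * |ρ|, ?_⟩
  rintro t ht x ⟨⟨hx0, hx1, hx2⟩, hx0', hx1'⟩ u hu
  have hρ0 : x 0 ≤ |ρ| := hx0'.trans (le_abs_self _)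
  have hρ1 : |x 1| ≤ |ρ| := by rw [abs_of_nonneg hx1]; exact hx1'.trans (le_abs_self _)
  have h1 : |D.b t (x 0) u| ≤ L₂ * (1 + |ρ|) := (h.abs_b_le ht hx0 hu).trans (by gcongr)
  have h2 : |D.σ t (x 0) u| ≤ L₂ * (1 + |ρ|) := (h.abs_σ_le ht hx0 hu).trans (by gcongr)
  have h3 : |D.vol t x u 1| ≤ W * |ρ| := by
    rw [vol_one, abs_neg, abs_mul]
    have := hw t ht _ hx2 u hu
    gcongr
  have hz (a : ℝ) (ha : |a| ≤ B) : |a * D.ζ (x 2)| ≤ B := by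
    rw [abs_mul]
    simpa using mul_le_mul ha (h.abs_ζ_le (x 2)) (abs_nonneg _) hB
  have h4 := hz _ (hb t ht).1
  have h5 := hz _ (hb t ht).2.1
  have h6 : |D.runCost x u| ≤ D.k * D.N ^ D.γ * |ρ| := by
    rw [runCost, abs_mul]
    have := h.running_factor_mem hu
    gcongr
  have p1 : 0 ≤ D.k * D.N ^ D.γ * |ρ| := by positivity
  have p2 : 0 ≤ W * |ρ| := by positivity
  have p3 : 0 ≤ L₂ * (1 + |ρ|) := by positivity
  refine ⟨(norm_toLp_three_le _).trans ?_, (norm_toLp_three_le _).trans ?_, ?_⟩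
  · simp only [drift, cons_val_zero, cons_val_one, cons_val, abs_zero]
    linarith
  · have e0 : D.vol t x u 0 = D.σ t (x 0) u := rfl
    have e2 : D.vol t x u 2 = D.sf t * D.ζ (x 2) := rfl
    rw [e0, e2]
    linarith
  · linarith

theorem Admissible.exists_box_lipschitz (h : D.Admissible L₁ L₂) (ρ : ℝ) :
    ∃ L, 0 ≤ L ∧ ∀ t ∈ Icc 0 D.T, ∀ x y : EuclideanSpace ℝ (Fin 3), x.ofLp ∈ D.box ρ →
      y.ofLp ∈ D.box ρ → ∀ u ∈ D.ctrl,
      ‖(WithLp.toLp 2 (D.drift t x u) : EuclideanSpace ℝ (Fin 3)) -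
        WithLp.toLp 2 (D.drift t y u)‖ ≤ L * ‖x - y‖ ∧
      ‖(WithLp.toLp 2 (D.vol t x u) : EuclideanSpace ℝ (Fin 3)) -
        WithLp.toLp 2 (D.vol t y u)‖ ≤ L * ‖x - y‖ ∧
      |D.runCost x u - D.runCost y u| ≤ L * ‖x - y‖ := by
  obtain ⟨B, hB, hb⟩ := h.exists_time_bound
  obtain ⟨W, hW, hw⟩ := h.exists_rate_bound
  obtain ⟨Z, hZ, hz⟩ := h.exists_lipschitz_ζ
  have hL := h.L₁_pos
  have hk := h.k_pos
  have hN := h.N_pos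
  have hϱ := h.ϱ_pos
  refine ⟨L₁ + (W + D.ϱ⁻¹ * |ρ|) + B * Z + D.k * D.N ^ D.γ, by positivity, ?_⟩
  rintro t ht x y ⟨⟨hx0, hx1, hx2⟩, hx0', hx1'⟩ ⟨⟨hy0, hy1, hy2⟩, hy0', hy1'⟩ u hu
  have hρ1 : |y 1| ≤ |ρ| := by rw [abs_of_nonneg hy1]; exact hy1'.trans (le_abs_self _)
  have hi (i : Fin 3) : |x i - y i| ≤ ‖x - y‖ := abs_apply_le_norm_three (x - y) i
  have h1 : |D.b t (x 0) u - D.b t (y 0) u| ≤ L₁ * ‖x - y‖ :=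
    (h.lip_b t ht _ hx0 _ hy0 u hu).trans (by gcongr; exact hi 0)
  have h2 : |D.σ t (x 0) u - D.σ t (y 0) u| ≤ L₁ * ‖x - y‖ :=
    (h.lip_σ t ht _ hx0 _ hy0 u hu).trans (by gcongr; exact hi 0)
  have h3 : |D.vol t x u 1 - D.vol t y u 1| ≤ (W + D.ϱ⁻¹ * |ρ|) * ‖x - y‖ := by
    rw [vol_one, vol_one, neg_sub_neg, abs_sub_comm]
    refine (abs_mul_sub_mul_le (hw t ht _ hx2 u hu) hρ1 (abs_rate_sub_le hϱ t _ _ u).le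
      (hi 1)).trans ?_
    have : D.ϱ⁻¹ * |x 2 - y 2| * |ρ| ≤ D.ϱ⁻¹ * ‖x - y‖ * |ρ| := by
      gcongr
      exact hi 2
    linarith
  have hzz (a : ℝ) (ha : |a| ≤ B) : |a * D.ζ (x 2) - a * D.ζ (y 2)| ≤ B * Z * ‖x - y‖ := by
    rw [← mul_sub, abs_mul, mul_assoc]
    exact mul_le_mul ha ((hz _ _).trans (by gcongr; exact hi 2)) (abs_nonneg _) hB
  have h4 := hzz _ (hb t ht).1
  have h5 := hzz _ (hb t ht).2.1
  have h6 : |D.runCost x u - D.runCost y u| ≤ D.k * D.N ^ D.γ * ‖x - y‖ := by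
    rw [runCost, runCost, ← mul_sub, abs_mul]
    exact mul_le_mul (h.running_factor_mem hu) (hi 1) (abs_nonneg _) (by positivity)
  have p1 : 0 ≤ D.k * D.N ^ D.γ * ‖x - y‖ := by positivity
  have p2 : 0 ≤ (W + D.ϱ⁻¹ * |ρ|) * ‖x - y‖ := by positivity
  have p3 : 0 ≤ L₁ * ‖x - y‖ := by positivity
  have p4 : 0 ≤ B * Z * ‖x - y‖ := by positivity
  rw [← WithLp.toLp_sub 2 (D.drift t x u), ← WithLp.toLp_sub 2 (D.vol t x u)]
  refine ⟨(norm_toLp_three_le _).trans ?_, (norm_toLp_three_le _).trans ?_, ?_⟩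
  · simp only [Pi.sub_apply, drift, cons_val_zero, cons_val_one, cons_val, sub_zero, abs_zero]
    linarith
  · have e0 (x : Vec3) : D.vol t x u 0 = D.σ t (x 0) u := rfl
    have e2 (x : Vec3) : D.vol t x u 2 = D.sf t * D.ζ (x 2) := rfl
    rw [Pi.sub_apply, Pi.sub_apply, Pi.sub_apply, e0, e2, e0, e2]
    linarith
  · linarith

/-- The generator of the controlled diffusion applied to `growthFn`. -/
def growthGen (D : HJBData) (m : ℕ) (t : ℝ) (x : Vec3) (u : ℝ × ℝ) : ℝ :=
  ∑ j, D.drift t x u j * growthGrad m x j +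
    (1 / 2) * (D.aMat t x u * growthHess m x).trace

theorem Admissible.exists_growthGen_bound (h : D.Admissible L₁ L₂) (m : ℕ) :
    ∃ C, 0 ≤ C ∧ ∀ t ∈ Icc 0 D.T, ∀ x ∈ Qbar D.R D.H, ∀ u ∈ D.ctrl,
      |D.growthGen m t x u| ≤ C * growthFn m x := by
  obtain ⟨W, hW, hw⟩ := h.exists_rate_bound
  have hL := h.L₂_pos
  refine ⟨(m + 2) * (2 * L₂) + 1 / 2 * ((m + 2) * (m + 1) * (4 * L₂ ^ 2 + W ^ 2)),
    by positivity, ?_⟩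
  rintro t ht x ⟨hx0, hx1, hx2⟩ u hu
  have hP : 0 < x 0 := h.R_pos.trans_le hx0
  have e : D.growthGen m t x u = (m + 2) * (D.b t (x 0) u * x 0 ^ (m + 1)) +
      1 / 2 * ((m + 2) * (m + 1) * (D.σ t (x 0) u ^ 2 * x 0 ^ m +
        D.rate t (x 2) u ^ 2 * x 1 ^ (m + 2))) := by
    have e0 : D.vol t x u 0 = D.σ t (x 0) u := rfl
    simp [growthGen, aMat, drift, growthGrad, growthHess, trace, vecMulVec, mul_apply,
      Fin.sum_univ_three, e0, vol_one]
    ring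
  have hpow (j : ℕ) (hj : j ≤ m + 2) : x 0 ^ j ≤ 1 + x 0 ^ (m + 2) := by
    rcases le_total (x 0) 1 with h1 | h1
    · exact (pow_le_one₀ hP.le h1).trans (by linarith [pow_pos hP (m + 2)])
    · exact (pow_le_pow_right₀ h1 hj).trans (by linarith)
  have hξ : 0 ≤ x 1 ^ (m + 2) := by positivity
  have hPp : 0 < x 0 ^ (m + 2) := by positivity
  have hg : 1 + x 0 ^ (m + 2) ≤ growthFn m x := by unfold growthFn; linarith
  have hg' : x 1 ^ (m + 2) ≤ growthFn m x := by unfold growthFn; linarith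
  have hg0 : 0 < growthFn m x := by linarith
  have b1 : |D.b t (x 0) u * x 0 ^ (m + 1)| ≤ 2 * L₂ * growthFn m x := by
    rw [abs_mul, abs_of_pos (pow_pos hP _)]
    calc _ ≤ L₂ * (1 + x 0) * x 0 ^ (m + 1) := by gcongr; exact h.abs_b_le ht hx0 hu
      _ = L₂ * (x 0 ^ (m + 1) + x 0 ^ (m + 2)) := by ring
      _ ≤ L₂ * (growthFn m x + growthFn m x) := by
        gcongr
        · exact (hpow _ (by lia)).trans hg
        · linarith
      _ = _ := by ring
  have b2 : D.σ t (x 0) u ^ 2 * x 0 ^ m ≤ 4 * L₂ ^ 2 * growthFn m x := by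
    calc _ ≤ (L₂ * (1 + x 0)) ^ 2 * x 0 ^ m := by
          gcongr ?_ * _
          exact sq_le_sq.2 ((h.abs_σ_le ht hx0 hu).trans (le_abs_self _))
      _ = L₂ ^ 2 * (x 0 ^ m + 2 * x 0 ^ (m + 1) + x 0 ^ (m + 2)) := by ring
      _ ≤ L₂ ^ 2 * (growthFn m x + 2 * growthFn m x + growthFn m x) := by
        gcongr
        · exact (hpow _ (by lia)).trans hg
        · exact (hpow _ (by lia)).trans hg
        · linarith
      _ = _ := by ring
  have b3 : D.rate t (x 2) u ^ 2 * x 1 ^ (m + 2) ≤ W ^ 2 * growthFn m x := by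
    gcongr ?_ * ?_
    exact sq_le_sq.2 ((hw t ht _ hx2 u hu).trans (le_abs_self _))
  have b4 : 0 ≤ D.σ t (x 0) u ^ 2 * x 0 ^ m := by positivity
  have b5 : 0 ≤ D.rate t (x 2) u ^ 2 * x 1 ^ (m + 2) := by positivity
  rw [e]
  refine (abs_add_le _ _).trans ?_
  rw [abs_mul ((m : ℝ) + 2), abs_mul (1 / 2 : ℝ), abs_mul (((m : ℝ) + 2) * (m + 1)),
    abs_of_nonneg (add_nonneg b4 b5),
    abs_of_pos (by positivity : (0 : ℝ) < m + 2), abs_of_pos (by positivity : (0 : ℝ) < 1 / 2),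
    abs_of_pos (by positivity : (0 : ℝ) < (m + 2) * (m + 1))]
  calc _ ≤ ((m : ℝ) + 2) * (2 * L₂ * growthFn m x) + 1 / 2 * ((m + 2) * (m + 1) *
        (4 * L₂ ^ 2 * growthFn m x + W ^ 2 * growthFn m x)) := by gcongr
    _ = _ := by ring

end HJBData

namespace HJBData

/-- The drift as a vector of the Euclidean space `ℝ³`. -/
def driftL2 (D : HJBData) (t : ℝ) (x : EuclideanSpace ℝ (Fin 3)) (u : ℝ × ℝ) :
    EuclideanSpace ℝ (Fin 3) := WithLp.toLp 2 (D.drift t x.ofLp u)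

/-- The volatility as a vector of the Euclidean space `ℝ³`. -/
def volL2 (D : HJBData) (t : ℝ) (x : EuclideanSpace ℝ (Fin 3)) (u : ℝ × ℝ) :
    EuclideanSpace ℝ (Fin 3) := WithLp.toLp 2 (D.vol t x.ofLp u)

/-- The running cost as a function on the Euclidean space `ℝ³`. -/
def costL2 (D : HJBData) (x : EuclideanSpace ℝ (Fin 3)) (u : ℝ × ℝ) : ℝ := D.runCost x.ofLp u

theorem Ham_eq_ctrlHam (D : HJBData) (t : ℝ) (x z : Vec3) (M : Mat3) :
    D.Ham t x z M = ctrlHam D.ctrl D.driftL2 D.volL2 D.costL2 t (WithLp.toLp 2 x)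
      (WithLp.toLp 2 z) (toEuclideanCLM (𝕜 := ℝ) M) := by
  simp only [Ham, ctrlHam, driftL2, volL2, costL2, genTerm_toLp, aMat]

variable {D : HJBData} {L₁ L₂ : ℝ}

theorem Admissible.Ham_le_add (h : D.Admissible L₁ L₂) {m : ℕ} {C : ℝ} {t : ℝ} {x : Vec3}
    (ht : t ∈ Icc 0 D.T) (hx : x ∈ Qbar D.R D.H)
    (hC : ∀ u ∈ D.ctrl, |D.growthGen m t x u| ≤ C * growthFn m x) (z : Vec3) (M : Mat3) (d : ℝ) :
    D.Ham t x z M ≤ D.Ham t x (z + d • growthGrad m x) (M + d • growthHess m x) +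
      |d| * (C * growthFn m x) := by
  refine sSup_image_le_add h.ctrl_nonempty ?_ fun u hu => ?_
  · obtain ⟨B, hB⟩ := h.exists_box_bound (max (x 0) (x 1))
    have hxb : x ∈ D.box (max (x 0) (x 1)) := ⟨hx, le_max_left _ _, le_max_right _ _⟩
    have := bddAbove_genTerm (U := D.ctrl) (f := D.driftL2) (s := D.volL2) (l := D.costL2)
      (T := D.T) (Ω := {y | y.ofLp ∈ D.box (max (x 0) (x 1))}) (B := B)
      (fun t ht y hy u hu => (hB t ht _ hy u hu).1)
      (fun t ht y hy u hu => (hB t ht _ hy u hu).2.1)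
      (fun y hy u hu => (hB t ‹_› _ hy u hu).2.2) ht (x := WithLp.toLp 2 x) hxb
      (WithLp.toLp 2 (z + d • growthGrad m x))
      (toEuclideanCLM (𝕜 := ℝ) (M + d • growthHess m x))
    simpa only [driftL2, volL2, costL2, genTerm_toLp, aMat] using this
  · have e : -(∑ j, D.drift t x u j * z j) - (1 / 2) * (D.aMat t x u * M).trace - D.runCost x u =
        -(∑ j, D.drift t x u j * (z + d • growthGrad m x) j) -
          (1 / 2) * (D.aMat t x u * (M + d • growthHess m x)).trace - D.runCost x u +
          d * D.growthGen m t x u := by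
      simp only [growthGen, Pi.add_apply, Pi.smul_apply, smul_eq_mul, mul_add,
        Matrix.mul_smul, trace_add, trace_smul, Finset.sum_add_distrib, Finset.mul_sum]
      have : ∀ j, D.drift t x u j * (d * growthGrad m x j) =
        d * (D.drift t x u j * growthGrad m x j) := fun j => by ring
      simp only [this]
      ring
    rw [e]
    refine (add_le_add_iff_left _).2 ?_
    refine (le_abs_self _).trans ?_
    rw [abs_mul]
    gcongr
    exact hC u hu

theorem one_le_growthFn (hR : 0 < D.R) {m : ℕ} {x : Vec3} (hx : x ∈ Qbar D.R D.H) :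
    1 ≤ growthFn m x := by
  have h0 : 0 < x 0 := hR.trans_le hx.1
  have h1 := hx.2.1
  unfold growthFn
  have : 0 ≤ x 0 ^ (m + 2) := by positivity
  have : 0 ≤ x 1 ^ (m + 2) := by positivity
  linarith

theorem Qset_subset_Qbar (R H : ℝ) : Qset R H ⊆ Qbar R H :=
  fun _ hx => ⟨hx.1.le, hx.2.1.le, Ioo_subset_Icc_self hx.2.2⟩

theorem growthFn_le_barrier (hR : 0 < D.R) {Λ : ℝ} (hΛ : 0 ≤ Λ) {m : ℕ} {z : ℝ × Vec3}
    (hz : z ∈ D.dom) : growthFn m z.2 ≤ barrier D.T Λ m z := by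
  have h1 := one_le_growthFn hR (m := m) hz.2
  refine le_mul_of_one_le_left (by linarith) (Real.one_le_exp ?_)
  exact mul_nonneg hΛ (sub_nonneg.2 hz.1.2)

theorem Admissible.subsolution_test (h : D.Admissible L₁ L₂) {m : ℕ} {C : ℝ} (hC0 : 0 ≤ C)
    (hC : ∀ t ∈ Icc 0 D.T, ∀ x ∈ Qbar D.R D.H, ∀ u ∈ D.ctrl,
      |D.growthGen m t x u| ≤ C * growthFn m x) {v : ℝ × Vec3 → ℝ}
    (hv : IsViscositySubsolution D v) {d : ℝ} (hd : 0 ≤ d) {t : ℝ} {x p : Vec3} {M : Mat3}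
    (ht : t ∈ Ioo 0 D.T) (hx : x ∈ Qset D.R D.H) {θ : ℝ → ℝ} (hθ : ContDiff ℝ 1 θ)
    (hM : M.IsSymm)
    (hmax : IsLocalMaxOn (fun z => v z - d * barrier D.T (C + 1) m z - θ z.1 - quadVec x p M z.2)
      D.dom (t, x)) : d + D.Ham t x p M ≤ deriv θ t := by
  have hx' := Qset_subset_Qbar _ _ hx
  have ht' := Ioo_subset_Icc_self ht
  have key := hv.2.2 _ _ _ _ (isC12_add_quadVec_add_barrier (T := D.T) (R := D.R) (H := D.H)
    (Λ := C + 1) hθ hM x p m d) (t, x) ⟨⟨ht.1.le, ht.2⟩, hx⟩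
    (by convert hmax using 2; ring)
  simp only [sub_self, mulVec_zero, add_zero] at key
  have hham := h.Ham_le_add ht' hx' (hC t ht' x hx') p M (d * Real.exp ((C + 1) * (D.T - t)))
  rw [abs_of_nonneg (by positivity)] at hham
  have hbar : d * growthFn m x ≤ d * barrier D.T (C + 1) m (t, x) := by
    gcongr
    exact growthFn_le_barrier h.R_pos (by positivity) (z := (t, x)) ⟨ht', hx'⟩
  have hg : d * 1 ≤ d * growthFn m x := by
    gcongr
    exact one_le_growthFn h.R_pos hx'
  unfold barrier at *
  linarith

theorem Admissible.supersolution_test (h : D.Admissible L₁ L₂) {m : ℕ} {C : ℝ} (hC0 : 0 ≤ C)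
    (hC : ∀ t ∈ Icc 0 D.T, ∀ x ∈ Qbar D.R D.H, ∀ u ∈ D.ctrl,
      |D.growthGen m t x u| ≤ C * growthFn m x) {v : ℝ × Vec3 → ℝ}
    (hv : IsViscositySupersolution D v) {d : ℝ} (hd : 0 ≤ d) {t : ℝ} {x p : Vec3} {M : Mat3}
    (ht : t ∈ Ioo 0 D.T) (hx : x ∈ Qset D.R D.H) {θ : ℝ → ℝ} (hθ : ContDiff ℝ 1 θ)
    (hM : M.IsSymm)
    (hmax : IsLocalMaxOn
      (fun z => -(v z + d * barrier D.T (C + 1) m z) - θ z.1 - quadVec x p M z.2)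
      D.dom (t, x)) : d - D.Ham t x (-p) (-M) ≤ deriv θ t := by
  have hx' := Qset_subset_Qbar _ _ hx
  have ht' := Ioo_subset_Icc_self ht
  have hq (z : Vec3) : quadVec x (-p) (-M) z = -quadVec x p M z := by
    simp only [quadVec, neg_dotProduct, neg_mulVec]
    ring
  have key := hv.2.2 _ _ _ _ (isC12_add_quadVec_add_barrier (T := D.T) (R := D.R) (H := D.H)
    (Λ := C + 1) hθ.neg hM.neg x (-p) m (-d)) (t, x) ⟨⟨ht.1.le, ht.2⟩, hx⟩
    (by
      convert! hmax.neg using 2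
      rw [hq]
      ring)
  have hder : deriv (fun r => -θ r) t = -deriv θ t := deriv.fun_neg
  simp only [sub_self, mulVec_zero, add_zero, hder] at key
  set e := Real.exp ((C + 1) * (D.T - t)) with he
  have hham := h.Ham_le_add ht' hx' (hC t ht' x hx') (-p + (-d * e) • growthGrad m x)
    (-M + (-d * e) • growthHess m x) (d * e)
  rw [abs_of_nonneg (by positivity)] at hham
  have e1 : -p + (-d * e) • growthGrad m x + (d * e) • growthGrad m x = -p := by
    rw [neg_mul, neg_smul, neg_add_cancel_right]
  have e2 : -M + (-d * e) • growthHess m x + (d * e) • growthHess m x = -M := by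
    rw [neg_mul, neg_smul, neg_add_cancel_right]
  rw [e1, e2] at hham
  have hbar : d * growthFn m x ≤ d * barrier D.T (C + 1) m (t, x) := by
    gcongr
    exact growthFn_le_barrier h.R_pos (by positivity) (z := (t, x)) ⟨ht', hx'⟩
  have hg : d * 1 ≤ d * growthFn m x := by
    gcongr
    exact one_le_growthFn h.R_pos hx'
  unfold barrier at *
  linarith

end HJBData

namespace HJBData

variable {D : HJBData} {L₁ L₂ : ℝ}

/-- The lower corner of the truncated state space. -/
def boxLo (D : HJBData) : Vec3 := ![D.R, 0, -D.H]

/-- The upper corner of the truncated state space. -/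
def boxHi (D : HJBData) (ρ : ℝ) : Vec3 := ![ρ, ρ, D.H]

/-- The nearest point projection, in every coordinate, onto the truncated domain. -/
def clamp (D : HJBData) (ρ : ℝ) (z : ℝ × EuclideanSpace ℝ (Fin 3)) : ℝ × Vec3 :=
  (max 0 (min D.T z.1), fun i => max (D.boxLo i) (min (D.boxHi ρ i) (z.2 i)))

/-- The truncated closed state space as a subset of the Euclidean space `ℝ³`. -/
def closedBoxL2 (D : HJBData) (ρ : ℝ) : Set (EuclideanSpace ℝ (Fin 3)) :=
  {x | ∀ i, x i ∈ Icc (D.boxLo i) (D.boxHi ρ i)}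

/-- The truncated open state space as a subset of the Euclidean space `ℝ³`. -/
def openBoxL2 (D : HJBData) (ρ : ℝ) : Set (EuclideanSpace ℝ (Fin 3)) :=
  {x | ∀ i, x i ∈ Ioo (D.boxLo i) (D.boxHi ρ i)}

theorem isCompact_closedBoxL2 (D : HJBData) (ρ : ℝ) : IsCompact (D.closedBoxL2 ρ) := by
  have h : IsCompact (univ.pi fun i => Icc (D.boxLo i) (D.boxHi ρ i)) :=
    isCompact_univ_pi fun i => isCompact_Icc
  have e : D.closedBoxL2 ρ = (EuclideanSpace.equiv (Fin 3) ℝ).toHomeomorph ⁻¹'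
      (univ.pi fun i => Icc (D.boxLo i) (D.boxHi ρ i)) := by
    ext x
    exact mem_univ_pi.symm
  rw [e]
  exact (EuclideanSpace.equiv (Fin 3) ℝ).toHomeomorph.isCompact_preimage.2 h

theorem isOpen_openBoxL2 (D : HJBData) (ρ : ℝ) : IsOpen (D.openBoxL2 ρ) := by
  simp only [openBoxL2, Set.ofPred_forall]
  exact isOpen_iInter_of_finite fun i =>
    isOpen_Ioo.preimage (PiLp.continuous_apply 2 (fun _ : Fin 3 => ℝ) i)

theorem openBoxL2_subset (D : HJBData) (ρ : ℝ) : D.openBoxL2 ρ ⊆ D.closedBoxL2 ρ :=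
  fun _ hx i => Ioo_subset_Icc_self (hx i)

theorem closedBoxL2_mem_box {ρ : ℝ} {x : EuclideanSpace ℝ (Fin 3)} (hx : x ∈ D.closedBoxL2 ρ) :
    x.ofLp ∈ D.box ρ :=
  ⟨⟨(hx 0).1, (hx 1).1, hx 2⟩, (hx 0).2, (hx 1).2⟩

theorem openBoxL2_mem_Qset {ρ : ℝ} {x : EuclideanSpace ℝ (Fin 3)} (hx : x ∈ D.openBoxL2 ρ) :
    x.ofLp ∈ Qset D.R D.H :=
  ⟨(hx 0).1, (hx 1).1, hx 2⟩

theorem continuous_clamp (D : HJBData) (ρ : ℝ) : Continuous (D.clamp ρ) := by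
  unfold clamp
  fun_prop

theorem clamp_mem_dom (hT : 0 ≤ D.T) (hH : 0 ≤ D.H) (ρ : ℝ) (z : ℝ × EuclideanSpace ℝ (Fin 3)) :
    D.clamp ρ z ∈ D.dom := by
  refine ⟨⟨le_max_left _ _, max_le hT (min_le_left _ _)⟩, le_max_left _ _, le_max_left _ _,
    le_max_left _ _, max_le ?_ (min_le_left _ _)⟩
  change -D.H ≤ D.H
  linarith

theorem clamp_eq {ρ t : ℝ} {x : EuclideanSpace ℝ (Fin 3)} (ht : t ∈ Icc 0 D.T)
    (hx : x ∈ D.closedBoxL2 ρ) : D.clamp ρ (t, x) = (t, x.ofLp) := by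
  refine Prod.ext ?_ (funext fun i => ?_)
  · simp [clamp, ht.1, ht.2]
  · simp [clamp, (hx i).1, (hx i).2]

theorem continuous_comp_clamp {v : ℝ × Vec3 → ℝ} (hv : ContinuousOn v D.dom) (hT : 0 ≤ D.T)
    (hH : 0 ≤ D.H) (ρ : ℝ) : Continuous fun z => v (D.clamp ρ z) :=
  hv.comp_continuous (D.continuous_clamp ρ) (clamp_mem_dom hT hH ρ)

theorem isLocalMaxOn_of_clamp {ρ : ℝ} {V : ℝ × Vec3 → ℝ} {θ : ℝ → ℝ} {t : ℝ}
    {x p : EuclideanSpace ℝ (Fin 3)} {M : Mat3} (ht : t ∈ Ioo 0 D.T) (hx : x ∈ D.openBoxL2 ρ)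
    (hmax : IsLocalMax (fun z : ℝ × EuclideanSpace ℝ (Fin 3) =>
      V (D.clamp ρ (z.1, z.2)) - θ z.1 - quad x p (toEuclideanCLM (𝕜 := ℝ) M) z.2) (t, x)) :
    IsLocalMaxOn (fun z => V z - θ z.1 - quadVec x.ofLp p.ofLp M z.2) D.dom (t, x.ofLp) := by
  have hj : Continuous fun z : ℝ × Vec3 =>
      ((z.1, WithLp.toLp 2 z.2) : ℝ × EuclideanSpace ℝ (Fin 3)) :=
    continuous_fst.prodMk ((PiLp.continuous_toLp 2 _).comp continuous_snd)
  have h1 := IsLocalMax.comp_continuous (b := (t, x.ofLp)) hmax hj.continuousAt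
  have hopen : (Ioo 0 D.T ×ˢ D.openBoxL2 ρ) ∈ 𝓝 (t, x) :=
    (isOpen_Ioo.prod (D.isOpen_openBoxL2 ρ)).mem_nhds ⟨ht, hx⟩
  have hev := (hj.continuousAt (x := (t, x.ofLp))).eventually hopen
  refine (Filter.EventuallyEq.isLocalMax_iff ?_).1 h1 |>.on _
  filter_upwards [hev] with z hz
  have e : D.clamp ρ (z.1, WithLp.toLp 2 z.2) = z :=
    clamp_eq (Ioo_subset_Icc_self hz.1) (D.openBoxL2_subset ρ hz.2)
  have hq := quad_toLp x.ofLp p.ofLp z.2 M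
  simp only [Function.comp_apply, e]
  rw [← hq]

theorem Admissible.sub_le_barrier (h : D.Admissible L₁ L₂) {m : ℕ} {C : ℝ} (hC0 : 0 ≤ C)
    (hC : ∀ t ∈ Icc 0 D.T, ∀ x ∈ Qbar D.R D.H, ∀ u ∈ D.ctrl,
      |D.growthGen m t x u| ≤ C * growthFn m x) {v₁ v₂ : ℝ × Vec3 → ℝ}
    (hv₁ : IsViscositySubsolution D v₁) (hv₂ : IsViscositySupersolution D v₂) {d ρ : ℝ}
    (hd : 0 < d)
    (hbd : ∀ t ∈ Icc 0 D.T, ∀ x ∈ D.box ρ, (x 0 = ρ ∨ x 1 = ρ) →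
      v₁ (t, x) - v₂ (t, x) ≤ 2 * d * barrier D.T (C + 1) m (t, x)) :
    ∀ t ∈ Icc 0 D.T, ∀ x ∈ D.box ρ,
      v₁ (t, x) - v₂ (t, x) ≤ 2 * d * barrier D.T (C + 1) m (t, x) := by
  have hT := h.T_pos.le
  have hH : 0 ≤ D.H := zero_le_one.trans h.H_gt.le
  obtain ⟨B, hB⟩ := h.exists_box_bound ρ
  obtain ⟨L, hL0, hL⟩ := h.exists_box_lipschitz ρ
  have hbar := continuous_barrier D.T (C + 1) m
  have hbox : ∀ x ∈ D.openBoxL2 ρ, x.ofLp ∈ D.box ρ :=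
    fun x hx => closedBoxL2_mem_box (D.openBoxL2_subset ρ hx)
  have h0 : (0 : ℝ) ∈ Icc 0 D.T := ⟨le_rfl, hT⟩
  have key := add_nonpos_of_ctrlHam (U := D.ctrl) (f := D.driftL2) (s := D.volL2)
    (l := D.costL2) (T := D.T) (B := B) (L := L) (K := D.closedBoxL2 ρ) (Ω := D.openBoxL2 ρ)
    (u := fun t x => v₁ (D.clamp ρ (t, x)) - d * barrier D.T (C + 1) m (D.clamp ρ (t, x)))
    (w := fun t x => -(v₂ (D.clamp ρ (t, x)) + d * barrier D.T (C + 1) m (D.clamp ρ (t, x))))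
    h.ctrl_nonempty
    (fun t ht x hx a ha => (hB t ht _ (hbox x hx) a ha).1)
    (fun t ht x hx a ha => (hB t ht _ (hbox x hx) a ha).2.1)
    (fun x hx a ha => (hB 0 h0 _ (hbox x hx) a ha).2.2)
    (fun t ht x hx y hy a ha => (hL t ht _ _ (hbox x hx) (hbox y hy) a ha).1)
    (fun t ht x hx y hy a ha => (hL t ht _ _ (hbox x hx) (hbox y hy) a ha).2.1)
    (fun x hx y hy a ha => (hL 0 h0 _ _ (hbox x hx) (hbox y hy) a ha).2.2) hL0
    (D.isCompact_closedBoxL2 ρ) (D.isOpen_openBoxL2 ρ) (D.openBoxL2_subset ρ)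
    (continuous_comp_clamp (v := fun z => v₁ z - d * barrier D.T (C + 1) m z)
      (hv₁.1.sub (by fun_prop)) hT hH ρ)
    (continuous_comp_clamp (v := fun z => -(v₂ z + d * barrier D.T (C + 1) m z))
      (hv₂.1.add (by fun_prop)).neg hT hH ρ) hd ?_ ?_ ?_
  · intro t ht x hx
    have hx' : WithLp.toLp 2 x ∈ D.closedBoxL2 ρ := by
      intro i
      fin_cases i
      exacts [⟨hx.1.1, hx.2.1⟩, ⟨hx.1.2.1, hx.2.2⟩, hx.1.2.2]
    have := key t ht _ hx'
    simp only [clamp_eq ht hx'] at this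
    linarith
  · intro t ht x hx θ hθ p A hA hmax
    obtain ⟨M, rfl⟩ := (toEuclideanCLM (𝕜 := ℝ) (n := Fin 3)).surjective A
    have := h.subsolution_test hC0 hC hv₁ hd.le ht (openBoxL2_mem_Qset hx) hθ
      (isSymm_of_toEuclideanCLM_symmetric hA)
      (isLocalMaxOn_of_clamp (V := fun z => v₁ z - d * barrier D.T (C + 1) m z) ht hx hmax)
    rwa [Ham_eq_ctrlHam] at this
  · intro t ht x hx θ hθ p A hA hmax
    obtain ⟨M, rfl⟩ := (toEuclideanCLM (𝕜 := ℝ) (n := Fin 3)).surjective A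
    have := h.supersolution_test hC0 hC hv₂ hd.le ht (openBoxL2_mem_Qset hx) hθ
      (isSymm_of_toEuclideanCLM_symmetric hA)
      (isLocalMaxOn_of_clamp (V := fun z => -(v₂ z + d * barrier D.T (C + 1) m z)) ht hx hmax)
    rwa [Ham_eq_ctrlHam, map_neg, WithLp.toLp_neg] at this
  · intro t ht x hx hside
    have hxb := closedBoxL2_mem_box hx
    simp only [clamp_eq ht hx]
    have hgoal : v₁ (t, x.ofLp) - v₂ (t, x.ofLp) ≤
        2 * d * barrier D.T (C + 1) m (t, x.ofLp) := by
      by_cases hface : x 0 = ρ ∨ x 1 = ρ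
      · exact hbd t ht _ hxb hface
      push Not at hface
      have hpar : (t, x.ofLp) ∈ D.parBdry := by
        by_cases hxQ : x.ofLp ∈ Qset D.R D.H
        · refine Or.inr ⟨hside.resolve_left (not_not.2 fun i => ?_), hxQ⟩
          fin_cases i
          exacts [⟨hxQ.1, lt_of_le_of_ne hxb.2.1 hface.1⟩,
            ⟨hxQ.2.1, lt_of_le_of_ne hxb.2.2 hface.2⟩, hxQ.2.2]
        · exact Or.inl ⟨ht, hxb.1, hxQ⟩
      have e1 := hv₁.2.1 _ hpar
      have e2 := hv₂.2.1 _ hpar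
      have e3 := growthFn_le_barrier h.R_pos (by positivity : 0 ≤ C + 1) (m := m)
        (z := (t, x.ofLp)) ⟨ht, hxb.1⟩
      have e4 := one_le_growthFn h.R_pos (m := m) hxb.1
      have : 0 ≤ 2 * d * barrier D.T (C + 1) m (t, x.ofLp) :=
        mul_nonneg (by positivity) (by linarith)
      linarith
    linarith

theorem enorm3_le_two_mul {x : Vec3} {ρ : ℝ} (hρ : 0 ≤ ρ) (h : ∀ i, |x i| ≤ ρ) :
    enorm3 x ≤ 2 * ρ := by
  refine Real.sqrt_le_iff.2 ⟨by positivity, ?_⟩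
  have h2 (i) : x i ^ 2 ≤ ρ ^ 2 := sq_le_sq.2 ((h i).trans (le_abs_self ρ))
  rw [Fin.sum_univ_three]
  nlinarith [h2 0, h2 1, h2 2, sq_nonneg ρ]

theorem Admissible.exists_growth_bound (h : D.Admissible L₁ L₂) {v : ℝ × Vec3 → ℝ}
    (hv : ∃ L₀ > (0 : ℝ), ∃ m > (3 : ℝ), ∀ p ∈ D.dom, |v p| ≤ L₀ * (enorm3 p.2 ^ m + 1)) :
    ∃ n₀ : ℕ, ∀ n ≥ n₀, ∃ K : ℝ, ∀ ρ, D.H ≤ ρ → ∀ t ∈ Icc 0 D.T, ∀ x ∈ D.box ρ,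
      |v (t, x)| ≤ K * ρ ^ n := by
  obtain ⟨L₀, hL₀, m, hm, hv⟩ := hv
  refine ⟨⌈m⌉₊, fun n hn => ⟨L₀ * (2 ^ n + 1), fun ρ hρ t ht x hx => ?_⟩⟩
  have hρ1 : 1 ≤ ρ := h.H_gt.le.trans hρ
  have hρ0 : 0 ≤ ρ := by linarith
  have hx0 : 0 ≤ x 0 := h.R_pos.le.trans hx.1.1
  have hen : enorm3 x ≤ 2 * ρ := by
    refine enorm3_le_two_mul hρ0 fun i => ?_
    fin_cases i
    · exact (abs_of_nonneg hx0).trans_le hx.2.1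
    · exact (abs_of_nonneg hx.1.2.1).trans_le hx.2.2
    · exact (abs_le.2 hx.1.2.2).trans hρ
  have hen0 : 0 ≤ enorm3 x := Real.sqrt_nonneg _
  calc |v (t, x)| ≤ L₀ * (enorm3 x ^ m + 1) := hv (t, x) ⟨ht, hx.1⟩
    _ ≤ L₀ * ((2 * ρ) ^ n + 1) := by
      gcongr
      rw [← Real.rpow_natCast]
      exact (Real.rpow_le_rpow hen0 hen (by linarith)).trans
        (Real.rpow_le_rpow_of_exponent_le (by linarith) (Nat.ceil_le.1 hn))
    _ ≤ L₀ * ((2 * ρ) ^ n + ρ ^ n) := by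
      gcongr
      exact one_le_pow₀ hρ1
    _ = _ := by rw [mul_pow]; ring

theorem Admissible.comparison (h : D.Admissible L₁ L₂) {v₁ v₂ : ℝ × Vec3 → ℝ}
    (hv₁ : IsViscositySubsolution D v₁) (hv₂ : IsViscositySupersolution D v₂)
    (hgrow₁ : ∃ L₀ > (0 : ℝ), ∃ m > (3 : ℝ),
      ∀ p ∈ D.dom, |v₁ p| ≤ L₀ * (enorm3 p.2 ^ m + 1))
    (hgrow₂ : ∃ L₀ > (0 : ℝ), ∃ m > (3 : ℝ),
      ∀ p ∈ D.dom, |v₂ p| ≤ L₀ * (enorm3 p.2 ^ m + 1)) :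
    ∀ p ∈ D.dom, v₁ p ≤ v₂ p := by
  rintro ⟨t₀, x₀⟩ ⟨ht₀, hx₀⟩
  obtain ⟨n₁, hn₁⟩ := h.exists_growth_bound hgrow₁
  obtain ⟨n₂, hn₂⟩ := h.exists_growth_bound hgrow₂
  set n := max n₁ n₂ with hn
  obtain ⟨K₁, hK₁⟩ := hn₁ n (le_max_left _ _)
  obtain ⟨K₂, hK₂⟩ := hn₂ n (le_max_right _ _)
  obtain ⟨C, hC0, hC⟩ := h.exists_growthGen_bound n
  have key : ∀ d > 0, v₁ (t₀, x₀) - v₂ (t₀, x₀) ≤ 2 * d * barrier D.T (C + 1) n (t₀, x₀) := by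
    intro d hd
    obtain ⟨ρ, hρ⟩ : ∃ ρ, D.H ≤ ρ ∧ x₀ 0 ≤ ρ ∧ x₀ 1 ≤ ρ ∧ (K₁ + K₂) / (2 * d) ≤ ρ :=
      ⟨max (max D.H (x₀ 0)) (max (x₀ 1) ((K₁ + K₂) / (2 * d))), by simp⟩
    refine h.sub_le_barrier hC0 hC hv₁ hv₂ hd (ρ := ρ) (fun t ht x hx hface => ?_) t₀ ht₀ x₀
      ⟨hx₀, hρ.2.1, hρ.2.2.1⟩
    have hρ1 : 1 ≤ ρ := h.H_gt.le.trans hρ.1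
    have hρ0 : 0 < ρ := by linarith
    have e1 := abs_le.1 (hK₁ ρ hρ.1 t ht x hx)
    have e2 := abs_le.1 (hK₂ ρ hρ.1 t ht x hx)
    have hx0 : 0 ≤ x 0 := h.R_pos.le.trans hx.1.1
    have hx1 : 0 ≤ x 1 := hx.1.2.1
    have hgr : ρ ^ (n + 2) ≤ growthFn n x := by
      have p0 : 0 ≤ x 0 ^ (n + 2) := by positivity
      have p1 : 0 ≤ x 1 ^ (n + 2) := by positivity
      unfold growthFn
      rcases hface with hf | hf
      · rw [← hf]; linarith
      · rw [← hf]; linarith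
    have hbar := growthFn_le_barrier h.R_pos (by positivity : 0 ≤ C + 1) (m := n)
        (z := (t, x)) ⟨ht, hx.1⟩
    have hK : K₁ + K₂ ≤ 2 * d * ρ ^ 2 := by
      have := (div_le_iff₀ (by positivity)).1 hρ.2.2.2
      nlinarith [mul_pos hd hρ0]
    calc v₁ (t, x) - v₂ (t, x) ≤ (K₁ + K₂) * ρ ^ n := by linarith [e1.2, e2.1]
      _ ≤ 2 * d * ρ ^ 2 * ρ ^ n := by gcongr
      _ = 2 * d * ρ ^ (n + 2) := by ring
      _ ≤ _ := by gcongr; exact hgr.trans hbar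
  have hlim : Tendsto (fun d : ℝ => 2 * d * barrier D.T (C + 1) n (t₀, x₀)) (𝓝[>] 0) (𝓝 0) := by
    refine Tendsto.mono_left ?_ nhdsWithin_le_nhds
    have : Continuous fun d : ℝ => 2 * d * barrier D.T (C + 1) n (t₀, x₀) := by fun_prop
    simpa using this.tendsto 0
  have := ge_of_tendsto hlim (eventually_mem_nhdsWithin.mono key)
  linarith

end HJBData

theorem uniqueness_viscosity_solution (D : HJBData)
    (hT : 0 < D.T) (hR : 0 < D.R) (hH : 1 < D.H) (hN : 0 < D.N) (hC : 0 < D.C)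
    (hA : 0 < D.A) (hα : 0 < D.α) (hβ : 0 < D.β) (hϱ : 0 < D.ϱ)
    (hk : 0 < D.k) (hγ : 0 < D.γ)
    (L₁ L₂ : ℝ) (hL₁ : 0 < L₁) (hL₂ : 0 < L₂)
    -- condition (C1)
    (hC1b : ∀ t ∈ Icc 0 D.T, ∀ P ∈ Ici D.R, ∀ P' ∈ Ici D.R, ∀ u ∈ D.ctrl,
      |D.b t P u - D.b t P' u| ≤ L₁ * |P - P'|)
    (hC1σ : ∀ t ∈ Icc 0 D.T, ∀ P ∈ Ici D.R, ∀ P' ∈ Ici D.R, ∀ u ∈ D.ctrl,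
      |D.σ t P u - D.σ t P' u| ≤ L₁ * |P - P'|)
    -- condition (C2)
    (hC2 : ∀ t ∈ Icc 0 D.T, ∀ P ∈ Ici D.R, ∀ u ∈ D.ctrl,
      |D.b t P u| ^ 2 + |D.σ t P u| ^ 2 ≤ L₂ ^ 2 * (1 + P ^ 2))
    -- regularity of the coefficients θ, s̄, ℓ and of the cut-off ζ_H
    (hθ : ContDiffOn ℝ 1 D.θf (Icc 0 D.T))
    (hs : ContDiffOn ℝ 1 D.sf (Icc 0 D.T))
    (hℓ : ContDiffOn ℝ 1 D.ℓf (Icc 0 D.T))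
    (hζ : ContDiff ℝ (⊤ : ℕ∞) D.ζ) (hζ01 : ∀ r : ℝ, D.ζ r ∈ Icc (0 : ℝ) 1)
    (hζone : ∀ r : ℝ, |r| ≤ D.H - 1 → D.ζ r = 1)
    (hζzero : ∀ r : ℝ, D.H < |r| → D.ζ r = 0)
    -- two viscosity solutions with polynomial growth attaining the boundary values
    (v₁ v₂ : ℝ × Vec3 → ℝ)
    (hv₁ : IsViscositySolution D v₁) (hv₂ : IsViscositySolution D v₂)
    (hgrow₁ : ∃ L₀ > (0 : ℝ), ∃ m > (3 : ℝ),
      ∀ p ∈ D.dom, |v₁ p| ≤ L₀ * (enorm3 p.2 ^ m + 1))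
    (hgrow₂ : ∃ L₀ > (0 : ℝ), ∃ m > (3 : ℝ),
      ∀ p ∈ D.dom, |v₂ p| ≤ L₀ * (enorm3 p.2 ^ m + 1))
    (hbd₁ : ∀ p ∈ D.parBdry, v₁ p = -(p.2 0 * p.2 1))
    (hbd₂ : ∀ p ∈ D.parBdry, v₂ p = -(p.2 0 * p.2 1)) :
    ∀ p ∈ D.dom, v₁ p = v₂ p := by
  have h : D.Admissible L₁ L₂ :=
    ⟨hT, hR, hH, hN, hC, hA, hα, hβ, hϱ, hk, hγ, hL₁, hL₂, hC1b, hC1σ, hC2, hθ.continuousOn,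
      hs.continuousOn, hℓ.continuousOn, hζ.of_le (by exact_mod_cast le_top), hζ01, hζzero⟩
  exact fun p hp => le_antisymm (h.comparison hv₁.1 hv₂.2 hgrow₁ hgrow₂ p hp)
    (h.comparison hv₂.1 hv₁.2 hgrow₂ hgrow₁ p hp)
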